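/- arXiv:1702.01058 — 3 statements merged into one kernel-verified Lean document; each statement's English description precedes it below -/
import Mathlib

section
/- For every integer k ≥ 6, the infinite caterpillar of maximum degree 3 admits a k-coloring that is (1 + 1/⌈k/2⌉)⁺-free, i.e., a coloring with k colors in which no factor contains a repetition of exponent strictly greater than 1 + 1/⌈k/2⌉. -/
open SimpleGraph

/-- The word `w` contains a repetition (period `p`, excess `e`) of exponent at least `β`:
`p ++ e` is a contiguous factor of `w`, `p` is nonempty, `e` is a prefix of `p ++ e`,
and the exponent `(|p| + |e|)/|p|` is at least `β`. -/
def HasRepGE {α : Type*} (β : ℝ) (w : List α) : Prop :=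
  ∃ p e : List α, p ≠ [] ∧ (p ++ e) <:+: w ∧ e <+: (p ++ e) ∧
    β ≤ ((p.length : ℝ) + (e.length : ℝ)) / (p.length : ℝ)

/-- The word `w` contains a repetition of exponent strictly greater than `β`. -/
def HasRepGT {α : Type*} (β : ℝ) (w : List α) : Prop :=
  ∃ p e : List α, p ≠ [] ∧ (p ++ e) <:+: w ∧ e <+: (p ++ e) ∧
    β < ((p.length : ℝ) + (e.length : ℝ)) / (p.length : ℝ)

/-- The coloring `c` of the graph `G` is `β⁺`-free: no factor (word read along the vertices of
a non-self-intersecting path) contains a repetition of exponent strictly greater than `β`. -/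
def ColoringFreePlus {V α : Type*} (G : SimpleGraph V) (c : V → α) (β : ℝ) : Prop :=
  ∀ (u v : V) (p : G.Walk u v), p.IsPath → ¬ HasRepGT β (p.support.map c)

/-- Some factor of the colored graph `(G, c)` is a repetition of exponent at least `β`. -/
def ColoringHasRepGE {V α : Type*} (G : SimpleGraph V) (c : V → α) (β : ℝ) : Prop :=
  ∃ (u v : V) (p : G.Walk u v), p.IsPath ∧ HasRepGE β (p.support.map c)

/-- The infinite caterpillar of maximum degree 3: vertex set `ℤ × {false, true}`, where
`(i, false)` is adjacent to `(i+1, false)` and `(i, false)` is adjacent to `(i, true)`. -/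
def InfCaterpillar : SimpleGraph (ℤ × Bool) :=
  SimpleGraph.fromRel (fun a b =>
    (a.2 = false ∧ b.2 = false ∧ b.1 = a.1 + 1) ∨ (a.2 = false ∧ b.2 = true ∧ a.1 = b.1))



/-- Combinatorial condition on a pair of words (spine, leaves) guaranteeing freeness. -/
structure GoodPair (m : ℕ) (s l : ℕ → ℕ) : Prop where
  ss : ∀ p n, 1 ≤ p → 1 ≤ n → (∀ j < p / m + 1, s (n + j) = s (n + j + p)) → False
  ls : ∀ p a, 1 ≤ p → 1 ≤ a → l a = s (a + p - 1) →
    (∀ j < p / m, s (a + j) = s (a + j + p)) → False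
  sl : ∀ p n, 1 ≤ p → 1 ≤ n → (∀ j < p / m, s (n + j) = s (n + j + p)) →
    s (n + p / m) = l (n + p / m + p - 1) → False
  ll : ∀ p a, m ≤ p → 1 ≤ a → l a = s (a + p - 1) →
    (∀ j < p / m - 1, s (a + j) = s (a + j + p)) →
    s (a + p / m - 1) = l (a + p / m - 1 + p - 1) → False
  lz : ∀ p a, 3 ≤ p → p < m → 1 ≤ a → l a = l (a + p - 2) → False

/-- color of a vertex (with nonnegative coordinate) read from the two words -/
def vcol (s l : ℕ → ℕ) (z : ℤ × Bool) : ℕ := if z.2 then l z.1.toNat else s z.1.toNat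

theorem cat_adj {a b : ℤ × Bool} (hab : InfCaterpillar.Adj a b) :
    (a.2 = false ∧ b.2 = false ∧ (b.1 = a.1 + 1 ∨ b.1 = a.1 - 1)) ∨
    (a.2 = false ∧ b.2 = true ∧ a.1 = b.1) ∨ (a.2 = true ∧ b.2 = false ∧ a.1 = b.1) := by
  unfold InfCaterpillar at hab
  rw [SimpleGraph.fromRel_adj] at hab
  obtain ⟨_, h | h⟩ := hab
  · rcases h with ⟨h1, h2, h3⟩ | ⟨h1, h2, h3⟩
    · left; exact ⟨h1, h2, Or.inl h3⟩
    · right; left; exact ⟨h1, h2, h3⟩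
  · rcases h with ⟨h1, h2, h3⟩ | ⟨h1, h2, h3⟩
    · left; exact ⟨h2, h1, Or.inr (by omega)⟩
    · right; right; exact ⟨h2, h1, h3.symm⟩

theorem cat_shift {a b : ℤ × Bool} (hab : InfCaterpillar.Adj a b) (j : ℤ) :
    InfCaterpillar.Adj (a.1 + j, a.2) (b.1 + j, b.2) := by
  unfold InfCaterpillar at hab ⊢
  rw [SimpleGraph.fromRel_adj] at hab ⊢
  obtain ⟨hne, h⟩ := hab
  refine ⟨fun h' => hne ?_, ?_⟩
  · simp only [Prod.mk.injEq, add_left_inj] at h'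
    exact Prod.ext h'.1 h'.2
  · dsimp only
    rcases h with (h | h) | (h | h)
    · exact Or.inl (Or.inl ⟨h.1, h.2.1, by omega⟩)
    · exact Or.inl (Or.inr ⟨h.1, h.2.1, by omega⟩)
    · exact Or.inr (Or.inl ⟨h.1, h.2.1, by omega⟩)
    · exact Or.inr (Or.inr ⟨h.1, h.2.1, by omega⟩)

theorem path_interior {v : ℕ → ℤ × Bool} {ℓ : ℕ}
    (hinj : ∀ i j, i < ℓ → j < ℓ → v i = v j → i = j)
    (hadj : ∀ i, i + 1 < ℓ → InfCaterpillar.Adj (v i) (v (i + 1)))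
    (i : ℕ) (hi : 1 ≤ i) (hi2 : i + 1 < ℓ) : (v i).2 = false := by
  obtain ⟨k, rfl⟩ : ∃ k, i = k + 1 := ⟨i - 1, by omega⟩
  have h1 := cat_adj (hadj k (by omega))
  have h2 := cat_adj (hadj (k + 1) hi2)
  by_contra hne
  have ht : (v (k + 1)).2 = true := by simpa using hne
  have e1 : (v k).2 = false ∧ (v k).1 = (v (k+1)).1 := by
    rcases h1 with h | h | h
    · simp [h.2.1] at ht
    · exact ⟨h.1, h.2.2⟩
    · simp [h.2.1] at ht
  have e2 : (v (k+1+1)).2 = false ∧ (v (k+1)).1 = (v (k+1+1)).1 := by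
    rcases h2 with h | h | h
    · simp [h.1] at ht
    · simp [h.1] at ht
    · exact ⟨h.2.1, h.2.2⟩
  have : v k = v (k + 1 + 1) := by
    apply Prod.ext
    · rw [e1.2, e2.2]
    · rw [e1.1, e2.1]
  have := hinj _ _ (by omega) (by omega) this
  omega

theorem path_up_false {m : ℕ} {s l : ℕ → ℕ} (hm : 2 ≤ m) (hg : GoodPair m s l)
    {v : ℕ → ℤ × Bool} {P : ℕ} (hP : 1 ≤ P)
    (hinj : ∀ i j, i < P + (P / m + 1) → j < P + (P / m + 1) → v i = v j → i = j)
    (hadj : ∀ i, i + 1 < P + (P / m + 1) → InfCaterpillar.Adj (v i) (v (i + 1)))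
    (hpos : ∀ i, i < P + (P / m + 1) → 1 ≤ (v i).1)
    (hmat : ∀ i, i < P / m + 1 → vcol s l (v i) = vcol s l (v (i + P)))
    (hup : ∀ i, i + 1 < P + (P / m + 1) → (v i).2 = false → (v (i + 1)).2 = false →
      (v (i + 1)).1 = (v i).1 + 1) : False := by
  have hinter := fun i h1 h2 => path_interior hinj hadj i h1 h2
  set u := P / m with hu
  have hum : P < m → u = 0 := fun h => Nat.div_eq_of_lt h
  have hum2 : m ≤ P → 1 ≤ u := fun h => Nat.div_pos h (by omega)
  clear_value u
  obtain ⟨A, hA⟩ : ∃ A : ℕ, (A : ℤ) = if (v 0).2 then (v 0).1 - 1 else (v 0).1 := by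
    have := hpos 0 (by omega)
    refine ⟨(if (v 0).2 then (v 0).1 - 1 else (v 0).1).toNat, ?_⟩
    rw [Int.toNat_of_nonneg]
    split_ifs <;> omega
  have hsp : ∀ i, i < P + (u + 1) → (v i).2 = false → (v i).1 = A + i := by
    intro i
    induction i with
    | zero => intro _ h; simp [h] at hA; simp [hA]
    | succ i ih =>
      intro hi hf
      by_cases h0 : (v i).2 = false
      · rw [hup i hi h0 hf, ih (by omega) h0]; push_cast; ring
      · have hz : i = 0 := by
          by_contra hne
          exact h0 (hinter i (by omega) hi)
        subst hz
        have ht : (v 0).2 = true := by simpa using h0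
        have := cat_adj (hadj 0 hi)
        simp [ht, hf] at this
        simp [ht] at hA
        push_cast
        simp at *
        omega
  have csp : ∀ i, i < P + (u + 1) → (v i).2 = false → vcol s l (v i) = s (A + i) := by
    intro i hi hf
    have := hsp i hi hf
    simp only [vcol, hf, this]
    simp
    congr 1
  have c0 : (v 0).2 = true → vcol s l (v 0) = l (A + 1) := by
    intro ht
    simp [ht] at hA
    have : (v 0).1 = ((A + 1 : ℕ) : ℤ) := by push_cast; omega
    simp only [vcol, ht, this]
    simp
  have cl : (v (P + u)).2 = true → vcol s l (v (P + u)) = l (A + (P + u) - 1) := by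
    intro ht
    have h1 := cat_adj (hadj (P + u - 1) (by omega))
    have e : P + u - 1 + 1 = P + u := by omega
    rw [e] at h1
    simp [ht] at h1
    have h2 := hsp (P + u - 1) (by omega) h1.1
    have : (v (P + u)).1 = ((A + (P + u) - 1 : ℕ) : ℤ) := by
      rw [← h1.2, h2]; omega
    simp only [vcol, ht, this]
    simp
  by_cases h0 : (v 0).2 = false
  · have hA1 : 1 ≤ A := by
      have := hsp 0 (by omega) h0
      have := hpos 0 (by omega)
      omega
    by_cases h1 : (v (P + u)).2 = false
    · have hall : ∀ i, i < P + (u + 1) → (v i).2 = false := by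
        intro i hi
        by_cases hi0 : i = 0
        · rw [hi0]; exact h0
        by_cases hi1 : i = P + u
        · rw [hi1]; exact h1
        exact hinter i (by omega) (by omega)
      refine hg.ss P A hP hA1 (fun j hj => ?_)
      rw [← hu] at hj
      have := hmat j hj
      rw [csp j (by omega) (hall _ (by omega)), csp (j + P) (by omega) (hall _ (by omega))] at this
      rw [this]; congr 1; omega
    · have h1' : (v (P + u)).2 = true := by simpa using h1
      have hall : ∀ i, i < P + u → (v i).2 = false := by
        intro i hi
        by_cases hi0 : i = 0
        · rw [hi0]; exact h0
        exact hinter i (by omega) (by omega)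
      refine hg.sl P A hP hA1 (fun j hj => ?_) ?_
      · rw [← hu] at hj
        have := hmat j (by omega)
        rw [csp j (by omega) (hall _ (by omega)), csp (j + P) (by omega) (hall _ (by omega))] at this
        rw [this]; congr 1; omega
      · rw [← hu]
        have := hmat u (by omega)
        rw [csp u (by omega) (hall _ (by omega)), Nat.add_comm u P, cl h1'] at this
        rw [this]; congr 1; omega
  · have h0' : (v 0).2 = true := by simpa using h0
    by_cases h1 : (v (P + u)).2 = false
    · have hall : ∀ i, 1 ≤ i → i < P + (u + 1) → (v i).2 = false := by
        intro i hi0 hi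
        by_cases hi1 : i = P + u
        · rw [hi1]; exact h1
        exact hinter i (by omega) (by omega)
      refine hg.ls P (A + 1) hP (by omega) ?_ (fun j hj => ?_)
      · have := hmat 0 (by omega)
        rw [c0 h0', csp (0 + P) (by omega) (hall _ (by omega) (by omega))] at this
        rw [this]; congr 1; omega
      · rw [← hu] at hj
        have := hmat (1 + j) (by omega)
        rw [csp (1 + j) (by omega) (hall _ (by omega) (by omega)),
          csp (1 + j + P) (by omega) (hall _ (by omega) (by omega))] at this
        rw [Nat.add_assoc A 1 j, this]; congr 1; omega
    · have h1' : (v (P + u)).2 = true := by simpa using h1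
      have hall : ∀ i, 1 ≤ i → i < P + u → (v i).2 = false := by
        intro i hi0 hi
        exact hinter i (by omega) (by omega)
      by_cases hPm : m ≤ P
      · have hu1 := hum2 hPm
        refine hg.ll P (A + 1) hPm (by omega) ?_ (fun j hj => ?_) ?_
        · have := hmat 0 (by omega)
          rw [c0 h0', csp (0 + P) (by omega) (hall _ (by omega) (by omega))] at this
          rw [this]; congr 1; omega
        · rw [← hu] at hj
          have := hmat (1 + j) (by omega)
          rw [csp (1 + j) (by omega) (hall _ (by omega) (by omega)),
            csp (1 + j + P) (by omega) (hall _ (by omega) (by omega))] at this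
          rw [Nat.add_assoc A 1 j, this]; congr 1; omega
        · rw [← hu]
          have := hmat u (by omega)
          rw [csp u (by omega) (hall _ (by omega) (by omega)), Nat.add_comm u P, cl h1'] at this
          rw [show A + 1 + u - 1 = A + u by omega, this]; congr 1; omega
      · have hu0 := hum (by omega)
        subst hu0
        have a0 := cat_adj (hadj 0 (by omega))
        have hP1 : P ≠ 1 := by
          rintro rfl
          simp at h1'
          simp [h0', h1'] at a0
        have hP2 : P ≠ 2 := by
          rintro rfl
          have a1 := cat_adj (hadj 1 (by omega))
          simp at h1'
          simp [h0'] at a0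
          simp [h1'] at a1
          have : v 0 = v 2 := Prod.ext (a0.2.trans a1.2) (h0'.trans h1'.symm)
          have := hinj _ _ (by omega) (by omega) this
          omega
        refine hg.lz P (A + 1) (by omega) (by omega) (by omega) ?_
        have := hmat 0 (by omega)
        rw [c0 h0', Nat.zero_add] at this
        rw [this]
        have h := cl h1'
        rw [Nat.add_zero] at h
        rw [h]; congr 1; omega

theorem path_false {m : ℕ} {s l : ℕ → ℕ} (hm : 2 ≤ m) (hg : GoodPair m s l)
    {v : ℕ → ℤ × Bool} {P : ℕ} (hP : 1 ≤ P)
    (hinj : ∀ i j, i < P + (P / m + 1) → j < P + (P / m + 1) → v i = v j → i = j)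
    (hadj : ∀ i, i + 1 < P + (P / m + 1) → InfCaterpillar.Adj (v i) (v (i + 1)))
    (hpos : ∀ i, i < P + (P / m + 1) → 1 ≤ (v i).1)
    (hmat : ∀ i, i < P / m + 1 → vcol s l (v i) = vcol s l (v (i + P))) : False := by
  have hinter := fun i h1 h2 => path_interior hinj hadj i h1 h2
  set ℓ := P + (P / m + 1) with hℓ
  -- direction is constant
  have hstep : ∀ i, i + 2 < ℓ → (v i).2 = false → (v (i+1)).2 = false → (v (i + 2)).2 = false →
      (v (i + 2)).1 - (v (i + 1)).1 = (v (i + 1)).1 - (v i).1 := by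
    intro i hi f0 f1 f2
    have a0 := cat_adj (hadj i (by omega))
    have a1 := cat_adj (hadj (i + 1) (by omega))
    simp only [Nat.add_assoc, Nat.reduceAdd] at a1
    simp [f0, f1] at a0
    simp [f1, f2] at a1
    have hne : v i ≠ v (i + 2) := fun h => by
      have := hinj _ _ (by omega) (by omega) h
      omega
    have hne1 : (v i).1 ≠ (v (i + 2)).1 := fun h => hne (Prod.ext h (f0.trans f2.symm))
    omega
  have hconst : ∀ d i, i + d + 1 < ℓ → (v i).2 = false → (v (i + 1)).2 = false →
      (v (i + d)).2 = false → (v (i + d + 1)).2 = false →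
      (v (i + d + 1)).1 - (v (i + d)).1 = (v (i + 1)).1 - (v i).1 := by
    intro d
    induction d with
    | zero => intros; rfl
    | succ d ih =>
      intro i hi f0 f1 f2 f3
      by_cases hd : d = 0
      · subst hd
        exact hstep i (by omega) f0 f1 f3
      have hf : (v (i + d)).2 = false := hinter _ (by omega) (by omega)
      have e1 := ih i (by omega) f0 f1 hf f2
      have e2 := hstep (i + d) (by omega) hf f2 f3
      rw [← e1]
      exact e2
  by_cases hup : ∀ i, i + 1 < ℓ → (v i).2 = false → (v (i + 1)).2 = false →
      (v (i + 1)).1 = (v i).1 + 1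
  · exact path_up_false hm hg hP hinj hadj hpos hmat hup
  · push Not at hup
    obtain ⟨i0, hi0, f0, f1, hne⟩ := hup
    have hd0 : (v (i0 + 1)).1 = (v i0).1 - 1 := by
      have a0 := cat_adj (hadj i0 hi0)
      simp [f0, f1] at a0
      omega
    have hdown : ∀ i, i + 1 < ℓ → (v i).2 = false → (v (i + 1)).2 = false →
        (v (i + 1)).1 = (v i).1 - 1 := by
      intro i hi g0 g1
      rcases le_total i i0 with h | h
      · obtain ⟨d, rfl⟩ := Nat.exists_eq_add_of_le h
        have := hconst d i (by omega) g0 g1 f0 f1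
        omega
      · obtain ⟨d, rfl⟩ := Nat.exists_eq_add_of_le h
        have := hconst d i0 (by omega) f0 f1 g0 g1
        omega
    refine path_up_false (v := fun i => v (ℓ - 1 - i)) hm hg hP ?_ ?_ ?_ ?_ ?_
    · intro i j hi hj h
      have := hinj _ _ (by omega) (by omega) h
      omega
    · intro i hi
      have := hadj (ℓ - 1 - (i + 1)) (by omega)
      rw [show ℓ - 1 - (i + 1) + 1 = ℓ - 1 - i by omega] at this
      exact this.symm
    · intro i hi
      exact hpos _ (by omega)
    · intro i hi
      have := hmat (P / m - i) (by omega)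
      rw [show ℓ - 1 - i = P / m - i + P by omega, show ℓ - 1 - (i + P) = P / m - i by omega]
      exact this.symm
    · intro i hi g0 g1
      have := hdown (ℓ - 1 - (i + 1)) (by omega) g1
        (by rw [show ℓ - 1 - (i + 1) + 1 = ℓ - 1 - i by omega]; exact g0)
      rw [show ℓ - 1 - (i + 1) + 1 = ℓ - 1 - i by omega] at this
      omega

theorem glue {k m : ℕ} (hm : 2 ≤ m) {s l : ℕ → ℕ} (S : Finset ℕ) (hS : S.card ≤ k)
    (hs : ∀ n, s n ∈ S) (hl : ∀ n, l n ∈ S) (hg : GoodPair m s l) :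
    ∃ c : ℤ × Bool → Fin k, ColoringFreePlus InfCaterpillar c (1 + 1 / (m : ℝ)) := by
  classical
  have hcol : ∀ z : ℤ × Bool, ∃ a ∈ (S : Set ℕ),
      ∀ᶠ j : ℕ in (Filter.hyperfilter ℕ : Filter ℕ), vcol s l (z.1 + j, z.2) = a := by
    intro z
    rw [← Ultrafilter.eventually_exists_mem_iff S.finite_toSet]
    refine Filter.Eventually.of_forall (fun j => ⟨_, ?_, rfl⟩)
    simp only [vcol]
    split_ifs
    · exact hl _
    · exact hs _
  choose f hfS hf using hcol
  let φ : S ↪ Fin k := S.equivFin.toEmbedding.trans (Fin.castLEEmb hS)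
  refine ⟨fun z => φ ⟨f z, hfS z⟩, ?_⟩
  rintro x y w hw ⟨p, e, hp, ⟨l1, l2, hinf⟩, ⟨e2, hpre⟩, hexp⟩
  have hP : 0 < p.length := List.length_pos_iff.mpr hp
  have hPR : (0 : ℝ) < p.length := by exact_mod_cast hP
  have hmR : (0 : ℝ) < m := by exact_mod_cast (by omega : 0 < m)
  have he : p.length < e.length * m := by
    have h1 : (1 : ℝ) + 1 / m < 1 + e.length / p.length := by
      rwa [add_div, div_self hPR.ne'] at hexp
    have h2 : (1 : ℝ) / m < e.length / p.length := by linarith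
    rw [div_lt_div_iff₀ hmR hPR] at h2
    have : (p.length : ℝ) < ((e.length * m : ℕ) : ℝ) := by push_cast; linarith
    exact_mod_cast this
  set P := p.length with hPdef
  have het : P / m + 1 ≤ e.length := by
    have := (Nat.div_lt_iff_lt_mul (by omega : 0 < m)).mpr he
    omega
  have hlen : l1.length + (P + e.length) + l2.length = w.length + 1 := by
    have := congrArg List.length hinf
    simp only [List.length_append, List.length_map, Walk.length_support] at this
    omega
  set o := l1.length with ho
  -- letters
  have hget : ∀ i, i < P + e.length → (p ++ e)[i]? = some (φ ⟨f (w.getVert (o + i)), hfS _⟩) := by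
    intro i hi
    have h1 : (l1 ++ (p ++ e) ++ l2)[o + i]? = (p ++ e)[i]? := by
      rw [List.append_assoc, List.getElem?_append_right (by omega)]
      rw [List.getElem?_append_left (by simp; omega)]
      congr 1; omega
    rw [← h1, hinf, List.getElem?_map]
    rw [List.getElem?_eq_getElem (by rw [Walk.length_support]; omega)]
    rw [← Walk.getVert_eq_support_getElem w (by omega)]
    rfl
  have hmatf : ∀ i, i < P / m + 1 → f (w.getVert (o + i)) = f (w.getVert (o + (i + P))) := by
    intro i hi
    have h1 : (p ++ e)[i]? = e[i]? := by
      rw [← hpre, List.getElem?_append_left (by omega)]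
    have h2 : (p ++ e)[i + P]? = e[i]? := by
      rw [List.getElem?_append_right (by omega)]
      congr 1; omega
    rw [hget i (by omega)] at h1
    rw [hget (i + P) (by omega), ← h1] at h2
    have h3 := φ.injective (Option.some.inj h2)
    exact (congrArg Subtype.val h3).symm
  -- choose a shift
  have hev : ∀ᶠ j : ℕ in (Filter.hyperfilter ℕ : Filter ℕ), ∀ i ∈ Finset.range (w.length + 1),
      vcol s l ((w.getVert i).1 + j, (w.getVert i).2) = f (w.getVert i) ∧
        1 ≤ (w.getVert i).1 + (j : ℤ) := by
    rw [Filter.eventually_all_finset]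
    intro i _
    refine (hf _).and ?_
    have : ∀ᶠ j : ℕ in Filter.atTop, 1 ≤ (w.getVert i).1 + (j : ℤ) := by
      filter_upwards [Filter.eventually_ge_atTop (1 - (w.getVert i).1).toNat] with j hj
      omega
    rw [← Nat.cofinite_eq_atTop] at this
    exact Filter.hyperfilter_le_cofinite this
  obtain ⟨j, hj⟩ := hev.exists
  refine path_false (v := fun i => ((w.getVert (o + i)).1 + (j : ℤ), (w.getVert (o + i)).2))
    hm hg (P := P) hP ?_ ?_ ?_ ?_
  · intro a b ha hb hab
    simp only [Prod.mk.injEq, add_left_inj] at hab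
    have h1 : w.getVert (o + a) = w.getVert (o + b) := Prod.ext hab.1 hab.2
    have := hw.getVert_injOn (by simp; omega) (by simp; omega) h1
    omega
  · intro i hi
    exact cat_shift (w.adj_getVert_succ (i := o + i) (by omega)) j
  · intro i hi
    exact (hj (o + i) (by simp; omega)).2
  · intro i hi
    rw [(hj (o + i) (by simp; omega)).1, (hj (o + (i + P)) (by simp; omega)).1]
    exact hmatf i hi


/-- Toeplitz-type bit sequence. -/
def tz (G k : ℕ) : Bool := decide ((k / (2 ^ (padicValNat 2 k) * G)) % 2 = 1)

theorem tz_odd {G v k : ℕ} (hk : k % 2 = 1) : tz G (2 ^ v * k) = decide ((k / G) % 2 = 1) := by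
  have hk0 : k ≠ 0 := by omega
  have h1 : padicValNat 2 (2 ^ v * k) = v := by
    rw [padicValNat.mul (by positivity) hk0, padicValNat.prime_pow,
      padicValNat.eq_zero_of_not_dvd (by omega)]
    rfl
  unfold tz
  rw [h1, Nat.mul_div_mul_left _ _ (by positivity)]

theorem tz_small {G k : ℕ} (h : k < G) : tz G k = false := by
  unfold tz
  have h1 : k < 2 ^ (padicValNat 2 k) * G := by
    have : 1 ≤ 2 ^ (padicValNat 2 k) := Nat.one_le_two_pow
    nlinarith
  rw [Nat.div_eq_of_lt h1]
  rfl

theorem tz_window {G : ℕ} (hG : G % 2 = 0) (hG0 : 0 < G) (y a : ℕ) (hy : 1 ≤ y) :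
    ∃ k, a ≤ k ∧ k < a + 2 * y ∧ tz G k ≠ tz G (k + G * y) := by
  obtain ⟨v, y', hodd, hyv⟩ := Nat.exists_eq_two_pow_mul_odd (n := y) (by omega)
  have hV : 0 < 2 ^ v := by positivity
  have hy1 : y' % 2 = 1 := Nat.odd_iff.mp hodd
  -- choose the odd multiple of 2 ^ v
  obtain ⟨k', hk1, hk2, hk3⟩ : ∃ k', k' % 2 = 1 ∧ a ≤ 2 ^ v * k' ∧ 2 ^ v * k' < a + 2 * 2 ^ v := by
    have hd := Nat.div_add_mod (a + 2 ^ v - 1) (2 ^ v)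
    have hm := Nat.mod_lt (a + 2 ^ v - 1) hV
    set c := (a + 2 ^ v - 1) / 2 ^ v
    rcases Nat.mod_two_eq_zero_or_one c with h | h
    · refine ⟨c + 1, by omega, ?_, ?_⟩
      · rw [Nat.mul_add, Nat.mul_one]; omega
      · rw [Nat.mul_add, Nat.mul_one]; omega
    · exact ⟨c, h, by omega, by omega⟩
  refine ⟨2 ^ v * k', hk2, ?_, ?_⟩
  · have : 2 ^ v ≤ y := by
      rw [hyv]; exact Nat.le_mul_of_pos_right _ (by omega)
    omega
  · have e : 2 ^ v * k' + G * y = 2 ^ v * (k' + G * y') := by rw [hyv]; ring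
    have ho : (k' + G * y') % 2 = 1 := by
      have : (G * y') % 2 = 0 := by rw [Nat.mul_mod, hG]; simp
      omega
    rw [e, tz_odd hk1, tz_odd ho, Nat.add_mul_div_left _ _ hG0]
    intro h
    simp only [decide_eq_decide] at h
    omega


/-- color of a slot -/
def slc (s l : ℕ → ℕ) (z : ℕ × Bool) : ℕ := if z.2 then l z.1 else s z.1

/-- the slots of the window at time `i` -/
def inW (m : ℕ) (A : ℕ → Prop) (i : ℕ) (z : ℕ × Bool) : Prop :=
  (z.2 = true ∧ i + 1 ≤ z.1 ∧ z.1 + 2 ≤ i + m) ∨ (z.2 = false ∧ ¬ A z.1 ∧ i ≤ z.1 ∧ z.1 < i + m)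

/-- hold / swap dynamics of the non-`A` letters -/
structure Dyn (m : ℕ) (A : ℕ → Prop) (s l : ℕ → ℕ) : Prop where
  hm : 3 ≤ m
  per : ∀ i, A (i + m) ↔ A i
  stepA : ∀ i, A i → l (i + m - 1) = l (i + 1)
  stepS : ∀ i, ¬ A i → (s (i + m) = s i ∧ l (i + m - 1) = l (i + 1)) ∨
    (s (i + m) = l (i + 1) ∧ l (i + m - 1) = s i)
  start : ∀ z z', inW m A 0 z → inW m A 0 z' → slc s l z = slc s l z' → z = z'

namespace Dyn

variable {m : ℕ} {A : ℕ → Prop} {s l : ℕ → ℕ}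

theorem winj (hd : Dyn m A s l) : ∀ i z z', inW m A i z → inW m A i z' →
    slc s l z = slc s l z' → z = z' := by
  intro i
  induction i with
  | zero => exact hd.start
  | succ i ih =>
    have hm := hd.hm
    have hper := hd.per i
    obtain ⟨σ, hσA, hσ⟩ : ∃ σ : Bool, (A i → σ = false) ∧
        ((¬ A i → s (i + m) = slc s l (if σ then (i + 1, true) else (i, false))) ∧
        l (i + m - 1) = slc s l (if σ then (i, false) else (i + 1, true))) := by
      by_cases hA : A i
      · exact ⟨false, fun _ => rfl, fun h => absurd hA h, by simp [slc, hd.stepA i hA]⟩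
      · rcases hd.stepS i hA with h | h
        · exact ⟨false, fun _ => rfl, fun _ => by simp [slc, h.1], by simp [slc, h.2]⟩
        · exact ⟨true, fun h => absurd h hA, fun _ => by simp [slc, h.1], by simp [slc, h.2]⟩
    let pre : ℕ × Bool → ℕ × Bool := fun z =>
      if z.2 then (if z.1 = i + m - 1 then (if σ then (i, false) else (i + 1, true)) else z)
      else (if z.1 = i + m then (if σ then (i + 1, true) else (i, false)) else z)
    have hcol : ∀ z, inW m A (i + 1) z → slc s l (pre z) = slc s l z := by
      rintro ⟨n, b⟩ hz
      cases b
      · by_cases hn : n = i + m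
        · subst hn
          have : ¬ A i := by
            rcases hz with hz | hz
            · simp at hz
            · rw [← hper]; exact hz.2.1
          simp only [pre, Bool.false_eq_true, if_false, if_true]
          rw [← hσ.1 this]
          simp [slc]
        · simp [pre, hn]
      · by_cases hn : n = i + m - 1
        · subst hn
          simp only [pre, if_true]
          rw [← hσ.2]
          simp [slc]
        · simp [pre, hn]
    have hin : ∀ z, inW m A (i + 1) z → inW m A i (pre z) := by
      rintro ⟨n, b⟩ hz
      cases b
      · simp [inW] at hz
        by_cases hn : n = i + m
        · subst hn
          have hA : ¬ A i := by rw [← hper]; exact hz.1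
          cases σ <;> simp [pre, inW, hA] <;> omega
        · simp [pre, hn, inW, hz.1]; omega
      · simp [inW] at hz
        by_cases hn : n = i + m - 1
        · subst hn
          cases hσ' : σ
          · simp [pre, inW, hσ']; omega
          · have hA : ¬ A i := fun h => by simp [hσA h] at hσ'
            simp [pre, inW, hσ', hA]; omega
        · simp [pre, hn, inW]; omega
    have hinj : ∀ z z', inW m A (i + 1) z → inW m A (i + 1) z' → pre z = pre z' → z = z' := by
      rintro ⟨n, b⟩ ⟨n', b'⟩ hz hz' h
      cases b <;> cases b' <;> simp [inW] at hz hz' <;> simp only [pre] at h <;>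
        cases σ <;> simp at h <;> split_ifs at h <;> simp [Prod.ext_iff] at h ⊢ <;> omega
    intro z z' hz hz' h
    apply hinj z z' hz hz'
    apply ih _ _ (hin z hz) (hin z' hz')
    have hcz := hcol z' hz'
    rw [hcol z hz, hcz, h]

/-- y coordinate of a slot -/
def yc (z : ℕ × Bool) : ℕ := if z.2 then z.1 + 1 else z.1

theorem orbit (hd : Dyn m A s l) (i : ℕ) (z : ℕ × Bool) (hz : inW m A i z) :
    ∀ d, ∃ z', inW m A (i + d) z' ∧ slc s l z' = slc s l z ∧
      ((z' = z) ∨ ∃ r w, 1 ≤ r ∧ yc z' + 2 * w = yc z + r * m ∧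
        (z.2 = false → w + 1 ≤ r) ∧ (z.2 = true → 1 ≤ w ∧ w ≤ r)) := by
  have hm := hd.hm
  intro d
  induction d with
  | zero => exact ⟨z, hz, rfl, Or.inl rfl⟩
  | succ d ih =>
    obtain ⟨z', h1, h2, h3⟩ := ih
    -- one step
    have hstep : ∃ z'', inW m A (i + (d + 1)) z'' ∧ slc s l z'' = slc s l z' ∧
        (z'' = z' ∨ (z'.2 = false ∧ yc z'' = yc z' + m) ∨
          (z'.2 = true ∧ yc z'' + 2 = yc z' + m)) := by
      obtain ⟨n, b⟩ := z'
      set t := i + d with ht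
      have hper := hd.per t
      rw [show i + (d + 1) = t + 1 by omega]
      cases b
      · simp [inW] at h1
        by_cases hn : n = t
        · rw [hn] at h1 ⊢
          rcases hd.stepS t h1.1 with h | h
          · refine ⟨(t + m, false), ?_, ?_, Or.inr (Or.inl ⟨rfl, ?_⟩)⟩
            · simp [inW, hper, h1.1]; omega
            · simp [slc, h.1]
            · simp [yc]
          · refine ⟨(t + m - 1, true), ?_, ?_, Or.inr (Or.inl ⟨rfl, ?_⟩)⟩
            · simp [inW]; omega
            · simp [slc, h.2]
            · simp [yc]; omega
        · exact ⟨(n, false), by simp [inW, h1.1]; omega, rfl, Or.inl rfl⟩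
      · simp [inW] at h1
        by_cases hn : n = t + 1
        · rw [hn] at h1 ⊢
          by_cases hA : A t
          · refine ⟨(t + m - 1, true), ?_, ?_, Or.inr (Or.inr ⟨rfl, ?_⟩)⟩
            · simp [inW]; omega
            · simp [slc, hd.stepA t hA]
            · simp [yc]; omega
          · rcases hd.stepS t hA with h | h
            · refine ⟨(t + m - 1, true), ?_, ?_, Or.inr (Or.inr ⟨rfl, ?_⟩)⟩
              · simp [inW]; omega
              · simp [slc, h.2]
              · simp [yc]; omega
            · refine ⟨(t + m, false), ?_, ?_, Or.inr (Or.inr ⟨rfl, ?_⟩)⟩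
              · simp [inW, hper, hA]; omega
              · simp [slc, h.1]
              · simp [yc]; omega
        · exact ⟨(n, true), by simp [inW]; omega, rfl, Or.inl rfl⟩
    obtain ⟨z'', g1, g2, g3⟩ := hstep
    refine ⟨z'', g1, g2.trans h2, ?_⟩
    rcases g3 with g3 | g3
    · rw [g3]; exact h3
    · right
      rcases h3 with h3 | ⟨r, w, hr, e, e1, e2⟩
      · subst h3
        rcases g3 with ⟨g3, g4⟩ | ⟨g3, g4⟩
        · exact ⟨1, 0, le_refl _, by omega, fun _ => by omega, fun h => by simp [g3] at h⟩
        · exact ⟨1, 1, le_refl _, by omega, fun h => by simp [g3] at h, fun _ => by omega⟩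
      · have em : (r + 1) * m = r * m + m := by ring
        rcases g3 with ⟨g3, g4⟩ | ⟨g3, g4⟩
        · exact ⟨r + 1, w, by omega, by rw [em]; omega,
            fun h => by have := e1 h; omega, fun h => by have := e2 h; omega⟩
        · exact ⟨r + 1, w + 1, by omega, by rw [em]; omega,
            fun h => by have := e1 h; omega, fun h => by have := e2 h; omega⟩

/-- two slots of the same color -/
theorem same (hd : Dyn m A s l) {i i' : ℕ} {z z' : ℕ × Bool} (hz : inW m A i z)
    (hz' : inW m A i' z') (hi : i ≤ i') (hne : z ≠ z') (hc : slc s l z = slc s l z') :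
    ∃ r w, 1 ≤ r ∧ yc z' + 2 * w = yc z + r * m ∧
        (z.2 = false → w + 1 ≤ r) ∧ (z.2 = true → 1 ≤ w ∧ w ≤ r) := by
  obtain ⟨d, rfl⟩ := Nat.exists_eq_add_of_le hi
  obtain ⟨z'', h1, h2, h3⟩ := hd.orbit i z hz d
  have := hd.winj _ _ _ h1 hz' (h2.trans hc)
  subst this
  rcases h3 with h3 | h3
  · exact absurd h3.symm hne
  · exact h3

theorem ss (hd : Dyn m A s l) {n p : ℕ} (hp : 1 ≤ p) (h1 : ¬ A n) (h2 : ¬ A (n + p))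
    (h : s n = s (n + p)) : ∃ r w, 1 ≤ r ∧ w + 1 ≤ r ∧ p + 2 * w = r * m := by
  have hm := hd.hm
  obtain ⟨r, w, hr, e, e1, _⟩ := hd.same (i := n) (i' := n + p) (z := (n, false))
    (z' := (n + p, false)) (by simp [inW, h1]; omega) (by simp [inW, h2]; omega) (by omega)
    (by simp; omega) (by simp [slc, h])
  simp [yc] at e e1
  exact ⟨r, w, hr, e1, by omega⟩

theorem ls (hd : Dyn m A s l) {a p : ℕ} (ha : 1 ≤ a) (hp : 1 ≤ p) (h2 : ¬ A (a + p - 1))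
    (h : l a = s (a + p - 1)) : ∃ r w, 1 ≤ r ∧ w + 1 ≤ r ∧ p + 2 * w = r * m := by
  have hm := hd.hm
  obtain ⟨r, w, hr, e, _, e1⟩ := hd.same (i := a - 1) (i' := a + p - 1) (z := (a, true))
    (z' := (a + p - 1, false)) (by simp [inW]; omega) (by simp [inW, h2]; omega) (by omega)
    (by simp) (by simp [slc, h])
  simp [yc] at e e1
  exact ⟨r, w - 1, hr, by omega, by omega⟩

theorem sl (hd : Dyn m A s l) {n p : ℕ} (hn : 1 ≤ n) (hp : 1 ≤ p) (h1 : ¬ A n)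
    (h : s n = l (n + p - 1)) : ∃ r w, 1 ≤ r ∧ w + 1 ≤ r ∧ p + 2 * w = r * m := by
  have hm := hd.hm
  obtain ⟨r, w, hr, e, e1, _⟩ := hd.same (i := n - 1) (i' := n + p - 2) (z := (n, false))
    (z' := (n + p - 1, true)) (by simp [inW, h1]; omega) (by simp [inW]; omega) (by omega)
    (by simp) (by simp [slc, h])
  simp [yc] at e e1
  exact ⟨r, w, hr, e1, by omega⟩

theorem ll (hd : Dyn m A s l) {a p : ℕ} (ha : 1 ≤ a) (hp : 3 ≤ p)
    (h : l a = l (a + p - 2)) : ∃ r w, 1 ≤ r ∧ w + 1 ≤ r ∧ p + 2 * w = r * m := by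
  have hm := hd.hm
  obtain ⟨r, w, hr, e, _, e1⟩ := hd.same (i := a - 1) (i' := a + p - 3) (z := (a, true))
    (z' := (a + p - 2, true)) (by simp [inW]; omega) (by simp [inW]; omega) (by omega)
    (by simp; omega) (by simp [slc, h])
  simp [yc] at e e1
  exact ⟨r, w - 1, hr, by omega, by omega⟩

end Dyn


/-! ## The general construction (`m ≥ 32`) -/

namespace Gen

/-- ring length -/
def MM (m : ℕ) : ℕ := if m % 2 = 0 then m / 2 + 2 else m + 2
/-- offset -/
def OF (m : ℕ) : ℕ := if m % 2 = 0 then 4 else m / 2 + 4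
/-- number of colours of type `A`, minus one -/
def gg (m : ℕ) : ℕ := (m + 1) / 2
/-- guard columns -/
def isG (m c : ℕ) : Prop := c = 0 ∨ c = m / 4 ∨ c = m / 2 - 2 ∨ (m % 2 = 1 ∧ c = 2)
instance (m c : ℕ) : Decidable (isG m c) := by unfold isG; infer_instance
/-- number of guards which are at least `e` -/
def NN (m e : ℕ) : ℕ := (if e ≤ 0 then 1 else 0) + (if e ≤ m / 4 then 1 else 0) +
  (if e ≤ m / 2 - 2 then 1 else 0) + (if m % 2 = 1 ∧ e ≤ 2 then 1 else 0)
/-- toggle columns -/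
def tg (m r : ℕ) : ℕ := if r = 0 then 4 else if r = 1 then 6 else if r = 2 then m / 4 + 2 else m / 4 + 4
/-- ring position of toggles -/
def io (m r : ℕ) : ℕ := tg m r + OF m - (if r ≤ 1 then 2 else 1)
/-- ring colours -/
def cX (m i : ℕ) : ℕ := gg m + 1 + i
/-- column colours -/
def cB (m c : ℕ) : ℕ := gg m + 1 + MM m + c
/-- bits -/
def bt (m k : ℕ) : Bool := tz (4 * (gg m + 1)) k
/-- colour in the ring of toggle `r` -/
def rc (m r J : ℕ) : ℕ := if bt m (4 * J + r + 1) then cB m (tg m r) else cX m (io m r)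
/-- colour in the column of toggle `r` -/
def cc (m r J : ℕ) : ℕ := if bt m (4 * J + r + 1) then cX m (io m r) else cB m (tg m r)
/-- colour of a ring slot -/
def ring (m P : ℕ) (af : ℕ → Bool) : ℕ :=
  if P % MM m = io m 0 then rc m 0 (P / MM m + (af 0).toNat)
  else if P % MM m = io m 1 then rc m 1 (P / MM m + (af 1).toNat)
  else if P % MM m = io m 2 then rc m 2 (P / MM m + (af 2).toNat)
  else if P % MM m = io m 3 then rc m 3 (P / MM m + (af 3).toNat)
  else cX m (P % MM m)
/-- spine colour at row `q` and column `2 c + 1` -/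
def sp (m q c : ℕ) : ℕ :=
  if isG m c then ring m (q + (c + OF m - NN m c)) (fun r => decide (c < tg m r))
  else if c = tg m 0 then cc m 0 ((q + MM m - 1) / MM m)
  else if c = tg m 1 then cc m 1 ((q + MM m - 1) / MM m)
  else if c = tg m 2 then cc m 2 ((q + MM m - 1) / MM m)
  else if c = tg m 3 then cc m 3 ((q + MM m - 1) / MM m)
  else cB m c
/-- leaf colour at row `q` and column `2 e` -/
def le (m q e : ℕ) : ℕ := ring m (q + (e + OF m - NN m e) - 1) (fun r => decide (e ≤ tg m r))
/-- leaf colour at row `q` and column `2 o + 1` -/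
def lo (m q o : ℕ) : ℕ := if m % 2 = 0 then gg m + 1 + MM m + m / 2 + (q * (m / 2) + o) % (m / 2 - 1)
  else ring m (q + o) (fun _ => true)
/-- spine -/
def s (m n : ℕ) : ℕ := if (n % m) % 2 = 0 then (n / m * gg m + n % m / 2) % (gg m + 1)
  else sp m (n / m) (n % m / 2)
/-- leaves -/
def l (m n : ℕ) : ℕ := if (n % m) % 2 = 0 then le m (n / m) (n % m / 2) else lo m (n / m) (n % m / 2)

theorem NN_cases {m : ℕ} (hm : 32 ≤ m) (e : ℕ) :
    (m % 2 = 0 ∧ ((e = 0 ∧ NN m e = 3) ∨ (1 ≤ e ∧ e ≤ m / 4 ∧ NN m e = 2) ∨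
      (m / 4 < e ∧ e ≤ m / 2 - 2 ∧ NN m e = 1) ∨ (m / 2 - 2 < e ∧ NN m e = 0))) ∨
    (m % 2 = 1 ∧ ((e = 0 ∧ NN m e = 4) ∨ (1 ≤ e ∧ e ≤ 2 ∧ NN m e = 3) ∨
      (2 < e ∧ e ≤ m / 4 ∧ NN m e = 2) ∨
      (m / 4 < e ∧ e ≤ m / 2 - 2 ∧ NN m e = 1) ∨ (m / 2 - 2 < e ∧ NN m e = 0))) := by
  unfold NN
  split_ifs <;> omega

theorem MO_cases (m : ℕ) : (m % 2 = 0 ∧ MM m = m / 2 + 2 ∧ OF m = 4) ∨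
    (m % 2 = 1 ∧ MM m = m + 2 ∧ OF m = m / 2 + 4) := by
  unfold MM OF
  split_ifs <;> omega

theorem NN_succ {m : ℕ} (hm : 32 ≤ m) (c : ℕ) :
    (isG m c ∧ NN m c = NN m (c + 1) + 1) ∨ (¬ isG m c ∧ NN m c = NN m (c + 1)) := by
  have h1 := NN_cases hm c
  have h2 := NN_cases hm (c + 1)
  unfold isG
  omega

theorem NN_le {m : ℕ} (hm : 32 ≤ m) (c : ℕ) : NN m c ≤ OF m := by
  have h1 := NN_cases hm c
  have h2 := MO_cases m
  omega

theorem tg_vals (m : ℕ) : tg m 0 = 4 ∧ tg m 1 = 6 ∧ tg m 2 = m / 4 + 2 ∧ tg m 3 = m / 4 + 4 := by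
  simp [tg]

theorem io_vals (m : ℕ) : io m 0 = OF m + 2 ∧ io m 1 = OF m + 4 ∧ io m 2 = m / 4 + 1 + OF m ∧
    io m 3 = m / 4 + 3 + OF m := by
  simp [io, tg]; omega

theorem tg_notG {m : ℕ} (hm : 32 ≤ m) (r : ℕ) : ¬ isG m (tg m r) := by
  have h : tg m r = 4 ∨ tg m r = 6 ∨ tg m r = m / 4 + 2 ∨ tg m r = m / 4 + 4 := by
    unfold tg
    split_ifs <;> simp
  unfold isG
  omega

/-- the colour of a ring slot determines its position -/
theorem ring_color {m : ℕ} (hm : 32 ≤ m) (P : ℕ) (af : ℕ → Bool) :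
    ring m P af = cX m (P % MM m) ∨ ∃ r, r < 4 ∧ P % MM m = io m r ∧ ring m P af = cB m (tg m r) := by
  unfold ring rc
  split_ifs with h0 h1 h2 h3 h4 h5 h6 h7
  · right; exact ⟨0, by omega, h0, rfl⟩
  · left; rw [h0]
  · right; exact ⟨1, by omega, h2, rfl⟩
  · left; rw [h2]
  · right; exact ⟨2, by omega, h4, rfl⟩
  · left; rw [h4]
  · right; exact ⟨3, by omega, h6, rfl⟩
  · left; rw [h6]
  · left; rfl

theorem tg_inj {m : ℕ} (hm : 32 ≤ m) {r r' : ℕ} (h : r < 4) (h' : r' < 4)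
    (e : tg m r = tg m r') : r = r' := by
  obtain ⟨a, b, c, d⟩ := tg_vals m
  interval_cases r <;> interval_cases r' <;> omega

theorem io_inj {m : ℕ} (hm : 32 ≤ m) {r r' : ℕ} (h : r < 4) (h' : r' < 4)
    (e : io m r = io m r') : r = r' := by
  obtain ⟨a, b, c, d⟩ := io_vals m
  interval_cases r <;> interval_cases r' <;> omega

theorem io_lt {m : ℕ} (hm : 32 ≤ m) {r : ℕ} (h : r < 4) : io m r < MM m := by
  obtain ⟨a, b, c, d⟩ := io_vals m
  have := MO_cases m
  interval_cases r <;> omega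

theorem MM_pos {m : ℕ} (hm : 32 ≤ m) : 18 ≤ MM m := by
  have := MO_cases m
  omega

theorem ring_inj {m : ℕ} (hm : 32 ≤ m) {P Q : ℕ} {af af' : ℕ → Bool}
    (h : ring m P af = ring m Q af') : P % MM m = Q % MM m := by
  have hM := MM_pos hm
  have h1 := Nat.mod_lt P (show 0 < MM m by omega)
  have h2 := Nat.mod_lt Q (show 0 < MM m by omega)
  rcases ring_color hm P af with hP | ⟨r, hr, e, hP⟩ <;>
  rcases ring_color hm Q af' with hQ | ⟨r', hr', e', hQ⟩ <;> rw [hP, hQ] at h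
  · unfold cX at h; omega
  · unfold cX cB at h; omega
  · unfold cX cB at h; omega
  · have : tg m r = tg m r' := by unfold cB at h; omega
    have hinj3 := tg_inj hm hr hr' this
    rw [e, e', hinj3]

/-- evaluation at a toggle slot -/
theorem ring_io {m : ℕ} (hm : 32 ≤ m) {P r : ℕ} {af : ℕ → Bool} (hr : r < 4)
    (h : P % MM m = io m r) : ring m P af = rc m r (P / MM m + (af r).toNat) := by
  have hne : ∀ r', r' < 4 → r' ≠ r → io m r ≠ io m r' := by
    intro r' hr' hn e
    exact hn (io_inj hm hr hr' e).symm
  unfold ring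
  rw [h]
  interval_cases r
  · simp
  · rw [if_neg (hne 0 (by omega) (by omega))]; simp
  · rw [if_neg (hne 0 (by omega) (by omega)), if_neg (hne 1 (by omega) (by omega))]; simp
  · rw [if_neg (hne 0 (by omega) (by omega)), if_neg (hne 1 (by omega) (by omega)),
      if_neg (hne 2 (by omega) (by omega))]; simp

theorem ring_congr {m P : ℕ} {af af' : ℕ → Bool}
    (h : ∀ r, r < 4 → P % MM m = io m r → af r = af' r) : ring m P af = ring m P af' := by
  unfold ring
  split_ifs with h0 h1 h2 h3
  · rw [h 0 (by omega) h0]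
  · rw [h 1 (by omega) h1]
  · rw [h 2 (by omega) h2]
  · rw [h 3 (by omega) h3]
  · rfl

theorem ring_wrap {m : ℕ} (hm : 32 ≤ m) {P : ℕ} {af af' : ℕ → Bool}
    (h : ∀ r, r < 4 → af r = true) (h' : ∀ r, r < 4 → af' r = false) :
    ring m (P + MM m) af' = ring m P af := by
  have hM := MM_pos hm
  unfold ring
  rw [Nat.add_mod_right, Nat.add_div_right _ (by omega)]
  simp [h, h']

theorem tg_lt {m : ℕ} (hm : 32 ≤ m) (r : ℕ) : 1 ≤ tg m r ∧ tg m r ≤ m / 2 - 3 := by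
  unfold tg
  split_ifs <;> omega

theorem rc_cc {m r : ℕ} (J : ℕ) : (cc m r (J + 1) = cc m r J ∧ rc m r (J + 1) = rc m r J) ∨
    (cc m r (J + 1) = rc m r J ∧ rc m r (J + 1) = cc m r J) := by
  unfold cc rc
  split_ifs <;> simp

theorem sp_tg {m : ℕ} (hm : 32 ≤ m) {r : ℕ} (hr : r < 4) (q : ℕ) :
    sp m q (tg m r) = cc m r ((q + MM m - 1) / MM m) := by
  have hne : ∀ r', r' < 4 → r' ≠ r → tg m r ≠ tg m r' := by
    intro r' hr' hn e
    exact hn (tg_inj hm hr hr' e).symm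
  unfold sp
  rw [if_neg (tg_notG hm r)]
  interval_cases r
  · simp
  · rw [if_neg (hne 0 (by omega) (by omega))]; simp
  · rw [if_neg (hne 0 (by omega) (by omega)), if_neg (hne 1 (by omega) (by omega))]; simp
  · rw [if_neg (hne 0 (by omega) (by omega)), if_neg (hne 1 (by omega) (by omega)),
      if_neg (hne 2 (by omega) (by omega))]; simp

theorem sp_pure {m c q : ℕ} (h : ¬ isG m c) (h' : ∀ r, r < 4 → c ≠ tg m r) :
    sp m q c = cB m c := by
  unfold sp
  rw [if_neg h, if_neg (h' 0 (by omega)), if_neg (h' 1 (by omega)), if_neg (h' 2 (by omega)),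
    if_neg (h' 3 (by omega))]

theorem sp_G {m c q : ℕ} (h : isG m c) :
    sp m q c = ring m (q + (c + OF m - NN m c)) (fun r => decide (c < tg m r)) := by
  unfold sp
  rw [if_pos h]

/-- the step at special times, away from the last column -/
theorem step_sp {m : ℕ} (hm : 32 ≤ m) (q c : ℕ) :
    (sp m (q + 1) c = sp m q c ∧ le m (q + 1) c = le m q (c + 1)) ∨
    (sp m (q + 1) c = le m q (c + 1) ∧ le m (q + 1) c = sp m q c) := by
  have hM := MM_pos hm
  have hle := NN_le hm c
  have hle' := NN_le hm (c + 1)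
  rcases NN_succ hm c with ⟨hG, hN⟩ | ⟨hG, hN⟩
  · right
    rw [sp_G hG, sp_G hG]
    unfold le
    constructor
    · rw [show q + (c + 1 + OF m - NN m (c + 1)) - 1 = q + 1 + (c + OF m - NN m c) by omega]
      rfl
    · rw [show q + 1 + (c + OF m - NN m c) - 1 = q + (c + OF m - NN m c) by omega]
      apply ring_congr
      intro r hr _
      have : c ≠ tg m r := fun e => tg_notG hm r (e ▸ hG)
      simp only [decide_eq_decide]
      omega
  · have e1 : q + (c + 1 + OF m - NN m (c + 1)) - 1 = q + 1 + (c + OF m - NN m c) - 1 := by omega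
    by_cases ht : ∃ r, r < 4 ∧ c = tg m r
    · obtain ⟨r, hr, rfl⟩ := ht
      rw [sp_tg hm hr, sp_tg hm hr]
      unfold le
      rw [e1]
      have hio : io m r = tg m r + OF m - NN m (tg m r) := by
        have h1 := NN_cases hm (tg m r)
        obtain ⟨a, b, c, d⟩ := io_vals m
        obtain ⟨a', b', c', d'⟩ := tg_vals m
        interval_cases r <;> omega
      rw [show q + 1 + (tg m r + OF m - NN m (tg m r)) - 1 = q + io m r by omega]
      have hlt := io_lt hm hr
      by_cases hq : q % MM m = 0
      · obtain ⟨J, rfl⟩ := Nat.dvd_of_mod_eq_zero hq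
        have hmod : (MM m * J + io m r) % MM m = io m r := by
          rw [Nat.mul_add_mod, Nat.mod_eq_of_lt hlt]
        have hdiv : (MM m * J + io m r) / MM m = J := by
          rw [Nat.mul_add_div (by omega), Nat.div_eq_of_lt hlt]; rfl
        rw [ring_io hm hr hmod, ring_io hm hr hmod, hdiv]
        have d1 : (MM m * J + 1 + MM m - 1) / MM m = J + 1 := by
          rw [show MM m * J + 1 + MM m - 1 = MM m * (J + 1) by ring_nf; omega]
          exact Nat.mul_div_cancel_left _ (by omega)
        have d2 : (MM m * J + MM m - 1) / MM m = J := by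
          rw [show MM m * J + MM m - 1 = MM m * J + (MM m - 1) by omega, Nat.mul_add_div (by omega),
            Nat.div_eq_of_lt (by omega)]; rfl
        rw [d1, d2]
        have e2 : (decide (tg m r ≤ tg m r)).toNat = 1 := by simp
        have e3 : (decide (tg m r + 1 ≤ tg m r)).toNat = 0 := by simp
        rw [e2, e3]
        exact rc_cc J
      · left
        constructor
        · congr 1
          have h1 := Nat.div_add_mod q (MM m)
          have h2 := Nat.mod_lt q (show 0 < MM m by omega)
          generalize q % MM m = x at *
          generalize q / MM m = y at *
          subst h1
          rw [show MM m * y + x + 1 + MM m - 1 = MM m * y + (x + MM m) by omega,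
            show MM m * y + x + MM m - 1 = MM m * y + (x - 1 + MM m) by omega,
            Nat.mul_add_div (by omega), Nat.mul_add_div (by omega),
            Nat.add_div_right _ (by omega), Nat.add_div_right _ (by omega),
            Nat.div_eq_of_lt h2, Nat.div_eq_of_lt (by omega)]
        · apply ring_congr
          intro r' hr' hmod
          have hne : r' ≠ r := by
            rintro rfl
            apply hq
            have h2 := Nat.mod_lt q (show 0 < MM m by omega)
            rw [Nat.add_mod, Nat.mod_eq_of_lt hlt] at hmod
            by_cases hx : q % MM m + io m r' < MM m
            · rw [Nat.mod_eq_of_lt hx] at hmod; omega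
            · rw [Nat.mod_eq_sub_mod (by omega), Nat.mod_eq_of_lt (by omega)] at hmod; omega
          have : tg m r' ≠ tg m r := fun e => hne (tg_inj hm hr' hr e)
          simp only [decide_eq_decide]
          omega
    · push Not at ht
      left
      rw [sp_pure hG ht, sp_pure hG ht]
      refine ⟨rfl, ?_⟩
      unfold le
      rw [e1]
      apply ring_congr
      intro r hr _
      have := ht r hr
      simp only [decide_eq_decide]
      omega

theorem s_even {m q a : ℕ} (h : 2 * a < m) : s m (q * m + 2 * a) = (q * gg m + a) % (gg m + 1) := by
  have h1 : (q * m + 2 * a) / m = q := by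
    rw [mul_comm, Nat.mul_add_div (by omega), Nat.div_eq_of_lt h]; rfl
  have h2 : (q * m + 2 * a) % m = 2 * a := by
    rw [mul_comm, Nat.mul_add_mod, Nat.mod_eq_of_lt h]
  unfold s
  rw [h1, h2, if_pos (by omega), show 2 * a / 2 = a by omega]

theorem s_odd {m q a : ℕ} (h : 2 * a + 1 < m) : s m (q * m + (2 * a + 1)) = sp m q a := by
  have h1 : (q * m + (2 * a + 1)) / m = q := by
    rw [mul_comm, Nat.mul_add_div (by omega), Nat.div_eq_of_lt h]; rfl
  have h2 : (q * m + (2 * a + 1)) % m = 2 * a + 1 := by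
    rw [mul_comm, Nat.mul_add_mod, Nat.mod_eq_of_lt h]
  unfold s
  rw [h1, h2, if_neg (by omega), show (2 * a + 1) / 2 = a by omega]

theorem l_even {m q a : ℕ} (h : 2 * a < m) : l m (q * m + 2 * a) = le m q a := by
  have h1 : (q * m + 2 * a) / m = q := by
    rw [mul_comm, Nat.mul_add_div (by omega), Nat.div_eq_of_lt h]; rfl
  have h2 : (q * m + 2 * a) % m = 2 * a := by
    rw [mul_comm, Nat.mul_add_mod, Nat.mod_eq_of_lt h]
  unfold l
  rw [h1, h2, if_pos (by omega), show 2 * a / 2 = a by omega]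

theorem l_odd {m q a : ℕ} (h : 2 * a + 1 < m) : l m (q * m + (2 * a + 1)) = lo m q a := by
  have h1 : (q * m + (2 * a + 1)) / m = q := by
    rw [mul_comm, Nat.mul_add_div (by omega), Nat.div_eq_of_lt h]; rfl
  have h2 : (q * m + (2 * a + 1)) % m = 2 * a + 1 := by
    rw [mul_comm, Nat.mul_add_mod, Nat.mod_eq_of_lt h]
  unfold l
  rw [h1, h2, if_neg (by omega), show (2 * a + 1) / 2 = a by omega]

/-- columns of type `A` -/
def A (m n : ℕ) : Prop := (n % m) % 2 = 0

theorem col_cases {m : ℕ} (hm : 0 < m) (n : ℕ) :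
    (∃ q a, 2 * a < m ∧ n = q * m + 2 * a ∧ A m n) ∨
    (∃ q a, 2 * a + 1 < m ∧ n = q * m + (2 * a + 1) ∧ ¬ A m n) := by
  have h1 := Nat.div_add_mod' n m
  have h2 := Nat.mod_lt n hm
  rcases Nat.mod_two_eq_zero_or_one (n % m) with h | h
  · left; exact ⟨n / m, n % m / 2, by omega, by omega, h⟩
  · right; exact ⟨n / m, n % m / 2, by omega, by omega, by unfold A; omega⟩

theorem A_even {m q a : ℕ} (h : 2 * a < m) : A m (q * m + 2 * a) := by
  have h2 : (q * m + 2 * a) % m = 2 * a := by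
    rw [mul_comm, Nat.mul_add_mod, Nat.mod_eq_of_lt h]
  unfold A; omega

theorem A_odd {m q a : ℕ} (h : 2 * a + 1 < m) : ¬ A m (q * m + (2 * a + 1)) := by
  have h2 : (q * m + (2 * a + 1)) % m = 2 * a + 1 := by
    rw [mul_comm, Nat.mul_add_mod, Nat.mod_eq_of_lt h]
  unfold A; omega

theorem stepA {m : ℕ} (hm : 32 ≤ m) (i : ℕ) (hA : A m i) : l m (i + m - 1) = l m (i + 1) := by
  have hMO := MO_cases m
  rcases col_cases (show 0 < m by omega) i with ⟨q, a, ha, rfl, -⟩ | ⟨q, a, ha, rfl, h⟩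
  swap
  · exact absurd hA h
  rcases hMO with ⟨hp, hMM, hOF⟩ | ⟨hp, hMM, hOF⟩
  · -- even
    have e1 : q * m + 2 * a + 1 = q * m + (2 * a + 1) := by omega
    rw [e1, l_odd (by omega)]
    unfold lo
    rw [if_pos hp]
    obtain ⟨h, rfl⟩ : ∃ h, m = 2 * h := ⟨m / 2, by omega⟩
    have eh : 2 * h / 2 = h := by omega
    rcases Nat.eq_zero_or_pos a with rfl | hpos
    · have e2 : q * (2 * h) + 2 * 0 + 2 * h - 1 = q * (2 * h) + (2 * (h - 1) + 1) := by omega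
      rw [e2, l_odd (by omega)]
      unfold lo
      rw [if_pos hp, eh]
      simp
    · have e2 : q * (2 * h) + 2 * a + 2 * h - 1 = (q + 1) * (2 * h) + (2 * (a - 1) + 1) := by
        have := Nat.add_one_mul q (2 * h)
        omega
      rw [e2, l_odd (by omega)]
      unfold lo
      rw [if_pos hp, eh, show (q + 1) * h + (a - 1) = q * h + a + (h - 1) by have := Nat.add_one_mul q h; omega,
        Nat.add_mod_right]
  · rcases Nat.eq_zero_or_pos a with rfl | hpos
    · have e1 : q * m + 2 * 0 + 1 = q * m + (2 * 0 + 1) := by omega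
      have e2 : q * m + 2 * 0 + m - 1 = q * m + 2 * (m / 2) := by omega
      rw [e1, e2, l_odd (by omega), l_even (by omega)]
      unfold lo le
      rw [if_neg (by omega)]
      have hN := NN_cases hm (m / 2)
      rw [show q + (m / 2 + OF m - NN m (m / 2)) - 1 = q + 0 + MM m by omega]
      apply ring_wrap hm
      · intros; rfl
      · intro r _
        have := tg_lt hm r
        simp only [decide_eq_false_iff_not]
        omega
    · have e2 : q * m + 2 * a + m - 1 = (q + 1) * m + (2 * (a - 1) + 1) := by
        have := Nat.add_one_mul q m; omega
      rw [e2, l_odd (by omega)]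
      by_cases hl : 2 * a + 1 < m
      · have e1 : q * m + 2 * a + 1 = q * m + (2 * a + 1) := by omega
        rw [e1, l_odd hl]
        unfold lo
        rw [if_neg (by omega), if_neg (by omega), show q + 1 + (a - 1) = q + a by omega]
      · have e1 : q * m + 2 * a + 1 = (q + 1) * m + 2 * 0 := by have := Nat.add_one_mul q m; omega
        rw [e1, l_even (by omega)]
        unfold lo le
        rw [if_neg (by omega)]
        have hN := NN_cases hm 0
        rw [show q + 1 + (0 + OF m - NN m 0) - 1 = q + 1 + (a - 1) by omega]
        simp

theorem stepS {m : ℕ} (hm : 32 ≤ m) (i : ℕ) (hA : ¬ A m i) :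
    (s m (i + m) = s m i ∧ l m (i + m - 1) = l m (i + 1)) ∨
    (s m (i + m) = l m (i + 1) ∧ l m (i + m - 1) = s m i) := by
  rcases col_cases (show 0 < m by omega) i with ⟨q, a, ha, rfl, h⟩ | ⟨q, a, ha, rfl, -⟩
  · exact absurd h hA
  have e1 : q * m + (2 * a + 1) + m = (q + 1) * m + (2 * a + 1) := by have := Nat.add_one_mul q m; omega
  have e2 : q * m + (2 * a + 1) + m - 1 = (q + 1) * m + 2 * a := by have := Nat.add_one_mul q m; omega
  rw [e2, e1, s_odd ha, s_odd ha, l_even (by omega)]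
  by_cases hl : 2 * (a + 1) < m
  · have e3 : q * m + (2 * a + 1) + 1 = q * m + 2 * (a + 1) := by omega
    rw [e3, l_even hl]
    exact step_sp hm q a
  · have e3 : q * m + (2 * a + 1) + 1 = (q + 1) * m + 2 * 0 := by have := Nat.add_one_mul q m; omega
    rw [e3, l_even (by omega)]
    have hG : ¬ isG m a := by unfold isG; omega
    have ht : ∀ r, r < 4 → a ≠ tg m r := by
      intro r _
      have := tg_lt hm r
      omega
    left
    rw [sp_pure hG ht, sp_pure hG ht]
    refine ⟨rfl, ?_⟩
    unfold le
    have hMO := MO_cases m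
    have hN := NN_cases hm 0
    have hN' := NN_cases hm a
    rw [show q + 1 + (a + OF m - NN m a) - 1 = (q + 1 + (0 + OF m - NN m 0) - 1) + MM m by omega]
    apply ring_wrap hm
    · intros; simp
    · intro r _
      have := tg_lt hm r
      simp only [decide_eq_false_iff_not]
      omega

end Gen


namespace Gen

theorem ring_init {m P : ℕ} (hm : 32 ≤ m) (hP : P ≤ MM m) (af : ℕ → Bool) :
    ring m P af = cX m (P % MM m) := by
  have hM := MM_pos hm
  have hJ : P / MM m ≤ 1 := by
    have := Nat.div_le_div_right (c := MM m) hP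
    rwa [Nat.div_self (by omega)] at this
  have hb : ∀ r, r < 4 → bt m (4 * (P / MM m + (af r).toNat) + r + 1) = false := by
    intro r hr
    apply tz_small
    have : (af r).toNat ≤ 1 := Bool.toNat_le _
    unfold gg
    omega
  unfold ring rc
  rw [hb 0 (by omega), hb 1 (by omega), hb 2 (by omega), hb 3 (by omega)]
  simp only [Bool.false_eq_true, if_false]
  split_ifs with h0 h1 h2 h3
  · rw [h0]
  · rw [h1]
  · rw [h2]
  · rw [h3]
  · rfl

theorem cc_init {m r : ℕ} (hm : 32 ≤ m) (hr : r < 4) : cc m r ((0 + MM m - 1) / MM m) = cB m (tg m r) := by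
  have hM := MM_pos hm
  rw [Nat.div_eq_of_lt (by omega)]
  have : bt m (4 * 0 + r + 1) = false := by
    apply tz_small
    unfold gg
    omega
  unfold cc
  rw [this]; rfl

/-- the slots of the first window -/
theorem init_slot {m : ℕ} (hm : 32 ≤ m) (z : ℕ × Bool) (hz : inW m (A m) 0 z) :
    (∃ e, 1 ≤ e ∧ 2 * e + 2 ≤ m ∧ z = (2 * e, true) ∧
      slc (s m) (l m) z = cX m ((e + OF m - NN m e - 1) % MM m)) ∨
    (∃ o, 2 * o + 3 ≤ m ∧ m % 2 = 0 ∧ z = (2 * o + 1, true) ∧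
      slc (s m) (l m) z = gg m + 1 + MM m + m / 2 + o) ∨
    (∃ o, 2 * o + 3 ≤ m ∧ m % 2 = 1 ∧ z = (2 * o + 1, true) ∧
      slc (s m) (l m) z = cX m (o % MM m)) ∨
    (∃ c, 2 * c + 1 < m ∧ isG m c ∧ z = (2 * c + 1, false) ∧
      slc (s m) (l m) z = cX m ((c + OF m - NN m c) % MM m)) ∨
    (∃ c, 2 * c + 1 < m ∧ ¬ isG m c ∧ z = (2 * c + 1, false) ∧
      slc (s m) (l m) z = cB m c) := by
  obtain ⟨n, b⟩ := z
  have hMO := MO_cases m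
  cases b
  · rcases hz with ⟨h, -⟩ | ⟨-, hA, -, hn⟩
    · simp at h
    simp only [slc] at *
    rcases col_cases (show 0 < m by omega) n with ⟨q, a, ha, rfl, h⟩ | ⟨q, a, ha, rfl, -⟩
    · exact absurd h hA
    have hq : q = 0 := by
      rcases Nat.eq_zero_or_pos q with h | h
      · exact h
      · have : m ≤ q * m := Nat.le_mul_of_pos_left _ h
        omega
    subst hq
    right; right; right
    simp only [Bool.false_eq_true, if_false]
    rw [s_odd ha]
    by_cases hG : isG m a
    · left
      refine ⟨a, ha, hG, by simp, ?_⟩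
      rw [sp_G hG, ring_init hm]
      · simp
      · have := NN_cases hm a
        unfold isG at hG
        omega
    · right
      refine ⟨a, ha, hG, by simp, ?_⟩
      by_cases ht : ∃ r, r < 4 ∧ a = tg m r
      · obtain ⟨r, hr, rfl⟩ := ht
        rw [sp_tg hm hr, cc_init hm hr]
      · push Not at ht
        rw [sp_pure hG ht]
  · rcases hz with ⟨-, h1, h2⟩ | ⟨h, -⟩
    swap
    · simp at h
    simp only [slc] at *
    simp only [if_true]
    rcases col_cases (show 0 < m by omega) n with ⟨q, a, ha, rfl, h⟩ | ⟨q, a, ha, rfl, h⟩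
    · have hq : q = 0 := by
        rcases Nat.eq_zero_or_pos q with h | h
        · exact h
        · have : m ≤ q * m := Nat.le_mul_of_pos_left _ h
          omega
      subst hq
      left
      refine ⟨a, by omega, by omega, by simp, ?_⟩
      have := NN_cases hm a
      rw [l_even ha, le, ring_init hm, show 0 + (a + OF m - NN m a) - 1 = a + OF m - NN m a - 1 by omega]
      omega
    · have hq : q = 0 := by
        rcases Nat.eq_zero_or_pos q with h | h
        · exact h
        · have : m ≤ q * m := Nat.le_mul_of_pos_left _ h
          omega
      subst hq
      rw [l_odd ha, lo]
      right
      split_ifs with hp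
      · left
        refine ⟨a, by omega, hp, by simp, ?_⟩
        rw [Nat.zero_mul, Nat.zero_add, Nat.mod_eq_of_lt (by omega)]
      · right; left
        refine ⟨a, by omega, by omega, by simp, ?_⟩
        rw [ring_init hm (by omega)]
        simp

theorem mod_small {P M : ℕ} (h : P ≤ M) : (P < M ∧ P % M = P) ∨ (P = M ∧ P % M = 0) := by
  rcases Nat.lt_or_eq_of_le h with h | h
  · exact Or.inl ⟨h, Nat.mod_eq_of_lt h⟩
  · exact Or.inr ⟨h, by simp [h]⟩

set_option maxHeartbeats 4000000 in
theorem start {m : ℕ} (hm : 32 ≤ m) (z z' : ℕ × Bool) (hz : inW m (A m) 0 z)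
    (hz' : inW m (A m) 0 z') (h : slc (s m) (l m) z = slc (s m) (l m) z') : z = z' := by
  have hMO := MO_cases m
  have hM := MM_pos hm
  have hmod : ∀ P, P % MM m < MM m := fun P => Nat.mod_lt _ (by omega)
  rcases init_slot hm z hz with ⟨e, h1, h2, rfl, hc⟩ | ⟨o, h1, h2, rfl, hc⟩ | ⟨o, h1, h2, rfl, hc⟩ |
    ⟨c, h1, h2, rfl, hc⟩ | ⟨c, h1, h2, rfl, hc⟩ <;>
  rcases init_slot hm z' hz' with ⟨e', h1', h2', rfl, hc'⟩ | ⟨o', h1', h2', rfl, hc'⟩ |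
    ⟨o', h1', h2', rfl, hc'⟩ | ⟨c', h1', h2', rfl, hc'⟩ | ⟨c', h1', h2', rfl, hc'⟩ <;>
  rw [hc, hc'] at h <;> (try simp only [cX, cB] at h) <;> clear hc hc' hz hz'
  all_goals try (exfalso; have := hmod (e + OF m - NN m e - 1); omega)
  all_goals try (exfalso; have := hmod (e' + OF m - NN m e' - 1); omega)
  all_goals try (exfalso; have := hmod (c + OF m - NN m c); omega)
  all_goals try (exfalso; have := hmod (c' + OF m - NN m c'); omega)
  all_goals try (exfalso; have := hmod o; omega)
  all_goals try (exfalso; have := hmod o'; omega)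
  all_goals try (exfalso; omega)
  all_goals try unfold isG at h2
  all_goals try unfold isG at h2'
  all_goals try (have hN := NN_cases hm e)
  all_goals try (have hN := NN_cases hm c)
  all_goals try (have hN' := NN_cases hm e')
  all_goals try (have hN' := NN_cases hm c')
  all_goals try (have hr := mod_small (show e + OF m - NN m e - 1 ≤ MM m by omega))
  all_goals try (have hr := mod_small (show c + OF m - NN m c ≤ MM m by omega))
  all_goals try (have hr' := mod_small (show e' + OF m - NN m e' - 1 ≤ MM m by omega))
  all_goals try (have hr' := mod_small (show c' + OF m - NN m c' ≤ MM m by omega))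
  all_goals try (have hr := mod_small (show o ≤ MM m by omega))
  all_goals try (have hr' := mod_small (show o' ≤ MM m by omega))
  all_goals simp only [Prod.mk.injEq, and_true, Bool.true_eq_false, Bool.false_eq_true, and_false]
  all_goals omega

theorem dyn {m : ℕ} (hm : 32 ≤ m) : Dyn m (A m) (s m) (l m) where
  hm := by omega
  per := fun i => by unfold A; rw [Nat.add_mod_right]
  stepA := stepA hm
  stepS := stepS hm
  start := start hm

end Gen


namespace Gen

theorem tok_ge {m p r w : ℕ} (hm : 32 ≤ m) (hr : 1 ≤ r) (hw : w + 1 ≤ r) (h : p + 2 * w = r * m) :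
    m ≤ p := by
  obtain ⟨r, rfl⟩ : ∃ r', r = r' + 1 := ⟨r - 1, by omega⟩
  have : r * 2 ≤ r * m := Nat.mul_le_mul_left _ (by omega)
  have := Nat.add_one_mul r m
  omega

theorem s_A {m n : ℕ} (h : A m n) : s m n < gg m + 1 := by
  unfold s
  unfold A at h
  rw [if_pos h]
  exact Nat.mod_lt _ (by omega)

theorem ring_ge {m : ℕ} (hm : 32 ≤ m) (P : ℕ) (af : ℕ → Bool) : gg m + 1 ≤ ring m P af := by
  rcases ring_color hm P af with h | ⟨r, _, _, h⟩ <;> rw [h]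
  · unfold cX; omega
  · unfold cB; omega

theorem sp_ge {m : ℕ} (hm : 32 ≤ m) (q c : ℕ) : gg m + 1 ≤ sp m q c := by
  have h1 : ∀ r J, gg m + 1 ≤ cc m r J := by
    intro r J
    unfold cc cX cB
    split_ifs <;> omega
  unfold sp
  split_ifs
  · exact ring_ge hm _ _
  · exact h1 _ _
  · exact h1 _ _
  · exact h1 _ _
  · exact h1 _ _
  · unfold cB; omega

theorem s_nA {m n : ℕ} (hm : 32 ≤ m) (h : ¬ A m n) : gg m + 1 ≤ s m n := by
  unfold s
  unfold A at h
  rw [if_neg h]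
  exact sp_ge hm _ _

theorem l_ge {m : ℕ} (hm : 32 ≤ m) (n : ℕ) : gg m + 1 ≤ l m n := by
  unfold l lo
  split_ifs
  · exact ring_ge hm _ _
  · omega
  · exact ring_ge hm _ _

theorem A_iff {m n n' : ℕ} (hm : 32 ≤ m) (h : s m n = s m n') : A m n ↔ A m n' := by
  by_cases h1 : A m n <;> by_cases h2 : A m n' <;> simp only [h1, h2]
  · have := s_A h1; have := s_nA hm h2; omega
  · have := s_A h2; have := s_nA hm h1; omega

theorem ls_nA {m n a : ℕ} (hm : 32 ≤ m) (h : l m a = s m n) : ¬ A m n := by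
  intro hA
  have := s_A hA; have := l_ge hm a; omega

theorem A_match {m n p : ℕ} (hm : 32 ≤ m) (hp : 1 ≤ p) (hA : A m n) (h : s m n = s m (n + p)) :
    (∃ i, 1 ≤ i ∧ m * i < p ∧ p ≤ (m + 2) * i) ∧ (∀ ρ, p = m * ρ → gg m + 1 ∣ ρ) := by
  have hA' := (A_iff hm h).1 hA
  rcases col_cases (show 0 < m by omega) n with ⟨q, a, ha, rfl, -⟩ | ⟨_, _, _, _, h⟩
  swap
  · exact absurd hA h
  rcases col_cases (show 0 < m by omega) (q * m + 2 * a + p) with ⟨q', a', ha', e, -⟩ | ⟨_, _, _, _, h⟩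
  swap
  · exact absurd hA' h
  rw [e, s_even ha, s_even ha'] at h
  have hd : ((gg m + 1 : ℕ) : ℤ) ∣ ((q' * gg m + a' : ℕ) : ℤ) - ((q * gg m + a : ℕ) : ℤ) :=
    (Nat.modEq_iff_dvd).1 h
  obtain ⟨i, hi⟩ := hd
  have hg : gg m = (m + 1) / 2 := rfl
  generalize gg m = g at *
  have hqq : q ≤ q' := by
    by_contra hlt
    have : (q' + 1) * m ≤ q * m := Nat.mul_le_mul_right _ (by omega)
    have := Nat.add_one_mul q' m
    omega
  obtain ⟨D, rfl⟩ := Nat.exists_eq_add_of_le hqq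
  have e' : p + 2 * a = D * m + 2 * a' := by
    have := Nat.add_mul q D m
    omega
  have hi' : (D : ℤ) * g + a' - a = (g + 1) * i := by
    push_cast at hi
    linarith
  have eZ : (p : ℤ) + 2 * a = D * m + 2 * a' := by exact_mod_cast e'
  have hag : (a : ℤ) + 1 ≤ g := by omega
  have hag' : (a' : ℤ) + 1 ≤ g := by omega
  have hgZ : (2 * (g : ℤ) = m) ∨ (2 * (g : ℤ) = m + 1) := by omega
  have hg16 : (16 : ℤ) ≤ g := by omega
  have hpZ : (1 : ℤ) ≤ p := by omega
  have ha0 : (0 : ℤ) ≤ a := by omega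
  have ha0' : (0 : ℤ) ≤ a' := by omega
  have hD0 : (0 : ℤ) ≤ D := by omega
  -- i ≥ 1
  have hi0 : 0 ≤ i := by
    by_contra hlt
    have : (g + 1 : ℤ) * i ≤ (g + 1) * (-1) := by
      apply mul_le_mul_of_nonneg_left <;> omega
    nlinarith [mul_nonneg hD0 (show (0 : ℤ) ≤ g by omega)]
  have hiD : i ≤ D := by
    by_contra hlt
    have : (g : ℤ) * D ≤ g * (i - 1) := by
      apply mul_le_mul_of_nonneg_left <;> omega
    nlinarith
  constructor
  · have key : (1 : ℤ) ≤ i ∧ (m : ℤ) * i < p ∧ (p : ℤ) ≤ (m + 2) * i := by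
      rcases hgZ with hgZ | hgZ
      · have hpe : (p : ℤ) = (m + 2) * i := by
          rw [← hgZ] at eZ ⊢; linarith
        have h1 : 1 ≤ i := by
          by_contra hlt
          have : i = 0 := by omega
          subst this
          omega
        refine ⟨h1, ?_, by omega⟩
        rw [hpe]; nlinarith
      · have hm' : (m : ℤ) = 2 * g - 1 := by omega
        have hpe : (p : ℤ) = (m + 3) * i - D := by
          rw [hm'] at eZ ⊢; linarith
        have h1 : 1 ≤ i := by
          by_contra hlt
          have : i = 0 := by omega
          subst this
          omega
        refine ⟨h1, ?_, by rw [hpe]; linarith⟩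
        have : (D : ℤ) < 3 * i := by
          by_contra hge
          have : (g : ℤ) * (3 * i) ≤ g * D := by
            apply mul_le_mul_of_nonneg_left <;> omega
          nlinarith
        rw [hpe]; linarith
    obtain ⟨k1, k2, k3⟩ := key
    lift i to ℕ using hi0
    exact ⟨i, by exact_mod_cast k1, by exact_mod_cast k2, by exact_mod_cast k3⟩
  · intro ρ hρ
    have h1 : (m : ℤ) * (ρ - D) = 2 * (a' - a) := by
      have : (p : ℤ) = m * ρ := by exact_mod_cast hρ
      linarith
    have h2 : (ρ : ℤ) = D := by
      by_contra hne
      rcases lt_or_gt_of_ne hne with hlt | hlt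
      · have : (m : ℤ) * (ρ - D) ≤ m * (-1) := by apply mul_le_mul_of_nonneg_left <;> omega
        omega
      · have : (m : ℤ) * 1 ≤ m * (ρ - D) := by apply mul_le_mul_of_nonneg_left <;> omega
        omega
    have h3 : (a' : ℤ) = a := by rw [h2] at h1; linarith
    have h4 : ((g + 1 : ℕ) : ℤ) ∣ ρ := by
      refine ⟨D - i, ?_⟩
      rw [h2]; push_cast
      linarith
    exact_mod_cast h4

/-- an `A`-match and a token match with the same period force a long period -/
theorem long_of {m n p r w : ℕ} (hm : 32 ≤ m) (hp : 1 ≤ p) (hA : A m n) (h : s m n = s m (n + p))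
    (hw : w + 1 ≤ r) (hrw : p + 2 * w = r * m) : 8 ≤ p / m := by
  obtain ⟨⟨i, h1, h2, h3⟩, -⟩ := A_match hm hp hA h
  have hri : i + 1 ≤ r := by
    by_contra hlt
    have : r * m ≤ i * m := Nat.mul_le_mul_right _ (by omega)
    have := Nat.mul_comm i m
    omega
  have hi8 : 8 ≤ i := by
    by_contra hlt
    obtain ⟨t, rfl⟩ := Nat.exists_eq_add_of_le hri
    nlinarith
  have : i ≤ p / m := by
    rw [Nat.le_div_iff_mul_le (by omega)]
    have := Nat.mul_comm i m
    omega
  omega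

theorem A_succ {m n : ℕ} (hm : 32 ≤ m) (h : ¬ A m n) : A m (n + 1) := by
  rcases col_cases (show 0 < m by omega) n with ⟨_, _, _, _, h'⟩ | ⟨q, a, ha, rfl, -⟩
  · exact absurd h' h
  by_cases hl : 2 * (a + 1) < m
  · have := A_even (q := q) hl
    rwa [show q * m + (2 * a + 1) + 1 = q * m + 2 * (a + 1) by omega]
  · have := A_even (m := m) (q := q + 1) (a := 0) (by omega)
    rwa [show q * m + (2 * a + 1) + 1 = (q + 1) * m + 2 * 0 by have := Nat.add_one_mul q m; omega]

theorem A_A {m n : ℕ} (hm : 32 ≤ m) (h : A m n) (h' : A m (n + 1)) : n % m = m - 1 := by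
  have h1 := Nat.div_add_mod' n m
  have h2 := Nat.mod_lt n (show 0 < m by omega)
  by_contra hne
  have : (n + 1) % m = n % m + 1 := by
    rw [← h1, show n / m * m + n % m + 1 = m * (n / m) + (n % m + 1) by rw [mul_comm]; omega,
      Nat.mul_add_mod, Nat.mod_eq_of_lt (by omega)]
    simp
  unfold A at h h'
  omega

theorem two_match {m n p : ℕ} (hm : 32 ≤ m) (hp : 1 ≤ p) (h0 : s m n = s m (n + p))
    (h1 : s m (n + 1) = s m (n + 1 + p)) : 8 ≤ p / m := by
  have hd := dyn hm
  by_cases hA : A m n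
  · by_cases hA' : A m (n + 1)
    · have e1 := A_A hm hA hA'
      have b1 := (A_iff hm h0).1 hA
      have b2 := (A_iff hm h1).1 hA'
      have e2 := A_A hm b1 (by rwa [show n + p + 1 = n + 1 + p by omega])
      have hdvd : m ∣ p := by
        have : n ≡ n + p [MOD m] := by unfold Nat.ModEq; omega
        have := (Nat.modEq_iff_dvd' (by omega)).1 this
        rwa [show n + p - n = p by omega] at this
      obtain ⟨ρ, rfl⟩ := hdvd
      have h3 := (A_match hm hp hA h0).2 ρ rfl
      rw [Nat.mul_div_cancel_left _ (by omega)]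
      have := Nat.le_of_dvd (by rcases Nat.eq_zero_or_pos ρ with h | h; · subst h; omega
                                · exact h) h3
      unfold gg at this
      omega
    · have hB : ¬ A m (n + 1 + p) := fun h => hA' ((A_iff hm h1).2 h)
      obtain ⟨r, w, hr, hw, hrw⟩ := hd.ss hp hA' hB h1
      exact long_of hm hp hA h0 hw hrw
  · have hB : ¬ A m (n + p) := fun h => hA ((A_iff hm h0).2 h)
    obtain ⟨r, w, hr, hw, hrw⟩ := hd.ss hp hA hB h0
    exact long_of hm hp (A_succ hm hA) h1 hw hrw

theorem one_match {m n p : ℕ} (hm : 32 ≤ m) (hp : 1 ≤ p) (h0 : s m n = s m (n + p)) : m ≤ p := by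
  have hd := dyn hm
  by_cases hA : A m n
  · obtain ⟨⟨i, h1, h2, h3⟩, -⟩ := A_match hm hp hA h0
    have : m * 1 ≤ m * i := Nat.mul_le_mul_left _ h1
    omega
  · have hB : ¬ A m (n + p) := fun h => hA ((A_iff hm h0).2 h)
    obtain ⟨r, w, hr, hw, hrw⟩ := hd.ss hp hA hB h0
    exact tok_ge hm hr hw hrw

/-- pure columns are visible -/
theorem sp_eq_B {m q c c' : ℕ} (hm : 32 ≤ m) (hG : ¬ isG m c) (ht : ∀ r, r < 4 → c ≠ tg m r)
    (hc' : 2 * c' + 1 < m) (h : sp m q c' = cB m c) : c' = c := by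
  have hM := MM_pos hm
  by_cases hG' : isG m c'
  · rw [sp_G hG'] at h
    rcases ring_color hm (q + (c' + OF m - NN m c')) (fun r => decide (c' < tg m r)) with h1 | ⟨r, hr, _, h1⟩ <;>
      rw [h1] at h
    · have := Nat.mod_lt (q + (c' + OF m - NN m c')) (show 0 < MM m by omega)
      unfold cX cB at h; omega
    · exact absurd (show c = tg m r by unfold cB at h; omega) (ht r hr)
  · by_cases ht' : ∃ r, r < 4 ∧ c' = tg m r
    · obtain ⟨r, hr, rfl⟩ := ht'
      rw [sp_tg hm hr] at h
      unfold cc at h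
      have := io_lt hm hr
      have := ht r hr
      unfold cX cB at h
      split_ifs at h <;> omega
    · push Not at ht'
      rw [sp_pure hG' ht'] at h
      unfold cB at h; omega

theorem pure_match {m q c p : ℕ} (hm : 32 ≤ m) (hc : 2 * c + 1 < m) (hG : ¬ isG m c)
    (ht : ∀ r, r < 4 → c ≠ tg m r)
    (h : s m (q * m + (2 * c + 1)) = s m (q * m + (2 * c + 1) + p)) : m ∣ p := by
  have hA : ¬ A m (q * m + (2 * c + 1) + p) := fun h' => A_odd hc ((A_iff hm h).2 h')
  rw [s_odd hc, sp_pure hG ht] at h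
  rcases col_cases (show 0 < m by omega) (q * m + (2 * c + 1) + p) with ⟨_, _, _, _, h'⟩ | ⟨q', c', hc', e, -⟩
  · exact absurd h' hA
  rw [e, s_odd hc'] at h
  have := sp_eq_B hm hG ht hc' h.symm
  subst this
  have hqq : q ≤ q' := by
    by_contra hlt
    have : (q' + 1) * m ≤ q * m := Nat.mul_le_mul_right _ (by omega)
    have := Nat.add_one_mul q' m
    omega
  obtain ⟨D, rfl⟩ := Nat.exists_eq_add_of_le hqq
  refine ⟨D, ?_⟩
  have := Nat.add_mul q D m
  have := Nat.mul_comm m D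
  omega

theorem pure_adj {m : ℕ} (hm : 32 ≤ m) (c : ℕ) : (¬ isG m c ∧ ∀ r, r < 4 → c ≠ tg m r) ∨
    (¬ isG m (c + 1) ∧ ∀ r, r < 4 → c + 1 ≠ tg m r) := by
  obtain ⟨a, b, c', d⟩ := tg_vals m
  have hx : ∀ x, (∀ r, r < 4 → x ≠ tg m r) ↔ (x ≠ 4 ∧ x ≠ 6 ∧ x ≠ m / 4 + 2 ∧ x ≠ m / 4 + 4) := by
    intro x
    constructor
    · intro h
      have h0 := h 0 (by omega)
      have h1 := h 1 (by omega)
      have h2 := h 2 (by omega)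
      have h3 := h 3 (by omega)
      omega
    · rintro ⟨h0, h1, h2, h3⟩ r hr
      interval_cases r <;> omega
  rw [hx, hx]
  unfold isG
  omega

theorem coprime_gM {m : ℕ} : Nat.Coprime (MM m) (gg m + 1) := by
  rcases MO_cases m with ⟨h, hM, -⟩ | ⟨h, hM, -⟩
  · rw [hM, show gg m + 1 = m / 2 + 1 by unfold gg; omega, show m / 2 + 2 = (m / 2 + 1) + 1 by omega]
    simp
  · rw [hM, show gg m + 1 = m / 2 + 2 by unfold gg; omega,
      show m + 2 = (m / 2 + 1) + 1 * (m / 2 + 2) by omega, Nat.coprime_add_mul_right_left]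
    rw [show m / 2 + 2 = (m / 2 + 1) + 1 by omega]
    simp

set_option maxHeartbeats 1000000 in
theorem core {m p b L : ℕ} (hm : 32 ≤ m) (hL : p / m ≤ L + 1) (h8 : 8 ≤ p / m)
    (h : ∀ j, j < L → s m (b + j) = s m (b + j + p)) : False := by
  have hM := MM_pos hm
  have hw : ∀ n, b ≤ n → n < b + L → s m n = s m (n + p) := by
    intro n h1 h2
    have := h (n - b) (by omega)
    rwa [show b + (n - b) = n by omega] at this
  -- four letters in the same row
  obtain ⟨q, col, hcol, hb1, hb2⟩ : ∃ q col, col + 3 < m ∧ b ≤ q * m + col ∧ q * m + col + 3 < b + L := by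
    have h1 := Nat.div_add_mod' b m
    have h2 := Nat.mod_lt b (show 0 < m by omega)
    by_cases hc : b % m + 3 < m
    · exact ⟨b / m, b % m, hc, by omega, by omega⟩
    · exact ⟨b / m + 1, 0, by omega, by have := Nat.add_one_mul (b / m) m; omega,
        by have := Nat.add_one_mul (b / m) m; omega⟩
  have hpp : 1 ≤ p := by
    rcases Nat.eq_zero_or_pos p with h | h
    · subst h; simp at h8
    · exact h
  -- the period is a multiple of m
  have hdvd : m ∣ p := by
    have hc : ∃ c, 2 * c + 3 < m ∧ col ≤ 2 * c + 1 ∧ 2 * c + 1 ≤ col + 1 := by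
      exact ⟨col / 2, by omega, by omega, by omega⟩
    obtain ⟨c, hc1, hc2, hc3⟩ := hc
    rcases pure_adj hm c with ⟨k1, k2⟩ | ⟨k1, k2⟩
    · exact pure_match hm (by omega) k1 k2 (hw (q * m + (2 * c + 1)) (by omega) (by omega))
    · exact pure_match hm (by omega) k1 k2 (hw (q * m + (2 * (c + 1) + 1)) (by omega) (by omega))
  obtain ⟨ρ, rfl⟩ := hdvd
  rw [Nat.mul_div_cancel_left _ (show 0 < m by omega)] at hL h8
  have hgρ : gg m + 1 ∣ ρ := by
    have hA : A m (q * m + 2 * ((col + 1) / 2)) := A_even (by omega)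
    exact (A_match hm hpp hA (hw _ (by omega) (by omega))).2 ρ rfl
  obtain ⟨j, rfl⟩ := hgρ
  have hj : 1 ≤ j := by
    rcases Nat.eq_zero_or_pos j with h | h
    · subst h; omega
    · exact h
  have hLg : gg m ≤ L := by
    have : (gg m + 1) * 1 ≤ (gg m + 1) * j := Nat.mul_le_mul_left _ hj
    omega
  have hshift : ∀ q c, q * m + c + m * ((gg m + 1) * j) = (q + (gg m + 1) * j) * m + c := by
    intro q c; ring
  -- a guard in the window
  obtain ⟨q', c, hc, hG, hb3, hb4⟩ : ∃ q' c, 2 * c + 1 < m ∧ isG m c ∧ b ≤ q' * m + (2 * c + 1) ∧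
      q' * m + (2 * c + 1) < b + gg m := by
    have h1 := Nat.div_add_mod' b m
    have h2 := Nat.mod_lt b (show 0 < m by omega)
    have hg : gg m = (m + 1) / 2 := rfl
    by_cases c1 : b % m ≤ 1
    · exact ⟨b / m, 0, by omega, by unfold isG; omega, by omega, by omega⟩
    by_cases c2 : b % m ≤ 2 * (m / 4) + 1
    · exact ⟨b / m, m / 4, by omega, by unfold isG; omega, by omega, by omega⟩
    by_cases c3 : b % m ≤ 2 * (m / 2 - 2) + 1
    · exact ⟨b / m, m / 2 - 2, by omega, by unfold isG; omega, by omega, by omega⟩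
    · exact ⟨b / m + 1, 0, by omega, by unfold isG; omega, by have := Nat.add_one_mul (b / m) m; omega,
        by have := Nat.add_one_mul (b / m) m; omega⟩
  have hMj : MM m ∣ j := by
    have h1 := hw _ hb3 (by omega)
    rw [hshift, s_odd hc, s_odd hc, sp_G hG, sp_G hG] at h1
    have h2 := ring_inj hm h1
    have h3 := (Nat.modEq_iff_dvd' (by omega)).1 (show _ ≡ _ [MOD MM m] from h2)
    rw [show q' + (gg m + 1) * j + (c + OF m - NN m c) - (q' + (c + OF m - NN m c)) =
      (gg m + 1) * j by omega] at h3
    exact coprime_gM.dvd_of_dvd_mul_left h3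
  obtain ⟨y, rfl⟩ := hMj
  have hy : 1 ≤ y := by
    rcases Nat.eq_zero_or_pos y with h | h
    · subst h; omega
    · exact h
  -- full rows
  obtain ⟨k, hk1, hk2, hk3⟩ := tz_window (G := 4 * (gg m + 1)) (by omega) (by omega) y
    (4 * (((b + m - 1) / m + MM m - 1) / MM m) + 1) hy
  apply hk3
  set q1 := (b + m - 1) / m with hq1
  set J0 := (q1 + MM m - 1) / MM m with hJ0
  obtain ⟨t, r, hr, rfl⟩ : ∃ t r, r < 4 ∧ k = 4 * (J0 + t) + r + 1 :=
    ⟨(k - 1) / 4 - J0, (k - 1) % 4, by omega, by omega⟩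
  have hq1m : b ≤ q1 * m ∧ q1 * m ≤ b + m - 1 := by
    have h1 := Nat.div_add_mod' (b + m - 1) m
    have h2 := Nat.mod_lt (b + m - 1) (show 0 < m by omega)
    rw [← hq1] at h1
    generalize (b + m - 1) % m = z at *
    generalize q1 * m = z' at *
    clear * - h1 h2 hm
    omega
  clear_value q1
  clear hq1
  clear_value J0
  have htg := tg_lt hm r
  have ht : 2 * t + 1 ≤ y := by omega
  have hrow : (q1 + MM m * t) * m + m ≤ b + L := by
    have e1 : (q1 + MM m * t) * m = q1 * m + MM m * t * m := by ring
    have hg2 : m + 2 ≤ 2 * (gg m + 1) := by unfold gg; omega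
    have e2 : MM m * ((m + 2) * y) ≤ MM m * (2 * (gg m + 1) * y) :=
      Nat.mul_le_mul_left _ (Nat.mul_le_mul_right _ hg2)
    have e3 : MM m * m * (2 * t + 1) ≤ MM m * m * y := Nat.mul_le_mul_left _ ht
    have e4 : 18 * m ≤ MM m * m := Nat.mul_le_mul_right _ hM
    have e5 : (gg m + 1) * (MM m * y) ≤ L + 1 := hL
    have e6 : q1 * m + 1 ≤ b + m := by omega
    have e7 := Nat.zero_le (MM m * y)
    clear * - e1 e2 e3 e4 e5 e6 e7 hm
    linarith
  have hmt := hw ((q1 + MM m * t) * m + (2 * tg m r + 1)) (by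
    have e1 : (q1 + MM m * t) * m = q1 * m + MM m * t * m := by ring
    omega) (by omega)
  rw [hshift, s_odd (by omega), s_odd (by omega), sp_tg hm hr, sp_tg hm hr] at hmt
  have l1 : (q1 + MM m * t + MM m - 1) / MM m = J0 + t := by
    rw [show q1 + MM m * t + MM m - 1 = (q1 + MM m - 1) + MM m * t by omega,
      Nat.add_mul_div_left _ _ (by omega), hJ0]
  have l2 : (q1 + MM m * t + (gg m + 1) * (MM m * y) + MM m - 1) / MM m = J0 + t + (gg m + 1) * y := by
    rw [show q1 + MM m * t + (gg m + 1) * (MM m * y) + MM m - 1 =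
      (q1 + MM m * t + MM m - 1) + MM m * ((gg m + 1) * y) by
        have : (gg m + 1) * (MM m * y) = MM m * ((gg m + 1) * y) := by ring
        omega, Nat.add_mul_div_left _ _ (by omega), l1]
  rw [l1, l2] at hmt
  have hio := io_lt hm hr
  have e : 4 * (J0 + t) + r + 1 + 4 * (gg m + 1) * y = 4 * (J0 + t + (gg m + 1) * y) + r + 1 := by ring
  rw [e]
  unfold cc bt cX cB at hmt
  cases hx : tz (4 * (gg m + 1)) (4 * (J0 + t) + r + 1) <;>
  cases hx' : tz (4 * (gg m + 1)) (4 * (J0 + t + (gg m + 1) * y) + r + 1) <;>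
  simp only [hx, hx', if_true, Bool.false_eq_true, if_false] at hmt ⊢ <;> omega

theorem good {m : ℕ} (hm : 32 ≤ m) : GoodPair m (s m) (l m) where
  ss := by
    intro p n hp hn h
    have hnn := Nat.zero_le (p / m)
    have h0 := h 0 (Nat.succ_pos _)
    have hmp := one_match hm hp (by simpa using h0)
    have hu : 1 ≤ p / m := (Nat.one_le_div_iff (by omega)).2 hmp
    have h1 := h 1 (by omega)
    exact core hm (L := p / m + 1) (by omega) (two_match hm hp (by simpa using h0) h1) h
  ls := by
    intro p a hp ha hl h
    have hnA := ls_nA hm hl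
    obtain ⟨r, w, hr, hw, hrw⟩ := (dyn hm).ls ha hp hnA hl
    have hmp := tok_ge hm hr hw hrw
    have hu : 1 ≤ p / m := (Nat.one_le_div_iff (by omega)).2 hmp
    have h0 := h 0 (by omega)
    have hA := A_succ hm hnA
    rw [show a + p - 1 + 1 = a + p by omega] at hA
    simp only [Nat.add_zero] at h0
    exact core hm (L := p / m) (by omega) (long_of hm hp ((A_iff hm h0).2 hA) h0 hw hrw) h
  sl := by
    intro p n hp hn h hl
    have hnA := ls_nA hm hl.symm
    obtain ⟨r, w, hr, hw, hrw⟩ := (dyn hm).sl (hn.trans (Nat.le_add_right _ _)) hp hnA hl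
    have hmp := tok_ge hm hr hw hrw
    have hu : 1 ≤ p / m := (Nat.one_le_div_iff (by omega)).2 hmp
    have h0 := h (p / m - 1) (by omega)
    have hA : A m (n + (p / m - 1)) := by
      by_contra hx
      have := A_succ hm hx
      rw [show n + (p / m - 1) + 1 = n + p / m by omega] at this
      exact hnA this
    exact core hm (L := p / m) (by omega) (long_of hm hp hA h0 hw hrw) h
  ll := by
    intro p a hp ha hl h hl'
    have hnA := ls_nA hm hl
    obtain ⟨r, w, hr, hw, hrw⟩ := (dyn hm).ls ha (by omega) hnA hl
    have hu : 1 ≤ p / m := (Nat.one_le_div_iff (by omega)).2 hp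
    by_cases hu2 : 2 ≤ p / m
    · have h0 := h 0 (by omega)
      have hA := A_succ hm hnA
      rw [show a + p - 1 + 1 = a + p by omega] at hA
      simp only [Nat.add_zero] at h0
      exact core hm (L := p / m - 1) (by omega) (long_of hm (by omega) ((A_iff hm h0).2 hA) h0 hw hrw) h
    · have hu1 : p / m = 1 := by omega
      rw [hu1] at hl'
      have hp2 : p < 2 * m := by
        have := (Nat.div_lt_iff_lt_mul (show 0 < m by omega)).1 (show p / m < 2 by omega)
        omega
      rw [show a + 1 - 1 = a by omega] at hl'
      have hnA' := ls_nA hm hl'.symm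
      have hcases : p = m ∨ p = 2 * m - 2 := by
        have hr3 : r < 3 := by
          by_contra hr3
          obtain ⟨t, rfl⟩ := Nat.exists_eq_add_of_le (show 3 ≤ r by omega)
          nlinarith
        interval_cases r
        · left; omega
        · right; omega
      rcases col_cases (show 0 < m by omega) a with ⟨_, _, _, _, h'⟩ | ⟨q, c, hc, rfl, -⟩
      · exact absurd h' hnA'
      rcases hcases with rfl | rfl
      · apply hnA
        have := A_even (m := p) (q := q + 1) (a := c) (by omega)
        rwa [show q * p + (2 * c + 1) + p - 1 = (q + 1) * p + 2 * c by
          have := Nat.add_one_mul q p; omega]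
      · have e2 := Nat.add_mul q 2 m
        have e1 := Nat.add_one_mul q m
        by_cases hc0 : 1 ≤ c
        · apply hnA
          have := A_even (m := m) (q := q + 2) (a := c - 1) (by omega)
          rwa [show q * m + (2 * c + 1) + (2 * m - 2) - 1 = (q + 2) * m + 2 * (c - 1) by omega]
        · have : c = 0 := by omega
          subst this
          rcases Nat.mod_two_eq_zero_or_one m with hev | hod
          · apply hnA
            have := A_even (m := m) (q := q + 1) (a := m / 2 - 1) (by omega)
            rwa [show q * m + (2 * 0 + 1) + (2 * m - 2) - 1 = (q + 1) * m + 2 * (m / 2 - 1) by omega]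
          · rw [show q * m + (2 * 0 + 1) + (2 * m - 2) - 1 = (q + 1) * m + (2 * (m / 2 - 1) + 1) by omega,
              s_odd (by omega), l_odd (by omega)] at hl
            have hG : ¬ isG m (m / 2 - 1) := by unfold isG; omega
            have ht : ∀ r, r < 4 → m / 2 - 1 ≠ tg m r := by
              intro r _
              have := tg_lt hm r
              omega
            rw [sp_pure hG ht, lo, if_neg (by omega)] at hl
            have hM := MM_pos hm
            rcases ring_color hm (q + 0) (fun _ => true) with h1 | ⟨r, hr, _, h1⟩ <;> rw [h1] at hl
            · have := Nat.mod_lt (q + 0) (show 0 < MM m by omega)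
              unfold cX cB at hl; omega
            · exact ht r hr (by unfold cB at hl; omega)
  lz := by
    intro p a h3 hp ha hl
    obtain ⟨r, w, hr, hw, hrw⟩ := (dyn hm).ll ha h3 hl
    have := tok_ge hm hr hw hrw
    omega

/-- the colour set -/
def CS (m : ℕ) : Finset ℕ := (Finset.range (if m % 2 = 0 then 2 * m + 2 else 2 * m + 3)) \
  (if m % 2 = 0 then {cB m 0, cB m (m / 4), cB m (m / 2 - 2)}
    else {cB m 0, cB m 2, cB m (m / 4), cB m (m / 2 - 2)})

theorem mem_CS {m x : ℕ} (hm : 32 ≤ m) (h : x < cB m 0 ∨ (∃ c, c < m / 2 ∧ ¬ isG m c ∧ x = cB m c) ∨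
    (m % 2 = 0 ∧ cB m (m / 2) ≤ x ∧ x < 2 * m + 2)) : x ∈ CS m := by
  have hMO := MO_cases m
  have hgg : gg m = (m + 1) / 2 := rfl
  unfold CS isG cB at *
  split_ifs with hp <;> simp only [Finset.mem_sdiff, Finset.mem_range, Finset.mem_insert,
    Finset.mem_singleton] <;> rcases h with h | ⟨c, h1, h2, h3⟩ | h <;> omega

theorem card_CS {m : ℕ} (hm : 32 ≤ m) : (CS m).card ≤ 2 * m - 1 := by
  have hMO := MO_cases m
  have hgg : gg m = (m + 1) / 2 := rfl
  unfold CS cB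
  split_ifs with hp
  · rw [Finset.card_sdiff_of_subset]
    · rw [Finset.card_range, Finset.card_eq_three.2 ⟨_, _, _, ?_, ?_, ?_, rfl⟩] <;> omega
    · intro x
      simp only [Finset.mem_range, Finset.mem_insert, Finset.mem_singleton]
      omega
  · rw [Finset.card_sdiff_of_subset]
    · rw [Finset.card_range, Finset.card_insert_of_notMem, Finset.card_eq_three.2 ⟨_, _, _, ?_, ?_, ?_, rfl⟩] <;>
        (try simp only [Finset.mem_insert, Finset.mem_singleton]) <;> omega
    · intro x
      simp only [Finset.mem_range, Finset.mem_insert, Finset.mem_singleton]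
      omega

theorem ring_CS {m : ℕ} (hm : 32 ≤ m) (P : ℕ) (af : ℕ → Bool) : ring m P af ∈ CS m := by
  have hM := MM_pos hm
  apply mem_CS hm
  rcases ring_color hm P af with h | ⟨r, _, _, h⟩ <;> rw [h]
  · left
    have := Nat.mod_lt P (show 0 < MM m by omega)
    unfold cX cB; omega
  · right; left
    have := tg_lt hm r
    exact ⟨_, by omega, tg_notG hm r, rfl⟩

theorem s_CS {m : ℕ} (hm : 32 ≤ m) (n : ℕ) : s m n ∈ CS m := by
  rcases col_cases (show 0 < m by omega) n with ⟨q, a, ha, rfl, h⟩ | ⟨q, a, ha, rfl, h⟩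
  · apply mem_CS hm
    left
    have := s_A h
    unfold cB; omega
  · rw [s_odd ha]
    by_cases hG : isG m a
    · rw [sp_G hG]; exact ring_CS hm _ _
    by_cases ht : ∃ r, r < 4 ∧ a = tg m r
    · obtain ⟨r, hr, rfl⟩ := ht
      rw [sp_tg hm hr]
      apply mem_CS hm
      have := io_lt hm hr
      unfold cc
      split_ifs
      · left; unfold cX cB; omega
      · right; left; exact ⟨_, by omega, hG, rfl⟩
    · push Not at ht
      rw [sp_pure hG ht]
      apply mem_CS hm
      right; left; exact ⟨_, by omega, hG, rfl⟩

theorem l_CS {m : ℕ} (hm : 32 ≤ m) (n : ℕ) : l m n ∈ CS m := by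
  unfold l
  split_ifs
  · exact ring_CS hm _ _
  · unfold lo
    split_ifs with hp
    · apply mem_CS hm
      right; right
      have := Nat.mod_lt (n / m * (m / 2) + n % m / 2) (show 0 < m / 2 - 1 by omega)
      have hMO := MO_cases m
      have hgg : gg m = (m + 1) / 2 := rfl
      unfold cB
      omega
    · exact ring_CS hm _ _

end Gen

theorem large_case {k m : ℕ} (hm : 32 ≤ m) (hk : 2 * m - 1 ≤ k) :
    ∃ c : ℤ × Bool → Fin k, ColoringFreePlus InfCaterpillar c (1 + 1 / (m : ℝ)) :=
  glue (by omega) (Gen.CS m) ((Gen.card_CS hm).trans hk) (Gen.s_CS hm) (Gen.l_CS hm) (Gen.good hm)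

namespace Sm

/-- Evaluate a number before passing it on (used to control kernel evaluation). -/
def force {α : Type} (n : ℕ) (f : ℕ → α) : α :=
  Nat.rec (motive := fun _ => α) (f 0) (fun k _ => f (k + 1)) n

theorem force_eq {α : Type} (n : ℕ) (f : ℕ → α) : force n f = f n := by
  cases n <;> rfl

/-- Lookup in a list of numbers. -/
def lk (L : List ℕ) : ℕ → ℕ :=
  List.rec (motive := fun _ => ℕ → ℕ) (fun _ => 0)
    (fun a _ ih c => Nat.rec (motive := fun _ => ℕ) a (fun c' _ => ih c') c) L

theorem lk_eq (L : List ℕ) (c : ℕ) : lk L c = L.getD c 0 := by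
  induction L generalizing c with
  | nil => simp [lk]
  | cons a t ih =>
    cases c with
    | zero => simp [lk]
    | succ c => simpa [lk] using ih c

/-- Build a list of evaluated numbers and pass it on. -/
def bld (g : ℕ → ℕ) (n : ℕ) : List ℕ → (List ℕ → Bool) → Bool :=
  Nat.rec (motive := fun _ => List ℕ → (List ℕ → Bool) → Bool) (fun acc k => k acc)
    (fun n ih acc k => force (g n) fun v => ih (v :: acc) k) n

theorem bld_eq (g : ℕ → ℕ) (n : ℕ) (acc : List ℕ) (k : List ℕ → Bool) :
    bld g n acc k = k ((List.range n).map g ++ acc) := by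
  induction n generalizing acc with
  | zero => simp [bld]
  | succ n ih =>
    have : bld g (n+1) acc k = bld g n (g n :: acc) k := by
      show force (g n) (fun v => bld g n (v :: acc) k) = _
      rw [force_eq]
    rw [this, ih, List.range_succ]
    simp

/-- Build a list of evaluated pairs and pass it on. -/
def bldP (g h : ℕ → ℕ) (n : ℕ) : List (ℕ × ℕ) → (List (ℕ × ℕ) → Bool) → Bool :=
  Nat.rec (motive := fun _ => List (ℕ × ℕ) → (List (ℕ × ℕ) → Bool) → Bool) (fun acc k => k acc)
    (fun n ih acc k => force (g n) fun v => force (h n) fun w => ih ((v, w) :: acc) k) n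

theorem bldP_eq (g h : ℕ → ℕ) (n : ℕ) (acc : List (ℕ × ℕ)) (k : List (ℕ × ℕ) → Bool) :
    bldP g h n acc k = k ((List.range n).map (fun i => (g i, h i)) ++ acc) := by
  induction n generalizing acc with
  | zero => simp [bldP]
  | succ n ih =>
    have : bldP g h (n+1) acc k = bldP g h n ((g n, h n) :: acc) k := by
      show force (g n) (fun v => force (h n) fun w => bldP g h n ((v, w) :: acc) k) = _
      rw [force_eq, force_eq]
    rw [this, ih, List.range_succ]
    simp

/-- Bounded universal quantifier. -/
def alln (f : ℕ → Bool) (n : ℕ) : Bool :=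
  Nat.rec (motive := fun _ => Bool) true (fun n ih => f n && ih) n

theorem alln_spec {f : ℕ → Bool} {n : ℕ} (h : alln f n = true) : ∀ i < n, f i = true := by
  induction n with
  | zero => intro i hi; omega
  | succ n ih =>
    have hand : (f n && alln f n) = true := h
    rw [Bool.and_eq_true] at hand
    intro i hi
    rcases Nat.lt_succ_iff_lt_or_eq.mp hi with h1 | h1
    · exact ih hand.2 i h1
    · rw [h1]; exact hand.1

/-- The data of a periodic skeleton. -/
structure Dat where
  m : ℕ
  L : ℕ
  o : ℕ
  K : ℕ
  T : ℕ
  P : ℕ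
  Q : ℕ
  j0 : ℕ
  rd : ℕ
  Z : ℕ

def get (T i : ℕ) : ℕ := (T >>> (6 * i)) % 64

def tab (D : Dat) (t j : ℕ) : ℕ := get D.T (t * D.L + j)
def F (D : Dat) (t x : ℕ) : ℕ := (get D.P)^[x / D.L] (tab D t (x % D.L))

/-- Basic checks. -/
def basic (D : Dat) : Bool :=
  Nat.ble 3 D.m && Nat.ble 1 D.L && Nat.ble 1 D.o && Nat.beq (D.o % 2) 0 &&
  Nat.ble (2 * D.L * D.m) (D.L * D.o) && Nat.ble (D.L + D.Z + 3) (D.L * D.o) &&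
  Nat.ble (2 * D.o) (2 ^ D.rd) && Nat.blt D.j0 D.L &&
  alln (fun i => Nat.blt (get D.T i) D.K) (4 * D.L) &&
  alln (fun c => Nat.blt (get D.P c) D.K && Nat.beq (get D.Q (get D.P c)) c &&
    Nat.beq ((get D.P)^[D.o] c) c) D.K &&
  ! Nat.beq (tab D 0 D.j0) (tab D 1 D.j0)

structure Ok (D : Dat) : Prop where
  m3 : 3 ≤ D.m
  L1 : 1 ≤ D.L
  o1 : 1 ≤ D.o
  oev : D.o % 2 = 0
  hN : 2 * D.L * D.m ≤ D.L * D.o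
  hZ : D.L + D.Z + 3 ≤ D.L * D.o
  hrd : 2 * D.o ≤ 2 ^ D.rd
  hj0 : D.j0 < D.L
  hT : ∀ i < 4 * D.L, get D.T i < D.K
  hP : ∀ c < D.K, get D.P c < D.K
  hQ : ∀ c < D.K, get D.Q (get D.P c) = c
  ho : ∀ c < D.K, (get D.P)^[D.o] c = c
  hv : tab D 0 D.j0 ≠ tab D 1 D.j0

theorem basic_ok {D : Dat} (h : basic D = true) : Ok D := by
  simp only [basic, Bool.and_eq_true, Nat.ble_eq, Nat.beq_eq, Bool.not_eq_true'] at h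
  obtain ⟨⟨⟨⟨⟨⟨⟨⟨⟨⟨h1, h2⟩, h3⟩, h4⟩, h5⟩, h6⟩, h7⟩, h8⟩, h9⟩, h10⟩, h11⟩ := h
  have h9' := alln_spec h9
  have h10' := alln_spec h10
  simp only [Bool.and_eq_true, Nat.beq_eq, Nat.blt, Nat.ble_eq] at h8 h9' h10'
  refine ⟨h1, h2, h3, h4, h5, h6, h7, h8, h9', fun c hc => (h10' c hc).1.1,
    fun c hc => (h10' c hc).1.2, fun c hc => (h10' c hc).2, ?_⟩
  intro h
  rw [h] at h11
  simp [Nat.beq_refl] at h11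

theorem F_lt {D : Dat} (h : Ok D) {t : ℕ} (ht : t < 4) (x : ℕ) : F D t x < D.K := by
  unfold F
  have hx : x % D.L < D.L := Nat.mod_lt _ h.L1
  have h0 : tab D t (x % D.L) < D.K := by
    apply h.hT
    nlinarith
  generalize x / D.L = q
  induction q with
  | zero => simpa using h0
  | succ q ih => rw [Function.iterate_succ_apply']; exact h.hP _ ih

theorem F_shift {D : Dat} (h : Ok D) (t x : ℕ) : F D t (x + D.L) = get D.P (F D t x) := by
  unfold F
  rw [Nat.add_div_right _ h.L1, Nat.add_mod_right, Function.iterate_succ_apply']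

theorem F_shiftq {D : Dat} (h : Ok D) (t x q : ℕ) :
    F D t (x + D.L * q) = (get D.P)^[q] (F D t x) := by
  induction q with
  | zero => simp
  | succ q ih =>
    rw [Nat.mul_succ, ← Nat.add_assoc, F_shift h, ih, Function.iterate_succ_apply']

theorem F_per {D : Dat} (h : Ok D) {t : ℕ} (ht : t < 4) (x y : ℕ) :
    F D t (x + D.L * D.o * y) = F D t x := by
  induction y with
  | zero => simp
  | succ y ih =>
    rw [Nat.mul_succ, ← Nat.add_assoc, F_shiftq h, ih, h.ho _ (F_lt h ht x)]

theorem P_inj {D : Dat} (h : Ok D) {c d : ℕ} (hc : c < D.K) (hd : d < D.K)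
    (e : get D.P c = get D.P d) : c = d := by
  rw [← h.hQ c hc, ← h.hQ d hd, e]

theorem F_back {D : Dat} (h : Ok D) {t : ℕ} (ht : t < 4) (x q : ℕ) :
    (get D.Q)^[q] (F D t (x + D.L * q)) = F D t x := by
  induction q with
  | zero => simp
  | succ q ih =>
    rw [Nat.mul_succ, ← Nat.add_assoc, F_shift h, Function.iterate_succ_apply,
      h.hQ _ (F_lt h ht _), ih]

/-! ### Match relations -/

def W (D : Dat) (a b x y : ℕ) : Prop :=
  F D (2*a) x = F D (2*b) y ∨ F D (2*a+1) x = F D (2*b+1) y ∨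
  F D (2*a) x = F D (2*b+1) y ∨ F D (2*a+1) x = F D (2*b) y

def PM (D : Dat) (a b x y : ℕ) : Prop :=
  (F D (2*a) x = F D (2*b) y ∨ F D (2*a+1) x = F D (2*b+1) y) ∨
  (x / D.L ≠ y / D.L ∧ W D a b x y)

theorem PM_W {D : Dat} {a b x y : ℕ} (h : PM D a b x y) : W D a b x y := by
  unfold PM W at *; tauto

theorem F_shift_inj {D : Dat} (h : Ok D) {t u : ℕ} (ht : t < 4) (hu : u < 4) {x y : ℕ} :
    F D t (x + D.L) = F D u (y + D.L) ↔ F D t x = F D u y := by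
  rw [F_shift h, F_shift h]
  exact ⟨fun e => P_inj h (F_lt h ht _) (F_lt h hu _) e, fun e => by rw [e]⟩

theorem W_shift {D : Dat} (h : Ok D) {a b : ℕ} (ha : a < 2) (hb : b < 2) {x y : ℕ} :
    W D a b (x + D.L) (y + D.L) ↔ W D a b x y := by
  unfold W
  rw [F_shift_inj h (by omega) (by omega), F_shift_inj h (by omega) (by omega),
    F_shift_inj h (by omega) (by omega), F_shift_inj h (by omega) (by omega)]

theorem PM_shift {D : Dat} (h : Ok D) {a b : ℕ} (ha : a < 2) (hb : b < 2) {x y : ℕ} :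
    PM D a b (x + D.L) (y + D.L) ↔ PM D a b x y := by
  unfold PM
  rw [F_shift_inj h (by omega) (by omega), F_shift_inj h (by omega) (by omega), W_shift h ha hb,
    Nat.add_div_right _ h.L1, Nat.add_div_right _ h.L1]
  simp

theorem PM_shiftq {D : Dat} (h : Ok D) {a b : ℕ} (ha : a < 2) (hb : b < 2) {x y : ℕ} (q : ℕ) :
    PM D a b (x + D.L * q) (y + D.L * q) ↔ PM D a b x y := by
  induction q with
  | zero => simp
  | succ q ih => rw [Nat.mul_succ, ← Nat.add_assoc, ← Nat.add_assoc, PM_shift h ha hb, ih]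

theorem W_shiftq {D : Dat} (h : Ok D) {a b : ℕ} (ha : a < 2) (hb : b < 2) {x y : ℕ} (q : ℕ) :
    W D a b (x + D.L * q) (y + D.L * q) ↔ W D a b x y := by
  induction q with
  | zero => simp
  | succ q ih => rw [Nat.mul_succ, ← Nat.add_assoc, ← Nat.add_assoc, W_shift h ha hb, ih]

theorem W_per {D : Dat} (h : Ok D) {a b : ℕ} (hb : b < 2) {x y : ℕ} (z : ℕ) :
    W D a b x (y + D.L * D.o * z) ↔ W D a b x y := by
  unfold W
  rw [F_per h (by omega), F_per h (by omega)]

/-- The actual colouring tracks. -/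
def G (D : Dat) (a x : ℕ) : ℕ := if tz D.o (x / D.L) then F D (2*a+1) x else F D (2*a) x

theorem G_lt {D : Dat} (h : Ok D) {a : ℕ} (ha : a < 2) (x : ℕ) : G D a x < D.K := by
  unfold G
  split
  · exact F_lt h (by omega) _
  · exact F_lt h (by omega) _

theorem G_PM {D : Dat} {a b x y : ℕ} (h : G D a x = G D b y) : PM D a b x y := by
  unfold G at h
  unfold PM W
  by_cases e : x / D.L = y / D.L
  · rw [e] at h
    split at h <;> tauto
  · split at h <;> split at h <;> tauto

/-! ### Bit planes -/

def st (D : Dat) : ℕ := D.L * 2 ^ D.rd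

/-- Initial plane of the colour `c`. -/
def blk (D : Dat) (c : ℕ) : ℕ :=
  Nat.rec (motive := fun _ => ℕ) 0 (fun i acc =>
    acc ||| (bif Nat.beq (get D.T i) c then 1 <<< ((i / D.L) * st D + i % D.L) else 0)) (4 * D.L)

def PS (D : Dat) (n : ℕ) (pl : List ℕ) : Prop :=
  ∀ t < 4, ∀ x < D.L * n, (lk pl (F D t x)).testBit (t * st D + x) = true

def planes (D : Dat) (k : List ℕ → Bool) : ℕ → ℕ → List ℕ → Bool :=
  fun r => Nat.rec (motive := fun _ => ℕ → List ℕ → Bool) (fun _ pl => k pl)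
    (fun _ ih n pl =>
      bld (fun c => lk pl c ||| (lk pl ((get D.Q)^[n] c) <<< (D.L * n))) D.K [] (ih (2 * n))) r

theorem blk_bit {D : Dat} (h : Ok D) {t x : ℕ} (ht : t < 4) (hx : x < D.L) :
    (blk D (tab D t x)).testBit (t * st D + x) = true := by
  have key : ∀ n, ∀ i < n, (Nat.rec (motive := fun _ => ℕ) 0 (fun i acc =>
    acc ||| (bif Nat.beq (get D.T i) (get D.T (t * D.L + x)) then
      1 <<< ((i / D.L) * st D + i % D.L) else 0)) n : ℕ).testBit ((i / D.L) * st D + i % D.L) = true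
      ∨ get D.T i ≠ get D.T (t * D.L + x) := by
    intro n
    induction n with
    | zero => intro i hi; omega
    | succ n ih =>
      intro i hi
      rcases Nat.lt_succ_iff_lt_or_eq.mp hi with h1 | h1
      · rcases ih i h1 with h2 | h2
        · left
          simp only [Nat.testBit_or, h2, Bool.true_or]
        · exact Or.inr h2
      · subst h1
        by_cases e : get D.T i = get D.T (t * D.L + x)
        · left
          simp only [Nat.testBit_or, e, Nat.beq_refl, cond_true]
          simp
        · exact Or.inr e
  have h1 := key (4 * D.L) (t * D.L + x) (by nlinarith)
  have e1 : (t * D.L + x) / D.L = t := by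
    rw [Nat.mul_comm, Nat.mul_add_div h.L1, Nat.div_eq_of_lt hx]; simp
  have e2 : (t * D.L + x) % D.L = x := by
    rw [Nat.mul_comm, Nat.mul_add_mod, Nat.mod_eq_of_lt hx]
  rw [e1, e2] at h1
  rcases h1 with h1 | h1
  · exact h1
  · exact absurd rfl h1

theorem lk_map {g : ℕ → ℕ} {n c : ℕ} (hc : c < n) : lk ((List.range n).map g ++ []) c = g c := by
  rw [lk_eq]
  simp [List.getD_eq_getElem?_getD, hc]

theorem PS_init {D : Dat} (h : Ok D) : PS D 1 ((List.range D.K).map (blk D) ++ []) := by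
  intro t ht x hx
  rw [lk_map (F_lt h ht x)]
  have hx' : x < D.L := by simpa using hx
  have : F D t x = tab D t x := by
    unfold F; rw [Nat.div_eq_of_lt hx', Nat.mod_eq_of_lt hx']; rfl
  rw [this]
  exact blk_bit h ht hx'

theorem PS_step {D : Dat} (h : Ok D) {n : ℕ} {pl : List ℕ} (hp : PS D n pl) :
    PS D (2 * n) ((List.range D.K).map
      (fun c => lk pl c ||| (lk pl ((get D.Q)^[n] c) <<< (D.L * n))) ++ []) := by
  intro t ht x hx
  rw [lk_map (F_lt h ht x), Nat.testBit_or]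
  by_cases e : x < D.L * n
  · rw [hp t ht x e]; rfl
  · obtain ⟨z, rfl⟩ : ∃ z, x = z + D.L * n := ⟨x - D.L * n, by omega⟩
    rw [F_back h ht]
    have := hp t ht z (by nlinarith)
    rw [Nat.testBit_shiftLeft, show t * st D + (z + D.L * n) - D.L * n = t * st D + z by omega, this]
    simp; right; omega

theorem planes_spec {D : Dat} (h : Ok D) (k : List ℕ → Bool) (r n : ℕ) (pl : List ℕ)
    (hp : PS D n pl) (hk : planes D k r n pl = true) :
    ∃ pl', PS D (n * 2 ^ r) pl' ∧ k pl' = true := by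
  induction r generalizing n pl with
  | zero => exact ⟨pl, by simpa using hp, hk⟩
  | succ r ih =>
    have hk' : bld (fun c => lk pl c ||| (lk pl ((get D.Q)^[n] c) <<< (D.L * n))) D.K []
      (planes D k r (2 * n)) = true := hk
    rw [bld_eq] at hk'
    obtain ⟨pl', h1, h2⟩ := ih _ _ (PS_step h hp) hk'
    refine ⟨pl', ?_, h2⟩
    rw [show n * 2 ^ (r+1) = 2 * n * 2 ^ r by ring]
    exact h1

/-! ### Match masks -/

def tm (D : Dat) (pl : List ℕ) (a b x base : ℕ) : ℕ :=
  force (lk pl (F D (2*a) x)) fun A => force (lk pl (F D (2*a+1) x)) fun B =>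
  force (2*b*st D + base) fun s0 => force ((2*b+1)*st D + base) fun s1 =>
  force ((A >>> s0) ||| (B >>> s1)) fun R =>
  force ((A >>> s1) ||| (B >>> s0)) fun V =>
  R ||| (V ^^^ (V &&& (((2 ^ D.L - 1) <<< (x / D.L * D.L)) >>> base)))

def tw (D : Dat) (pl : List ℕ) (x : ℕ) : ℕ :=
  force (lk pl (F D 0 x)) fun A => force (lk pl (F D 1 x)) fun B =>
  force (st D + x) fun s1 =>
  ((A >>> x) ||| (B >>> s1)) ||| ((A >>> s1) ||| (B >>> x))

theorem tm_spec {D : Dat} (h : Ok D) {pl : List ℕ} (hp : PS D (2 ^ D.rd) pl) {a b x base p : ℕ}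
    (ha : a < 2) (hb : b < 2) (hx : x < D.L * D.o * 2) (hy : base + p < D.L * D.o * 2)
    (hm : PM D a b x (base + p)) : (tm D pl a b x base).testBit p = true := by
  have hst : D.L * D.o * 2 ≤ D.L * 2 ^ D.rd := by
    have := Nat.mul_le_mul_left D.L h.hrd
    linarith
  have key : ∀ t u, t < 4 → u < 4 → F D t x = F D u (base + p) →
      (lk pl (F D t x)).testBit (u * st D + base + p) = true := by
    intro t u ht hu e
    rw [e, Nat.add_assoc]
    exact hp u hu _ (by omega)
  unfold tm
  simp only [force_eq]
  simp only [Nat.testBit_or, Nat.testBit_xor, Nat.testBit_and, Nat.testBit_shiftRight]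
  rcases hm with (e | e) | ⟨e, hW⟩
  · have := key _ _ (by omega) (by omega) e
    simp [this]
  · have := key _ _ (by omega) (by omega) e
    simp [this]
  · have hs : ((2 ^ D.L - 1) <<< (x / D.L * D.L)).testBit (base + p) = false := by
      rw [Nat.testBit_shiftLeft, Nat.testBit_two_pow_sub_one]
      by_contra hc
      simp at hc
      apply e
      symm
      apply Nat.div_eq_of_lt_le
      · exact hc.1
      · rw [Nat.succ_mul]; omega
    rw [hs]
    rcases hW with e | e | e | e
    all_goals
      have := key _ _ (by omega) (by omega) e
      simp [this]

theorem tw_spec {D : Dat} (h : Ok D) {pl : List ℕ} (hp : PS D (2 ^ D.rd) pl) {x p : ℕ}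
    (hx : x < D.L * D.o * 2) (hy : x + p < D.L * D.o * 2)
    (hm : W D 0 0 x (x + p)) : (tw D pl x).testBit p = true := by
  have hst : D.L * D.o * 2 ≤ D.L * 2 ^ D.rd := by
    have := Nat.mul_le_mul_left D.L h.hrd
    linarith
  have key : ∀ t u, t < 4 → u < 4 → F D t x = F D u (x + p) →
      (lk pl (F D t x)).testBit (u * st D + x + p) = true := by
    intro t u ht hu e
    rw [e, Nat.add_assoc]
    exact hp u hu _ (by omega)
  unfold tw
  simp only [force_eq]
  simp only [Nat.testBit_or, Nat.testBit_shiftRight]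
  rcases hm with e | e | e | e
  all_goals
    have := key _ _ (by omega) (by omega) e
    simp at this
    simp [this]

end Sm

namespace Sm

/-- Inner loop of the exact check. -/
def inA (m TL : ℕ) (E : List (ℕ × ℕ)) : ℕ → ℕ → ℕ → ℕ → Bool :=
  List.rec (motive := fun _ => ℕ → ℕ → ℕ → ℕ → Bool) (fun _ _ _ _ => false)
    (fun e _ ih R Rp pv M =>
      Nat.beq Rp 0 ||
      (force (R &&& M) fun RM =>
        (Nat.beq (RM &&& e.1) 0 && Nat.beq (RM &&& TL) 0 && Nat.beq (RM &&& e.2) 0 &&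
          Nat.beq ((TL &&& M) &&& (Rp &&& pv)) 0) &&
        (force (R &&& e.1) fun R' => force (M <<< m) fun M' => ih R' R e.2 M'))) E

theorem inA_cons (m TL : ℕ) (e : ℕ × ℕ) (E : List (ℕ × ℕ)) (R Rp pv M : ℕ) :
    inA m TL (e :: E) R Rp pv M = true → Rp ≠ 0 →
    ((R &&& M) &&& e.1 = 0 ∧ (R &&& M) &&& TL = 0 ∧ (R &&& M) &&& e.2 = 0 ∧
      (TL &&& M) &&& (Rp &&& pv) = 0) ∧ inA m TL E (R &&& e.1) R e.2 (M <<< m) = true := by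
  intro h hR
  have hand : (Nat.beq Rp 0 ||
      (force (R &&& M) fun RM =>
        (Nat.beq (RM &&& e.1) 0 && Nat.beq (RM &&& TL) 0 && Nat.beq (RM &&& e.2) 0 &&
          Nat.beq ((TL &&& M) &&& (Rp &&& pv)) 0) &&
        (force (R &&& e.1) fun R' => force (M <<< m) fun M' => inA m TL E R' R e.2 M'))) = true := h
  simp only [force_eq, Bool.or_eq_true, Bool.and_eq_true, Nat.beq_eq] at hand
  rcases hand with hand | hand
  · exact absurd hand hR
  · tauto

theorem land_false {a b p : ℕ} (h : a &&& b = 0) (ha : a.testBit p = true)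
    (hb : b.testBit p = true) : False := by
  have := congrArg (fun z => Nat.testBit z p) h
  simp [ha, hb] at this

theorem ne_zero_of_bit {a p : ℕ} (h : a.testBit p = true) : a ≠ 0 := by
  rintro rfl; simp at h

theorem mask_bit {m k p : ℕ} (hm : 1 ≤ m) (h : p / m = k) :
    ((2 ^ m - 1) <<< (k * m)).testBit p = true := by
  rw [Nat.testBit_shiftLeft, Nat.testBit_two_pow_sub_one]
  have h1 := Nat.div_mul_le_self p m
  have h2 := Nat.lt_div_mul_add hm (a := p)
  rw [h] at h1 h2
  simp
  constructor <;> omega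

theorem and_bit {a b p : ℕ} (ha : a.testBit p = true) (hb : b.testBit p = true) :
    (a &&& b).testBit p = true := by rw [Nat.testBit_and, ha, hb]; rfl

theorem inA_sound {m TL p : ℕ} (hm : 1 ≤ m) (E : List (ℕ × ℕ)) (a b : ℕ → Prop)
    (hE : ∀ j (hj : j < E.length), (a j → E[j].1.testBit p = true) ∧
      (b j → E[j].2.testBit p = true))
    (R Rp pv k i : ℕ) (hRp : R.testBit p = true → Rp.testBit p = true) (hi : p / m = k + i)
    (h : inA m TL E R Rp pv ((2 ^ m - 1) <<< (k * m)) = true) :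
    (R.testBit p = true → (∀ j ≤ i, a j) → False) ∧
    (R.testBit p = true → TL.testBit p = true → (∀ j < i, a j) → False) ∧
    (R.testBit p = true → (∀ j < i, a j) → b i → False) ∧
    (TL.testBit p = true → i = 0 → Rp.testBit p = true → pv.testBit p = true → False) ∧
    (TL.testBit p = true → 1 ≤ i → R.testBit p = true → (∀ j < i - 1, a j) → b (i - 1) → False) := by
  induction E generalizing a b R Rp pv k i with
  | nil => exact absurd h (by simp [inA])
  | cons e E ih =>
    by_cases hR0 : Rp.testBit p = true
    swap
    · have : R.testBit p ≠ true := fun hh => hR0 (hRp hh)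
      tauto
    obtain ⟨⟨c1, c2, c3, c4⟩, c5⟩ := inA_cons _ _ _ _ _ _ _ _ h (ne_zero_of_bit hR0)
    have he := hE 0 (by simp)
    simp only [List.getElem_cons_zero] at he
    rcases Nat.eq_zero_or_pos i with hi0 | hi0
    · subst hi0
      have hM := mask_bit hm (show p / m = k by omega)
      refine ⟨?_, ?_, ?_, ?_, ?_⟩
      · intro h1 h2
        exact land_false c1 (and_bit h1 hM) (he.1 (h2 0 le_rfl))
      · intro h1 h2 _
        exact land_false c2 (and_bit h1 hM) h2
      · intro h1 _ h3
        exact land_false c3 (and_bit h1 hM) (he.2 h3)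
      · intro h1 _ h2 h3
        exact land_false c4 (and_bit h1 hM) (and_bit h2 h3)
      · intro _ h1; omega
    · rw [← Nat.shiftLeft_add, show k * m + m = (k+1) * m by ring] at c5
      obtain ⟨d1, d2, d3, d4, d5⟩ := ih (fun j => a (j+1)) (fun j => b (j+1))
        (fun j hj => hE (j+1) (Nat.succ_lt_succ hj)) (R &&& e.1) R e.2 (k+1) (i-1)
        (fun hh => by rw [Nat.testBit_and, Bool.and_eq_true] at hh; exact hh.1) (by omega) c5
      refine ⟨?_, ?_, ?_, ?_, ?_⟩
      · intro h1 h2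
        exact d1 (and_bit h1 (he.1 (h2 0 (by omega)))) (fun j hj => h2 _ (by omega))
      · intro h1 h2 h3
        exact d2 (and_bit h1 (he.1 (h3 0 (by omega)))) h2 (fun j hj => h3 _ (by omega))
      · intro h1 h2 h3
        refine d3 (and_bit h1 (he.1 (h2 0 (by omega)))) (fun j hj => h2 _ (by omega)) ?_
        rwa [show i - 1 + 1 = i by omega]
      · intro _ h1; omega
      · intro h1 _ h2 h3 h4
        rcases Nat.eq_or_lt_of_le hi0 with hi1 | hi1
        · refine d4 h1 (by omega) h2 (he.2 ?_)
          rw [show i - 1 = 0 by omega] at h4; exact h4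
        · refine d5 h1 (by omega) (and_bit h2 (he.1 (h3 0 (by omega))))
            (fun j hj => h3 _ (by omega)) ?_
          rwa [show i - 1 - 1 + 1 = i - 1 by omega]

/-- Outer loop of the exact check. -/
def outA (m R0 : ℕ) (TLs : List ℕ) : List (ℕ × ℕ) → Bool :=
  List.rec (motive := fun _ => List (ℕ × ℕ) → Bool) (fun _ => true)
    (fun TL _ ih E => inA m TL E R0 R0 0 (2 ^ m - 1) && ih E.tail) TLs

theorem outA_spec {m R0 : ℕ} (TLs : List ℕ) (E : List (ℕ × ℕ)) (h : outA m R0 TLs E = true) :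
    ∀ i (hi : i < TLs.length), inA m TLs[i] (E.drop i) R0 R0 0 (2 ^ m - 1) = true := by
  induction TLs generalizing E with
  | nil => intro i hi; simp at hi
  | cons TL t ih =>
    have hand : (inA m TL E R0 R0 0 (2 ^ m - 1) && outA m R0 t E.tail) = true := h
    rw [Bool.and_eq_true] at hand
    intro i hi
    cases i with
    | zero => simpa using hand.1
    | succ i =>
      have := ih _ hand.2 i (by simpa using hi)
      simpa using this

/-- Inner loop of the rough check. -/
def inB (c : ℕ) : List ℕ → ℕ → Bool :=
  Nat.rec (motive := fun _ => List ℕ → ℕ → Bool) (fun _ R => Nat.beq R 0)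
    (fun _ ih E R => Nat.beq R 0 ||
      List.rec (motive := fun _ => Bool) false (fun e t _ => force (R &&& e) fun R' => ih t R') E) c

theorem inB_sound {p : ℕ} (c : ℕ) (E : List ℕ) (R : ℕ) (h : inB c E R = true) (a : ℕ → Prop)
    (hE : ∀ j (hj : j < E.length), (a j → E[j].testBit p = true)) (hR : R.testBit p = true)
    (ha : ∀ j < c, a j) : False := by
  induction c generalizing E R a with
  | zero =>
    have hand : Nat.beq R 0 = true := h
    rw [Nat.beq_eq] at hand
    exact ne_zero_of_bit hR hand
  | succ c ih =>
    cases E with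
    | nil =>
      have hand : (Nat.beq R 0 || false) = true := h
      rw [Bool.or_false, Nat.beq_eq] at hand
      exact ne_zero_of_bit hR hand
    | cons e t =>
      have hand : (Nat.beq R 0 || force (R &&& e) fun R' => inB c t R') = true := h
      rw [Bool.or_eq_true, Nat.beq_eq, force_eq] at hand
      rcases hand with hand | hand
      · exact ne_zero_of_bit hR hand
      · have he := hE 0 (by simp)
        exact ih t _ hand (fun j => a (j+1)) (fun j hj => hE (j+1) (Nat.succ_lt_succ hj))
          (and_bit hR (he (ha 0 (by omega)))) (fun j hj => ha _ (by omega))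

def outB (c R0 n : ℕ) : List ℕ → Bool :=
  Nat.rec (motive := fun _ => List ℕ → Bool) (fun _ => true)
    (fun _ ih E => inB c E R0 && ih E.tail) n

theorem outB_spec {c R0 : ℕ} (n : ℕ) (E : List ℕ) (h : outB c R0 n E = true) :
    ∀ i < n, inB c (E.drop i) R0 = true := by
  induction n generalizing E with
  | zero => intro i hi; omega
  | succ n ih =>
    have hand : (inB c E R0 && outB c R0 n E.tail) = true := h
    rw [Bool.and_eq_true] at hand
    intro i hi
    cases i with
    | zero => simpa using hand.1
    | succ i => simpa using ih _ hand.2 i (by omega)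

def allL (f : ℕ → Bool) (l : List ℕ) : Bool :=
  List.rec (motive := fun _ => Bool) true (fun a _ ih => f a && ih) l

theorem allL_spec {f : ℕ → Bool} {l : List ℕ} (h : allL f l = true) : ∀ x ∈ l, f x = true := by
  induction l with
  | nil => intro x hx; simp at hx
  | cons a t ih =>
    have hand : (f a && allL f t) = true := h
    rw [Bool.and_eq_true] at hand
    intro x hx
    rcases List.mem_cons.mp hx with rfl | hx
    · exact hand.1
    · exact ih hand.2 x hx

/-- Everything after the planes have been built. -/
def chk2 (D : Dat) (N : ℕ) (pl : List ℕ) : Bool :=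
  bldP (fun i => tm D pl 0 0 (i+1) (i+1)) (fun i => tm D pl 0 1 (i+1) (i+1)) (D.L + D.Z) [] fun E =>
  bld (fun i => tm D pl 1 0 (i+2) i) D.L [] fun TLs =>
  bld (fun i => tw D pl (i+1)) (D.L + D.Z) [] fun Ws =>
  force (2 ^ N - 2) fun R0 =>
  outA D.m R0 TLs E && outB (N / D.m - 1) R0 D.L Ws &&
  alln (fun i => Nat.beq (tm D pl 1 1 (i+2) i &&& ((2 ^ (D.m - 3) - 1) <<< 3)) 0) D.L &&
  (Nat.ble ((2 * D.L + 1) * D.m) N || allL (fun TL => Nat.beq ((TL >>> N) % 2) 0) TLs)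

def chk (D : Dat) : Bool :=
  basic D && (force (D.L * D.o) fun N =>
    bld (blk D) D.K [] (planes D (chk2 D N) D.rd 1))

structure Sound (D : Dat) : Prop where
  ok : Ok D
  A : ∀ n p, 1 ≤ n → n ≤ D.L → 1 ≤ p → p < D.L * D.o →
    ((∀ j ≤ p / D.m, PM D 0 0 (n+j) (n+j+p)) → False) ∧
    (PM D 1 0 (n+1) (n-1+p) → (∀ j < p / D.m, PM D 0 0 (n+j) (n+j+p)) → False) ∧
    ((∀ j < p / D.m, PM D 0 0 (n+j) (n+j+p)) → PM D 0 1 (n+p/D.m) (n+p/D.m+p) → False) ∧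
    (PM D 1 0 (n+1) (n-1+p) → 1 ≤ p / D.m → (∀ j < p / D.m - 1, PM D 0 0 (n+j) (n+j+p)) →
      PM D 0 1 (n+(p/D.m-1)) (n+(p/D.m-1)+p) → False)
  B : ∀ n p, 1 ≤ n → n ≤ D.L → 1 ≤ p → p < D.L * D.o →
    (∀ j < D.L * D.o / D.m - 1, W D 0 0 (n+j) (n+j+p)) → False
  Z : ∀ n p, 1 ≤ n → n ≤ D.L → 3 ≤ p → p < D.m → PM D 1 1 (n+1) (n-1+p) → False
  C : (2 * D.L + 1) * D.m ≤ D.L * D.o ∨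
    ∀ n, 1 ≤ n → n ≤ D.L → PM D 1 0 (n+1) (n-1+D.L * D.o) → False

theorem R0_bit {N p : ℕ} (h1 : 1 ≤ p) (h2 : p < N) : (2 ^ N - 2).testBit p = true := by
  obtain ⟨M, rfl⟩ : ∃ M, N = M + 1 := ⟨N - 1, by omega⟩
  obtain ⟨q, rfl⟩ : ∃ q, p = q + 1 := ⟨p - 1, by omega⟩
  rw [show 2 ^ (M+1) - 2 = (2 ^ M - 1) * 2 by rw [Nat.pow_succ]; omega]
  rw [Nat.testBit_succ, Nat.mul_div_cancel _ (by norm_num), Nat.testBit_two_pow_sub_one]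
  simp; omega

theorem chk_sound {D : Dat} (h : chk D = true) : Sound D := by
  unfold chk at h
  rw [Bool.and_eq_true, force_eq, bld_eq] at h
  have ok := basic_ok h.1
  obtain ⟨pl, hp, h⟩ := planes_spec ok _ _ _ _ (PS_init ok) h.2
  rw [Nat.one_mul] at hp
  unfold chk2 at h
  simp only [bldP_eq, bld_eq, force_eq, List.append_nil, Bool.and_eq_true] at h
  obtain ⟨⟨⟨hA, hB⟩, hZ⟩, hC⟩ := h
  have hA' := outA_spec _ _ hA
  have hB' := outB_spec _ _ hB
  have hZ' := alln_spec hZ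
  have hzz := ok.hZ
  have hm3 := ok.m3
  generalize hN : D.L * D.o = N at *
  have hmN : D.m ≤ N := by
    have := ok.hN
    have := ok.L1
    nlinarith
  refine ⟨ok, ?_, ?_, ?_, ?_⟩
  · intro n p hn hnL hp1 hpN
    rw [hN] at hpN
    have hI := hA' (n-1) (by simpa using (by omega : n - 1 < D.L))
    simp only [List.getElem_map, List.getElem_range] at hI
    have hI' := inA_sound (TL := tm D pl 1 0 (n-1+2) (n-1)) (p := p) (by omega : 1 ≤ D.m)
      (((List.range (D.L + D.Z)).map fun i =>
        (tm D pl 0 0 (i+1) (i+1), tm D pl 0 1 (i+1) (i+1))).drop (n-1))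
      (fun j => PM D 0 0 (n+j) (n+j+p)) (fun j => PM D 0 1 (n+j) (n+j+p)) (by
        intro j hj
        have hj' : j < D.L + D.Z - (n-1) := by simpa using hj
        simp only [List.getElem_drop, List.getElem_map, List.getElem_range]
        rw [show n - 1 + j + 1 = n + j by omega]
        exact ⟨fun hh => tm_spec ok hp (by omega) (by omega) (by omega) (by omega) hh,
          fun hh => tm_spec ok hp (by omega) (by omega) (by omega) (by omega) hh⟩)
      (2 ^ N - 2) (2 ^ N - 2) 0 0 (p / D.m) (fun hh => hh) (by simp) (by simpa using hI)
    obtain ⟨d1, d2, d3, d4, d5⟩ := hI'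
    have hR := R0_bit hp1 hpN
    have hTL : PM D 1 0 (n+1) (n-1+p) → (tm D pl 1 0 (n-1+2) (n-1)).testBit p = true := by
      intro hh
      rw [show n - 1 + 2 = n + 1 by omega]
      exact tm_spec ok hp (by omega) (by omega) (by omega) (by omega) hh
    exact ⟨d1 hR, fun h1 h2 => d2 hR (hTL h1) h2, fun h1 h2 => d3 hR h1 h2,
      fun h1 h2 h3 h4 => d5 (hTL h1) h2 hR h3 h4⟩
  · intro n p hn hnL hp1 hpN hW
    rw [hN] at hpN hW
    have hI := hB' (n-1) (by omega)
    refine inB_sound (p := p) _ _ _ hI (fun j => W D 0 0 (n+j) (n+j+p)) ?_ (R0_bit hp1 hpN) hW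
    intro j hj hh
    have hj' : j < D.L + D.Z - (n-1) := by simpa using hj
    simp only [List.getElem_drop, List.getElem_map, List.getElem_range]
    rw [show n - 1 + j + 1 = n + j by omega]
    exact tw_spec ok hp (by omega) (by omega) hh
  · intro n p hn hnL hp3 hpm hh
    have hI := hZ' (n-1) (by omega)
    rw [Nat.beq_eq] at hI
    have ht : (tm D pl 1 1 (n-1+2) (n-1)).testBit p = true := by
      rw [show n - 1 + 2 = n + 1 by omega]
      exact tm_spec ok hp (by omega) (by omega) (by omega) (by omega) hh
    refine land_false hI ht ?_
    rw [Nat.testBit_shiftLeft, Nat.testBit_two_pow_sub_one]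
    simp; omega
  · rw [Bool.or_eq_true, Nat.ble_eq] at hC
    rcases hC with hC | hC
    · left; rw [hN]; exact hC
    · right
      intro n hn hnL hh
      rw [hN] at hh
      have hI := allL_spec hC (tm D pl 1 0 (n-1+2) (n-1)) (by
        simp only [List.mem_map, List.mem_range]
        exact ⟨n-1, by omega, rfl⟩)
      have ht : (tm D pl 1 0 (n-1+2) (n-1)).testBit N = true := by
        rw [show n - 1 + 2 = n + 1 by omega]
        exact tm_spec ok hp (by omega) (by omega) (by omega) (by omega) hh
      rw [Nat.beq_eq] at hI
      rw [Nat.testBit_eq_decide_div_mod_eq, decide_eq_true_eq, ← Nat.shiftRight_eq_div_pow] at ht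
      omega

/-- Reduction of a position to the first block. -/
theorem red (L n : ℕ) (hL : 1 ≤ L) (hn : 1 ≤ n) : ∃ n0 q, 1 ≤ n0 ∧ n0 ≤ L ∧ n = n0 + L * q := by
  refine ⟨(n-1) % L + 1, (n-1)/L, by omega, Nat.mod_lt _ hL, ?_⟩
  have := Nat.mod_add_div (n-1) L
  omega

theorem Sound.big {D : Dat} (h : Sound D) {n p w : ℕ} (hn : 1 ≤ n) (hp : D.L * D.o ≤ p)
    (hw : p / D.m - 1 ≤ w) (hw2 : D.L * D.o ∣ p → 2 * D.L * (p / (D.L * D.o)) ≤ w)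
    (hs : ∀ j < w, G D 0 (n+j) = G D 0 (n+j+p)) : False := by
  have ok := h.ok
  have hL := ok.L1
  have ho := ok.o1
  have hN : 1 ≤ D.L * D.o := Nat.mul_pos hL ho
  have hdm := Nat.mod_add_div p (D.L * D.o)
  set y := p / (D.L * D.o) with hy
  have hy1 : 1 ≤ y := (Nat.one_le_div_iff hN).mpr hp
  by_cases hr : p % (D.L * D.o) = 0
  · have hw' := hw2 (Nat.dvd_of_mod_eq_zero hr)
    rw [hr, Nat.zero_add] at hdm
    -- first visible position
    obtain ⟨q0, hq1, hq2⟩ : ∃ q0, n ≤ D.j0 + D.L * q0 ∧ D.j0 + D.L * q0 < n + D.L := by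
      have hj := ok.hj0
      refine ⟨(n + (D.L - 1 - D.j0)) / D.L, ?_, ?_⟩
      · have h1 := Nat.mod_add_div (n + (D.L - 1 - D.j0)) D.L
        have h2 := Nat.mod_lt (n + (D.L - 1 - D.j0)) hL
        omega
      · have h1 := Nat.mod_add_div (n + (D.L - 1 - D.j0)) D.L
        omega
    obtain ⟨k, hk1, hk2, hk3⟩ := tz_window ok.oev (by omega : 0 < D.o) y q0 hy1
    apply hk3
    have hx1 : D.L * q0 ≤ D.L * k := Nat.mul_le_mul_left _ hk1
    have hx2 : D.L * k + D.L ≤ D.L * q0 + 2 * D.L * y := by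
      have := Nat.mul_le_mul_left D.L (show k + 1 ≤ q0 + 2 * y by omega)
      linarith
    have e := hs (D.j0 + D.L * k - n) (by omega)
    rw [show n + (D.j0 + D.L * k - n) = D.j0 + D.L * k by omega] at e
    have hb1 : (D.j0 + D.L * k) / D.L = k := by
      rw [Nat.add_mul_div_left _ _ hL, Nat.div_eq_of_lt ok.hj0]; omega
    have hb2 : (D.j0 + D.L * k + p) / D.L = k + D.o * y := by
      rw [← hdm, show D.j0 + D.L * k + D.L * D.o * y = D.j0 + D.L * (k + D.o * y) by ring,
        Nat.add_mul_div_left _ _ hL, Nat.div_eq_of_lt ok.hj0]; omega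
    have hF : F D 0 (D.j0 + D.L * k) ≠ F D 1 (D.j0 + D.L * k) := by
      intro e'
      have f0 := F_back ok (show 0 < 4 by omega) D.j0 k
      have f1 := F_back ok (show 1 < 4 by omega) D.j0 k
      rw [e', f1] at f0
      apply ok.hv
      unfold F at f0
      rw [Nat.div_eq_of_lt ok.hj0, Nat.mod_eq_of_lt ok.hj0] at f0
      exact f0.symm
    unfold G at e
    rw [hb1, hb2] at e
    have p0 : F D 0 (D.j0 + D.L * k + p) = F D 0 (D.j0 + D.L * k) := by
      rw [← hdm]; exact F_per ok (by omega) _ _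
    have p1 : F D 1 (D.j0 + D.L * k + p) = F D 1 (D.j0 + D.L * k) := by
      rw [← hdm]; exact F_per ok (by omega) _ _
    simp only [Nat.mul_zero, Nat.zero_add, p0, p1] at e
    cases h1 : tz D.o k <;> cases h2 : tz D.o (k + D.o * y) <;> simp [h1, h2] at e ⊢
    · exact hF e
    · exact hF e.symm
  · obtain ⟨n0, q, h1, h2, rfl⟩ := red D.L n hL hn
    refine h.B n0 (p % (D.L * D.o)) h1 h2 (by omega) (Nat.mod_lt _ hN) ?_
    intro j hj
    have hjw : j < w := by
      have := Nat.div_le_div_right (c := D.m) hp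
      omega
    have e := PM_W (G_PM (hs j hjw))
    rw [show n0 + D.L * q + j = n0 + j + D.L * q by ring] at e
    rw [← hdm, show n0 + j + D.L * q + (p % (D.L * D.o) + D.L * D.o * y) =
      (n0 + j + p % (D.L * D.o)) + D.L * q + D.L * D.o * y by ring, W_per ok (by omega),
      W_shiftq ok (by omega) (by omega)] at e
    exact e

theorem Sound.w2 {D : Dat} (h : Sound D) {p : ℕ} (hp : D.L * D.o ∣ p) :
    2 * D.L * (p / (D.L * D.o)) ≤ p / D.m := by
  obtain ⟨y, rfl⟩ := hp
  have hN : 0 < D.L * D.o := Nat.mul_pos h.ok.L1 h.ok.o1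
  have h3 := h.ok.m3
  rw [Nat.mul_div_cancel_left _ hN, Nat.le_div_iff_mul_le (by omega)]
  have := Nat.mul_le_mul_right y h.ok.hN
  linarith

theorem Sound.good {D : Dat} (h : Sound D) : GoodPair D.m (G D 0) (fun a => G D 1 (a+1)) := by
  have ok := h.ok
  have hL := ok.L1
  have hm3 := ok.m3
  have pms : ∀ {a b x y x' y' : ℕ} (q : ℕ), a < 2 → b < 2 → G D a x = G D b y →
      x = x' + D.L * q → y = y' + D.L * q → PM D a b x' y' := by
    intro a b x y x' y' q ha hb e hx hy
    have := G_PM e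
    rw [hx, hy, PM_shiftq ok ha hb] at this
    exact this
  constructor
  · intro p n hp hn hs
    by_cases hpN : p < D.L * D.o
    · obtain ⟨n0, q, h1, h2, rfl⟩ := red D.L n hL hn
      refine (h.A n0 p h1 h2 hp hpN).1 ?_
      intro j hj
      exact pms q (by omega) (by omega) (hs j (by omega)) (by ring) (by ring)
    · exact h.big hn (by omega) (w := p / D.m + 1) ((Nat.sub_le _ _).trans (Nat.le_succ _))
        (fun hd => (h.w2 hd).trans (Nat.le_succ _)) hs
  · intro p a hp ha hl hs
    by_cases hpN : p < D.L * D.o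
    · obtain ⟨n0, q, h1, h2, rfl⟩ := red D.L a hL ha
      refine (h.A n0 p h1 h2 hp hpN).2.1 ?_ ?_
      · exact pms q (by omega) (by omega) hl (by ring) (by omega)
      · intro j hj
        exact pms q (by omega) (by omega) (hs j (by omega)) (by ring) (by ring)
    · exact h.big ha (by omega) (w := p / D.m) (Nat.sub_le _ _) (fun hd => h.w2 hd) hs
  · intro p n hp hn hs hl
    by_cases hpN : p < D.L * D.o
    · obtain ⟨n0, q, h1, h2, rfl⟩ := red D.L n hL hn
      refine (h.A n0 p h1 h2 hp hpN).2.2.1 ?_ ?_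
      · intro j hj
        exact pms q (by omega) (by omega) (hs j (by omega)) (by ring) (by ring)
      · exact pms q (by omega) (by omega) hl (by ring) (by generalize p / D.m = u; omega)
    · exact h.big hn (by omega) (w := p / D.m) (Nat.sub_le _ _) (fun hd => h.w2 hd) hs
  · intro p a hp ha hl hs hl2
    have hu : 1 ≤ p / D.m := (Nat.one_le_div_iff (by omega)).mpr hp
    by_cases hpN : p < D.L * D.o
    · obtain ⟨n0, q, h1, h2, rfl⟩ := red D.L a hL ha
      refine (h.A n0 p h1 h2 (by omega) hpN).2.2.2 ?_ hu ?_ ?_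
      · exact pms q (by omega) (by omega) hl (by ring) (by omega)
      · intro j hj
        exact pms q (by omega) (by omega) (hs j (by omega)) (by ring) (by ring)
      · exact pms q (by omega) (by omega) hl2 (by omega) (by omega)
    · by_cases hd : D.L * D.o ∣ p
      swap
      · exact h.big ha (by omega) (w := p / D.m - 1) (by omega) (fun hd' => absurd hd' hd) hs
      have hN : 1 ≤ D.L * D.o := Nat.mul_pos hL ok.o1
      rcases h.C with hC | hC
      · refine h.big ha (by omega) (w := p / D.m - 1) (by omega) (fun _ => ?_) hs
        obtain ⟨y, rfl⟩ := hd
        have hy : 1 ≤ y := by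
          rcases Nat.eq_zero_or_pos y with h0 | h0
          · subst h0; omega
          · exact h0
        rw [Nat.mul_div_cancel_left _ hN]
        have : 2 * D.L * y + 1 ≤ D.L * D.o * y / D.m := by
          rw [Nat.le_div_iff_mul_le (by omega)]
          have h1 := Nat.mul_le_mul_right y hC
          have h2 : D.m ≤ D.m * y := Nat.le_mul_of_pos_right _ hy
          nlinarith
        omega
      · obtain ⟨n0, q, h1, h2, rfl⟩ := red D.L a hL ha
        refine hC n0 h1 h2 ?_
        obtain ⟨y, rfl⟩ := hd
        have hy : 1 ≤ y := by
          rcases Nat.eq_zero_or_pos y with h0 | h0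
          · subst h0; omega
          · exact h0
        have hw := PM_W (pms (x' := n0 + 1) (y' := n0 - 1 + D.L * D.o * y) q (by omega) (by omega) hl
          (by ring) (by omega))
        rw [W_per ok (by omega)] at hw
        refine Or.inr ⟨?_, ?_⟩
        · have hzz := ok.hZ
          have ho2 : 2 * D.m ≤ D.o := by
            have := ok.hN
            by_contra hlt
            have h5 : D.L * D.o < D.L * (2 * D.m) := Nat.mul_lt_mul_of_pos_left (by omega) hL
            nlinarith
          have h5 : D.L * 6 ≤ D.L * D.o := Nat.mul_le_mul_left _ (by omega)
          have h6 : (n0 + 1) / D.L ≤ 2 := by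
            apply Nat.le_of_lt_succ
            rw [Nat.div_lt_iff_lt_mul hL]
            omega
          have h7 : 5 ≤ (n0 - 1 + D.L * D.o) / D.L := by
            rw [Nat.le_div_iff_mul_le hL]
            omega
          omega
        · have := W_per (a := 1) (x := n0+1) (y := n0 - 1) ok (show 0 < 2 by omega) 1
          rw [Nat.mul_one] at this
          exact this.mpr hw
  · intro p a hp hpm ha hl
    obtain ⟨n0, q, h1, h2, rfl⟩ := red D.L a hL ha
    exact h.Z n0 p h1 h2 hp hpm (pms q (by omega) (by omega) hl (by ring) (by omega))

theorem main {D : Dat} (h : chk D = true) {k : ℕ} (hk : D.K ≤ k) :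
    ∃ c : ℤ × Bool → Fin k, ColoringFreePlus InfCaterpillar c (1 + 1 / (D.m : ℝ)) := by
  have hs := chk_sound h
  have := hs.ok.m3
  exact glue (by omega) (Finset.range D.K) (by simpa using hk)
    (fun n => Finset.mem_range.mpr (G_lt hs.ok (by omega) n))
    (fun n => Finset.mem_range.mpr (G_lt hs.ok (by omega) (n+1))) hs.good

end Sm

namespace Sm

def d3 : Dat where
  m := 3
  L := 18
  o := 6
  K := 6
  T := 880212601308195193516956883854947207440138754087560817514437962096459801508366892396012117848134591075400314479652102471647498436
  P := 5386022916
  Q := 5369245953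
  j0 := 4
  rd := 4
  Z := 9

theorem c3 : chk d3 = true := by decide +kernel

def d4 : Dat where
  m := 4
  L := 20
  o := 10
  K := 7
  T := 147118687900413715373586743298330775715164924353972459591326402874244024898315584664463319441749859625699455774102794099575594661847354250109312
  P := 140678029317
  Q := 137490620673
  j0 := 6
  rd := 5
  Z := 8

theorem c4 : chk d4 = true := by decide +kernel

def d5 : Dat where
  m := 5
  L := 20
  o := 12
  K := 9
  T := 98376714376451409025372283734747662006206844422366392668144053744576205452961911665472767289481998255851585427363971564281154377035298724409728
  P := 2260670113394694
  Q := 2269397419323777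
  j0 := 10
  rd := 5
  Z := 13

theorem c5 : chk d5 = true := by decide +kernel

def d6 : Dat where
  m := 6
  L := 20
  o := 18
  K := 11
  T := 56470231676779867404207103731611445038707522612287748502420089000561414920150443562217967228564010023409908636300750044134196163043281665819270
  P := 8091306071002743364
  Q := 9241993850041422406
  j0 := 6
  rd := 6
  Z := 11

theorem c6 : chk d6 = true := by decide +kernel

def d7 : Dat where
  m := 7
  L := 20
  o := 24
  K := 13
  T := 545721597544832951911320625983957356950688518855944588548877907731167135051304242063015232649416475184156535628355442501140700625131979520905991
  P := 825530096116752208323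
  Q := 48041196518260047122700
  j0 := 6
  rd := 6
  Z := 10

theorem c7 : chk d7 = true := by decide +kernel

def d8 : Dat where
  m := 8
  L := 20
  o := 18
  K := 15
  T := 444487240860821461282366808578878266888966706189079886901112319362631777873836621118368965230474458798509138301731646354862878879969412567573384
  P := 196182239450691932536438851
  Q := 80729535485399356835659842
  j0 := 10
  rd := 6
  Z := 13

theorem c8 : chk d8 = true := by decide +kernel

def d9 : Dat where
  m := 9
  L := 20
  o := 30
  K := 17
  T := 537348804756877072403303457164509463824180800300782885001196166687893413596702541204935674119146126641580958090471892216895560714801879108555785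
  P := 647462900242353976512412447504
  Q := 2650877932943881824999097222
  j0 := 3
  rd := 6
  Z := 13

theorem c9 : chk d9 = true := by decide +kernel

def d10 : Dat where
  m := 10
  L := 16
  o := 24
  K := 19
  T := 3821280868169790374516124861999810449942090955944170128292380974298846417546004837640995833067187326660198037197952
  P := 1654065189627232025639785697932356
  Q := 2277432376246806709962321712955781
  j0 := 3
  rd := 6
  Z := 9

theorem c10 : chk d10 = true := by decide +kernel

def d11 : Dat where
  m := 11
  L := 15
  o := 68
  K := 21
  T := 594770261856617582739205656215271093878026259574779948503344997454415895868804242389971679722015797750060299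
  P := 18945819979551525779054031327924601155
  Q := 22870826881126608616170242086562464398
  j0 := 2
  rd := 8
  Z := 12

theorem c11 : chk d11 = true := by decide +kernel

def d12 : Dat where
  m := 12
  L := 16
  o := 40
  K := 23
  T := 10604142222129702965804941303438433376718550360916078822480832388962144622351852856477280740357950832740927893464460
  P := 83133034614825325152094867819377018552643
  Q := 104740594690134737152262611186234276492432
  j0 := 2
  rd := 7
  Z := 8

theorem c12 : chk d12 = true := by decide +kernel

def d13 : Dat where
  m := 13
  L := 17
  o := 36
  K := 25
  T := 41699821614447976390273615655493369095401400788355864178301967965873747460130165417026863245880001221309640664921137018381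
  P := 358218668052192092418536849045948650021999761
  Q := 474327691836828308163238684376267948928623250
  j0 := 2
  rd := 7
  Z := 10

theorem c13 : chk d13 = true := by decide +kernel

def d14 : Dat where
  m := 14
  L := 27
  o := 36
  K := 27
  T := 237631836166081244426765561746689296879747757441644555108915381128968477822883806528746116790182443042400845874401938190987155774197199933365442450308994552960973917774199043097221701107695551450
  P := 932022846849995241093681714073546430071888684683
  Q := 123014520933938135648075686759873843586957321742
  j0 := 7
  rd := 7
  Z := 14

theorem c14 : chk d14 = true := by decide +kernel

def d15 : Dat where
  m := 15
  L := 21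
  o := 60
  K := 29
  T := 18058194803895321579141073097763714254054563178082448828605593149593770170496901668464459060225607247594649171105058569676974047433724823012267075835663
  P := 7611890189197794484115161047673062990615724576498117
  Q := 4227235423672552075130453326454405153341445349664276
  j0 := 3
  rd := 7
  Z := 9

theorem c15 : chk d15 = true := by decide +kernel

def d16 : Dat where
  m := 16
  L := 32
  o := 84
  K := 31
  T := 461763892408577475984581411744483857072158701867123409098790883408889607190879438263920218826685073439831639512165789104651686686596027297724095290015890919887693830649425477540989219657682683726067870571650927009124993336445577088
  P := 20378250636359725401809070307205163689229408029254092687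
  Q := 2136873976904640629197830358151047718473144290797536386
  j0 := 2
  rd := 8
  Z := 16

theorem c16 : chk d16 = true := by decide +kernel

def d17 : Dat where
  m := 17
  L := 23
  o := 60
  K := 33
  T := 1397660508754250673589574119202143682215418556482747503973633745373643565439828645011434209265095181471642197096369349185252085522238963978185234273455701390668079136
  P := 19426423437784138265184723702871051236962834935132713154071
  Q := 165471716470724678615514054773021515216754181950223255918171
  j0 := 2
  rd := 7
  Z := 26

theorem c17 : chk d17 = true := by decide +kernel

def d18 : Dat where
  m := 18
  L := 28
  o := 42
  K := 35
  T := 3417626758774043949291894368073996664637426555273938919100957343496529638317002088940749615014429023669332970412299923743446487184275633779724938754482534388593849797691448511214222975065799353158079698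
  P := 672970443823331771061283674316354112474988739366946860860294985
  Q := 574206049470519653606481951016963396905806117396855307113710231
  j0 := 6
  rd := 7
  Z := 12

theorem c18 : chk d18 = true := by decide +kernel

def d19 : Dat where
  m := 19
  L := 29
  o := 102
  K := 37
  T := 144564387949842088585818914736537389744897466219354690233712078890038668554820946605105183078765684621894225113336147927099324396913060407045416191927658133657713285679482641537069935009445513217738071847023908
  P := 3205677536821494869185600635581780422138448566014121084242531054237
  Q := 2881852684279120482294120353131471284676838689684448524523450975832
  j0 := 4
  rd := 8
  Z := 32

theorem c19 : chk d19 = true := by decide +kernel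

def d20 : Dat where
  m := 20
  L := 26
  o := 112
  K := 39
  T := 5887405697031032660403136050052697717013223839960659813033314529613506521721751100258539718216762680067707898504518770618035011375815371298059563626004235260513968019826091665299951327636
  P := 1761915818220457254259854602445962499738368593265159220815882319152838
  Q := 14433305305064649320920014884115746805573038061563337570982798085458062
  j0 := 2
  rd := 8
  Z := 15

theorem c20 : chk d20 = true := by decide +kernel

def d21 : Dat where
  m := 21
  L := 34
  o := 84
  K := 41
  T := 240423859311883237164324774007737112489060511164594281203679489821298712504101732753942379854571386731553658744482295399165280570884037007276260458407515407373146081686888740195657487212636746974656576196700797034160443399102890778458590648299560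
  P := 57511181716985671156034056642203866957628053074519986216539719745183736610
  Q := 18341108217282588003448820715303829782341159393142379869131590312322774665
  j0 := 2
  rd := 8
  Z := 16

theorem c21 : chk d21 = true := by decide +kernel

def d22 : Dat where
  m := 22
  L := 30
  o := 120
  K := 43
  T := 698147597840083094978637075872913176834606379826257458345862728880449540335049588547567713501299989491704239725482852746928634593830964528619238163328422752166699216075522252457719508232489378338595223317133715147392
  P := 51575068155990923521342890205636586037671043736152775192900332969191954581470
  Q := 112078980945327531869485852283125516434115621789458783878801130299365430200674
  j0 := 4
  rd := 8
  Z := 9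

theorem c22 : chk d22 = true := by decide +kernel

def d23 : Dat where
  m := 23
  L := 29
  o := 70
  K := 45
  T := 31068672652905722851448642724733724171084086661854733609100811829635459092958359239736060530518609741023226840407772417599869005487484753686363137932876312426540066908923346728474004420668533331642807455587072
  P := 832799027589481541235301626251147190805951709097989496094476417552521424141416349
  Q := 1172528921513349007482381128846017207876629442478033989050297269217287344111641810
  j0 := 2
  rd := 8
  Z := 14

theorem c23 : chk d23 = true := by decide +kernel

def d24 : Dat where
  m := 24
  L := 40
  o := 60
  K := 47
  T := 6281739218198882604459516529284460027526862911389963264126010704455602507859649332901717223199907670453644021479446527782913491709438916797554662867262459985562313372246101334456920553787770125879381408172742259688871246930403595486777837944761051559879168627326634789019445851249053376622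
  P := 4449269156782569764347853311918598365522027409387457824509275144920559191510888131048
  Q := 980950303934064779857574689340065926348590360966930062774543531894367661004340114077
  j0 := 7
  rd := 7
  Z := 7

theorem c24 : chk d24 = true := by decide +kernel

def d25 : Dat where
  m := 25
  L := 29
  o := 90
  K := 49
  T := 156332897834541427588968010540364142543183113287764337177217611237611585628822550246439877510273891464693235063549692603909131853141099662794022386486468797908654864515450350862108938615036515641155592886688793
  P := 14161540274231451616738407791796388543676032748586633624741583500229591573078606203339075
  Q := 22532120268481050724437236100896978548752586389975579265557077391825147054823654486623786
  j0 := 2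
  rd := 8
  Z := 30

theorem c25 : chk d25 = true := by decide +kernel

def d26 : Dat where
  m := 26
  L := 34
  o := 90
  K := 51
  T := 57944214148339205444169060175905539862729229081151865618234772510353691744491540213327012806380551246920742177163009741918505267296934953557735838882338034436123239203304912908650248699664265145645441967670884266499952220832633173432225604835008
  P := 67492292026863006843343467914815763427007390536249434747342118715672229470716308484896626914
  Q := 84003159769158576824320843400066122992805197801598146587360313191687386734204934447548949779
  j0 := 5
  rd := 8
  Z := 7

theorem c26 : chk d26 = true := by decide +kernel

def d27 : Dat where
  m := 27
  L := 33
  o := 84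
  K := 53
  T := 14050506762538607127094537431788028604378434827659985283642897084980458496387109352709312960003285989683512441251780157518889433496166028388463040710247083297816580389985741000018440361911607828458831648086375467200751837665693981260502772
  P := 46219341926215776709326159279429374873701564026095369842516360990507380224637004828785665520004
  Q := 389451240162047284367108046502295415716142745557356019206076404152969078652510943918308475628396
  j0 := 2
  rd := 8
  Z := 25

theorem c27 : chk d27 = true := by decide +kernel

def d28 : Dat where
  m := 28
  L := 41
  o := 102
  K := 55
  T := 107760783501057702589978461991059187901688101344425627841129667180540580796568635657752924801983329223744176113695054203825640934177048424157259838380621941929231117919040646579175350415043369273612903548058741045140443185527857333516180894227900179312802319356051172303067246263913156721135331072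
  P := 1355380848305090619654765785295984622898193061617104668980956964854503369550202261099455972875756329
  Q := 1339360364150864100265787032943762931688954052047926423910573240995519757390369016163728284721001744
  j0 := 7
  rd := 8
  Z := 31

theorem c28 : chk d28 = true := by decide +kernel

def d29 : Dat where
  m := 29
  L := 39
  o := 80
  K := 57
  T := 368373768390357609169454089522676731213747336358697395869266836769020878254316472857103129710316785490460154307266801627457436450018616901040781274303957963519231233440802083522518334153552789451638014104685941027693711080694852040729807687653245541222205967051174847159668746229632
  P := 1068663450925462510813986087468909625286938074498241803834125543583957514545474858135944557132507826634
  Q := 6195751668651752758790051505731763058883814419597885388539805576382520869172409499957635645908012967252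
  j0 := 5
  rd := 8
  Z := 9

theorem c29 : chk d29 = true := by decide +kernel

def d30 : Dat where
  m := 30
  L := 36
  o := 68
  K := 59
  T := 71247287864391456142602162179383330135248161684176855035459297046170166268794562739050595287063423969130062444880094928185698512173507269034196736845052410772968603536755104977844213173265137984011710568712375699072861153152479095741209657034618617868348424250
  P := 2052240555159139252050874158483965992933925612285950414280968436518909504429034485887767417248667538448804
  Q := 14780118707884228170714206354435618129205780972826481239330534288199173540765740354895940367904933667366389
  j0 := 2
  rd := 8
  Z := 30

theorem c30 : chk d30 = true := by decide +kernel

def d31 : Dat where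
  m := 31
  L := 47
  o := 100
  K := 61
  T := 2745947307437693571853862033445782933094142916823184129840103301074132030223330824673073265027247516924611848342471308617813366365403308890301354311079485452710492761721416693167512994903293122025104501743510761331533607173820024206765263442322557677881686246923504951206627736123549485306203597632571010366392611047824979463521455244189471
  P := 34648301670901751299898039327669952711139127689629061002427902881206936657694057126257121322232562107770282960
  Q := 41453044664187820017762732112792731669863706535136863031036394098465125577921999573947873839082126306462463118
  j0 := 4
  rd := 8
  Z := 14

theorem c31 : chk d31 = true := by decide +kernel

theorem small {m k : ℕ} (h3 : 3 ≤ m) (h31 : m < 32) (hk : 2 * m - 1 ≤ k) (hk6 : 6 ≤ k) :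
    ∃ c : ℤ × Bool → Fin k, ColoringFreePlus InfCaterpillar c (1 + 1 / (m : ℝ)) := by
  interval_cases m
  · exact main c3 (show 6 ≤ k by omega)
  · exact main c4 (show 7 ≤ k by omega)
  · exact main c5 (show 9 ≤ k by omega)
  · exact main c6 (show 11 ≤ k by omega)
  · exact main c7 (show 13 ≤ k by omega)
  · exact main c8 (show 15 ≤ k by omega)
  · exact main c9 (show 17 ≤ k by omega)
  · exact main c10 (show 19 ≤ k by omega)
  · exact main c11 (show 21 ≤ k by omega)
  · exact main c12 (show 23 ≤ k by omega)
  · exact main c13 (show 25 ≤ k by omega)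
  · exact main c14 (show 27 ≤ k by omega)
  · exact main c15 (show 29 ≤ k by omega)
  · exact main c16 (show 31 ≤ k by omega)
  · exact main c17 (show 33 ≤ k by omega)
  · exact main c18 (show 35 ≤ k by omega)
  · exact main c19 (show 37 ≤ k by omega)
  · exact main c20 (show 39 ≤ k by omega)
  · exact main c21 (show 41 ≤ k by omega)
  · exact main c22 (show 43 ≤ k by omega)
  · exact main c23 (show 45 ≤ k by omega)
  · exact main c24 (show 47 ≤ k by omega)
  · exact main c25 (show 49 ≤ k by omega)
  · exact main c26 (show 51 ≤ k by omega)
  · exact main c27 (show 53 ≤ k by omega)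
  · exact main c28 (show 55 ≤ k by omega)
  · exact main c29 (show 57 ≤ k by omega)
  · exact main c30 (show 59 ≤ k by omega)
  · exact main c31 (show 61 ≤ k by omega)

end Sm

/-- For every `k ≥ 6`, the infinite caterpillar of maximum degree 3 admits a `k`-coloring
that is `(1 + 1/⌈k/2⌉)⁺`-free. -/
theorem infCaterpillar_k_coloring_free (k : ℕ) (hk : 6 ≤ k) :
    ∃ c : ℤ × Bool → Fin k,
      ColoringFreePlus InfCaterpillar c (1 + 1 / (((k + 1) / 2 : ℕ) : ℝ)) := by
  by_cases h : 32 ≤ (k + 1) / 2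
  · exact large_case h (by omega)
  · exact Sm.small (by omega) (by omega) (by omega) hk
end

section
/- Every 5-coloring of the infinite rooted binary tree T contains a factor that is a repetition of exponent at least 3/2. (Hence the repetition threshold of trees of maximum degree 3 over a 5-letter alphabet equals 3/2.) -/
open SimpleGraph

/-- The infinite rooted binary tree `T`: vertices are finite binary strings (the root is the
empty string), and each vertex `s` is adjacent to its two sons `s ++ [false]` and `s ++ [true]`. -/
def BinTree : SimpleGraph (List Bool) :=
  SimpleGraph.fromRel (fun a b => ∃ x : Bool, b = a ++ [x])

set_option maxHeartbeats 0 in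
set_option synthInstance.maxHeartbeats 0 in
set_option synthInstance.maxSize 100000 in
set_option maxRecDepth 100000 in
/-- The finite combinatorial core: the ball of radius 2 around an edge `uv` of the cubic tree
(14 vertices) has no 5-coloring avoiding repetitions of exponent at least `3/2` and period
at most 4. -/
theorem core_search :
    ∀ u : Fin 5,
    ∀ v : Fin 5, (u ≠ v) →
    ∀ a : Fin 5, (u ≠ a ∧
      v ≠ a) →
    ∀ b : Fin 5, (u ≠ b ∧
      v ≠ b ∧
      a ≠ b) →
    ∀ c : Fin 5, (v ≠ c ∧
      u ≠ c) →
    ∀ d : Fin 5, (v ≠ d ∧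
      u ≠ d ∧
      c ≠ d) →
    ∀ a1 : Fin 5, (a ≠ a1 ∧
      u ≠ a1 ∧
      ¬(c = a ∧ v = a1) ∧
      ¬(d = a ∧ v = a1)) →
    ∀ a2 : Fin 5, (a ≠ a2 ∧
      u ≠ a2 ∧
      a1 ≠ a2 ∧
      ¬(c = a ∧ v = a2) ∧
      ¬(d = a ∧ v = a2)) →
    ∀ c1 : Fin 5, (c ≠ c1 ∧
      v ≠ c1 ∧
      ¬(a = c ∧ u = c1) ∧
      ¬(b = c ∧ u = c1) ∧
      ¬(a1 = c ∧ a = c1) ∧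
      ¬(a2 = c ∧ a = c1)) →
    ∀ c2 : Fin 5, (c ≠ c2 ∧
      v ≠ c2 ∧
      c1 ≠ c2 ∧
      ¬(a = c ∧ u = c2) ∧
      ¬(b = c ∧ u = c2) ∧
      ¬(a1 = c ∧ a = c2) ∧
      ¬(a2 = c ∧ a = c2)) →
    ∀ b1 : Fin 5, (b ≠ b1 ∧
      u ≠ b1 ∧
      ¬(c = b ∧ v = b1) ∧
      ¬(d = b ∧ v = b1) ∧
      ¬(a1 = b ∧ a = b1) ∧
      ¬(a2 = b ∧ a = b1) ∧
      ¬(c1 = b ∧ c = b1) ∧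
      ¬(c2 = b ∧ c = b1)) →
    ∀ b2 : Fin 5, (b ≠ b2 ∧
      u ≠ b2 ∧
      b1 ≠ b2 ∧
      ¬(c = b ∧ v = b2) ∧
      ¬(d = b ∧ v = b2) ∧
      ¬(a1 = b ∧ a = b2) ∧
      ¬(a2 = b ∧ a = b2) ∧
      ¬(c1 = b ∧ c = b2) ∧
      ¬(c2 = b ∧ c = b2)) →
    ∀ d1 : Fin 5, (d ≠ d1 ∧
      v ≠ d1 ∧
      ¬(a = d ∧ u = d1) ∧
      ¬(b = d ∧ u = d1) ∧
      ¬(c1 = d ∧ c = d1) ∧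
      ¬(c2 = d ∧ c = d1) ∧
      ¬(a1 = d ∧ a = d1) ∧
      ¬(a2 = d ∧ a = d1) ∧
      ¬(b1 = d ∧ b = d1) ∧
      ¬(b2 = d ∧ b = d1)) →
    ∀ d2 : Fin 5, (d ≠ d2 ∧
      v ≠ d2 ∧
      d1 ≠ d2 ∧
      ¬(a = d ∧ u = d2) ∧
      ¬(b = d ∧ u = d2) ∧
      ¬(c1 = d ∧ c = d2) ∧
      ¬(c2 = d ∧ c = d2) ∧
      ¬(a1 = d ∧ a = d2) ∧
      ¬(a2 = d ∧ a = d2) ∧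
      ¬(b1 = d ∧ b = d2) ∧
      ¬(b2 = d ∧ b = d2)) →
      False := by
  decide +kernel

instance binTreeAdjDecidable : DecidableRel BinTree.Adj := fun a b =>
  decidable_of_iff (a ≠ b ∧ ((∃ x : Bool, b = a ++ [x]) ∨ (∃ x : Bool, a = b ++ [x])))
    (by simp [BinTree, SimpleGraph.fromRel_adj])

theorem exists_walk_of_chain {V : Type*} (G : SimpleGraph V) :
    ∀ (l : List V) (x : V), (x :: l).IsChain G.Adj →
      ∃ (y : V) (p : G.Walk x y), p.support = x :: l := by
  intro l
  induction l with
  | nil => intro x _; exact ⟨x, .nil, rfl⟩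
  | cons z l ih =>
    intro x h
    rw [List.isChain_cons_cons] at h
    obtain ⟨y, p, hp⟩ := ih z h.2
    exact ⟨y, .cons h.1 p, by simp [hp]⟩

theorem rep_of_list (c : List Bool → Fin 5) (x : List Bool) (l : List (List Bool))
    (h : (x :: l).IsChain BinTree.Adj) (hn : (x :: l).Nodup)
    (hr : HasRepGE (3 / 2) ((x :: l).map c)) : ColoringHasRepGE BinTree c (3 / 2) := by
  obtain ⟨y, p, hp⟩ := exists_walk_of_chain BinTree l x h
  refine ⟨x, y, p, ?_, ?_⟩
  · rw [SimpleGraph.Walk.isPath_def, hp]; exact hn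
  · rw [hp]; exact hr

abbrev vertex_u : List Bool := [false, false]

abbrev vertex_v : List Bool := [false, false, false]

abbrev vertex_a : List Bool := [false]

abbrev vertex_b : List Bool := [false, false, true]

abbrev vertex_c : List Bool := [false, false, false, false]

abbrev vertex_d : List Bool := [false, false, false, true]

abbrev vertex_a1 : List Bool := []

abbrev vertex_a2 : List Bool := [false, true]

abbrev vertex_c1 : List Bool := [false, false, false, false, false]

abbrev vertex_c2 : List Bool := [false, false, false, false, true]

abbrev vertex_b1 : List Bool := [false, false, true, false]

abbrev vertex_b2 : List Bool := [false, false, true, true]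

abbrev vertex_d1 : List Bool := [false, false, false, true, false]

abbrev vertex_d2 : List Bool := [false, false, false, true, true]

/-- Every 5-coloring of the infinite rooted binary tree contains a factor that is a
repetition of exponent at least 3/2 (hence `RT(5, T₃) = 3/2`). -/
theorem binTree_five_coloring_hasRep (c : List Bool → Fin 5) :
    ColoringHasRepGE BinTree c (3 / 2) := by
  by_contra hc
  have h2 : ∀ x y : List Bool, [x, y].IsChain BinTree.Adj → [x, y].Nodup → c x ≠ c y := by
    intro x y h hn he
    refine hc (rep_of_list c _ _ h hn ⟨[c x], [c y], by simp, by simp, by simp [he], ?_⟩)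
    norm_num
  have h3 : ∀ x y z : List Bool, [x, y, z].IsChain BinTree.Adj → [x, y, z].Nodup →
      c x ≠ c z := by
    intro x y z h hn he
    refine hc (rep_of_list c _ _ h hn ⟨[c x, c y], [c z], by simp, by simp, by simp [he], ?_⟩)
    norm_num
  have h5 : ∀ x0 x1 x2 x3 x4 : List Bool, [x0, x1, x2, x3, x4].IsChain BinTree.Adj →
      [x0, x1, x2, x3, x4].Nodup → ¬(c x0 = c x3 ∧ c x1 = c x4) := by
    intro x0 x1 x2 x3 x4 h hn he
    refine hc (rep_of_list c _ _ h hn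
      ⟨[c x0, c x1, c x2], [c x3, c x4], by simp, by simp, by simp [he.1, he.2], ?_⟩)
    norm_num
  have h6 : ∀ x0 x1 x2 x3 x4 x5 : List Bool, [x0, x1, x2, x3, x4, x5].IsChain BinTree.Adj →
      [x0, x1, x2, x3, x4, x5].Nodup → ¬(c x0 = c x4 ∧ c x1 = c x5) := by
    intro x0 x1 x2 x3 x4 x5 h hn he
    refine hc (rep_of_list c _ _ h hn
      ⟨[c x0, c x1, c x2, c x3], [c x4, c x5], by simp, by simp, by simp [he.1, he.2], ?_⟩)
    norm_num
  exact core_search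
    (c vertex_u)
    (c vertex_v)
    (h2 vertex_u vertex_v (by decide) (by decide))
    (c vertex_a)
    ⟨h2 vertex_u vertex_a (by decide) (by decide),
      h3 vertex_v vertex_u vertex_a (by decide) (by decide)⟩
    (c vertex_b)
    ⟨h2 vertex_u vertex_b (by decide) (by decide),
      h3 vertex_v vertex_u vertex_b (by decide) (by decide),
      h3 vertex_a vertex_u vertex_b (by decide) (by decide)⟩
    (c vertex_c)
    ⟨h2 vertex_v vertex_c (by decide) (by decide),
      h3 vertex_u vertex_v vertex_c (by decide) (by decide)⟩
    (c vertex_d)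
    ⟨h2 vertex_v vertex_d (by decide) (by decide),
      h3 vertex_u vertex_v vertex_d (by decide) (by decide),
      h3 vertex_c vertex_v vertex_d (by decide) (by decide)⟩
    (c vertex_a1)
    ⟨h2 vertex_a vertex_a1 (by decide) (by decide),
      h3 vertex_u vertex_a vertex_a1 (by decide) (by decide),
      h5 vertex_c vertex_v vertex_u vertex_a vertex_a1 (by decide) (by decide),
      h5 vertex_d vertex_v vertex_u vertex_a vertex_a1 (by decide) (by decide)⟩
    (c vertex_a2)
    ⟨h2 vertex_a vertex_a2 (by decide) (by decide),
      h3 vertex_u vertex_a vertex_a2 (by decide) (by decide),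
      h3 vertex_a1 vertex_a vertex_a2 (by decide) (by decide),
      h5 vertex_c vertex_v vertex_u vertex_a vertex_a2 (by decide) (by decide),
      h5 vertex_d vertex_v vertex_u vertex_a vertex_a2 (by decide) (by decide)⟩
    (c vertex_c1)
    ⟨h2 vertex_c vertex_c1 (by decide) (by decide),
      h3 vertex_v vertex_c vertex_c1 (by decide) (by decide),
      h5 vertex_a vertex_u vertex_v vertex_c vertex_c1 (by decide) (by decide),
      h5 vertex_b vertex_u vertex_v vertex_c vertex_c1 (by decide) (by decide),
      h6 vertex_a1 vertex_a vertex_u vertex_v vertex_c vertex_c1 (by decide) (by decide),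
      h6 vertex_a2 vertex_a vertex_u vertex_v vertex_c vertex_c1 (by decide) (by decide)⟩
    (c vertex_c2)
    ⟨h2 vertex_c vertex_c2 (by decide) (by decide),
      h3 vertex_v vertex_c vertex_c2 (by decide) (by decide),
      h3 vertex_c1 vertex_c vertex_c2 (by decide) (by decide),
      h5 vertex_a vertex_u vertex_v vertex_c vertex_c2 (by decide) (by decide),
      h5 vertex_b vertex_u vertex_v vertex_c vertex_c2 (by decide) (by decide),
      h6 vertex_a1 vertex_a vertex_u vertex_v vertex_c vertex_c2 (by decide) (by decide),
      h6 vertex_a2 vertex_a vertex_u vertex_v vertex_c vertex_c2 (by decide) (by decide)⟩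
    (c vertex_b1)
    ⟨h2 vertex_b vertex_b1 (by decide) (by decide),
      h3 vertex_u vertex_b vertex_b1 (by decide) (by decide),
      h5 vertex_c vertex_v vertex_u vertex_b vertex_b1 (by decide) (by decide),
      h5 vertex_d vertex_v vertex_u vertex_b vertex_b1 (by decide) (by decide),
      h5 vertex_a1 vertex_a vertex_u vertex_b vertex_b1 (by decide) (by decide),
      h5 vertex_a2 vertex_a vertex_u vertex_b vertex_b1 (by decide) (by decide),
      h6 vertex_c1 vertex_c vertex_v vertex_u vertex_b vertex_b1 (by decide) (by decide),
      h6 vertex_c2 vertex_c vertex_v vertex_u vertex_b vertex_b1 (by decide) (by decide)⟩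
    (c vertex_b2)
    ⟨h2 vertex_b vertex_b2 (by decide) (by decide),
      h3 vertex_u vertex_b vertex_b2 (by decide) (by decide),
      h3 vertex_b1 vertex_b vertex_b2 (by decide) (by decide),
      h5 vertex_c vertex_v vertex_u vertex_b vertex_b2 (by decide) (by decide),
      h5 vertex_d vertex_v vertex_u vertex_b vertex_b2 (by decide) (by decide),
      h5 vertex_a1 vertex_a vertex_u vertex_b vertex_b2 (by decide) (by decide),
      h5 vertex_a2 vertex_a vertex_u vertex_b vertex_b2 (by decide) (by decide),
      h6 vertex_c1 vertex_c vertex_v vertex_u vertex_b vertex_b2 (by decide) (by decide),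
      h6 vertex_c2 vertex_c vertex_v vertex_u vertex_b vertex_b2 (by decide) (by decide)⟩
    (c vertex_d1)
    ⟨h2 vertex_d vertex_d1 (by decide) (by decide),
      h3 vertex_v vertex_d vertex_d1 (by decide) (by decide),
      h5 vertex_a vertex_u vertex_v vertex_d vertex_d1 (by decide) (by decide),
      h5 vertex_b vertex_u vertex_v vertex_d vertex_d1 (by decide) (by decide),
      h5 vertex_c1 vertex_c vertex_v vertex_d vertex_d1 (by decide) (by decide),
      h5 vertex_c2 vertex_c vertex_v vertex_d vertex_d1 (by decide) (by decide),
      h6 vertex_a1 vertex_a vertex_u vertex_v vertex_d vertex_d1 (by decide) (by decide),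
      h6 vertex_a2 vertex_a vertex_u vertex_v vertex_d vertex_d1 (by decide) (by decide),
      h6 vertex_b1 vertex_b vertex_u vertex_v vertex_d vertex_d1 (by decide) (by decide),
      h6 vertex_b2 vertex_b vertex_u vertex_v vertex_d vertex_d1 (by decide) (by decide)⟩
    (c vertex_d2)
    ⟨h2 vertex_d vertex_d2 (by decide) (by decide),
      h3 vertex_v vertex_d vertex_d2 (by decide) (by decide),
      h3 vertex_d1 vertex_d vertex_d2 (by decide) (by decide),
      h5 vertex_a vertex_u vertex_v vertex_d vertex_d2 (by decide) (by decide),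
      h5 vertex_b vertex_u vertex_v vertex_d vertex_d2 (by decide) (by decide),
      h5 vertex_c1 vertex_c vertex_v vertex_d vertex_d2 (by decide) (by decide),
      h5 vertex_c2 vertex_c vertex_v vertex_d vertex_d2 (by decide) (by decide),
      h6 vertex_a1 vertex_a vertex_u vertex_v vertex_d vertex_d2 (by decide) (by decide),
      h6 vertex_a2 vertex_a vertex_u vertex_v vertex_d vertex_d2 (by decide) (by decide),
      h6 vertex_b1 vertex_b vertex_u vertex_v vertex_d vertex_d2 (by decide) (by decide),
      h6 vertex_b2 vertex_b vertex_u vertex_v vertex_d vertex_d2 (by decide) (by decide)⟩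
end

section
/- For every integer t ≥ 4, the infinite rooted binary tree T admits a coloring with (t+1)·2^⌊(t+1)/2⌋ colors that is (1 + 1/t)⁺-free, i.e., in which no factor contains a repetition of exponent strictly greater than 1 + 1/t. -/
open SimpleGraph

/-- The newest letter (head) of `L` completes a forbidden pattern. -/
def BadHead {α : Type*} (t : ℕ) (L : List α) : Prop :=
  (∃ r, 1 ≤ r ∧ r < t ∧ r < L.length ∧ L[0]? = L[r]?) ∨
  (∃ k r, 1 ≤ k ∧ r < t ∧ k * t + r + k < L.length ∧ ∀ i ≤ k, L[i]? = L[i + (k * t + r)]?) ∨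
  (∃ k r, 1 ≤ k ∧ r < t ∧ k * t + 2 + r < L.length ∧ ∀ i ≤ k, L[i]? = L[k * t + 2 + r - i]?)

open Classical in
/-- Admissible words of length `n` (newest letter first). -/
noncomputable def GoodW (t K : ℕ) : ℕ → Finset (List (Fin K))
  | 0 => {[]}
  | n + 1 => ((Finset.univ ×ˢ GoodW t K n).image (fun q => q.1 :: q.2)).filter
      (fun L => ¬ BadHead t L)

theorem goodW_length {t K : ℕ} : ∀ {n : ℕ} {L : List (Fin K)}, L ∈ GoodW t K n → L.length = n
  | 0, L, h => by
    simp only [GoodW, Finset.mem_singleton] at h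
    simp [h]
  | n + 1, L, h => by
    simp only [GoodW, Finset.mem_filter, Finset.mem_image, Finset.mem_product] at h
    obtain ⟨⟨q, ⟨-, hq⟩, rfl⟩, -⟩ := h
    simp [goodW_length hq]

theorem goodW_drop {t K : ℕ} : ∀ {d n : ℕ} {L : List (Fin K)}, L ∈ GoodW t K (n + d) →
    L.drop d ∈ GoodW t K n
  | 0, n, L, h => by simpa using h
  | d + 1, n, L, h => by
    rw [← add_assoc] at h
    simp only [GoodW, Finset.mem_filter, Finset.mem_image, Finset.mem_product] at h
    obtain ⟨⟨q, ⟨-, hq⟩, rfl⟩, -⟩ := h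
    simpa using goodW_drop hq

theorem goodW_not_bad {t K n : ℕ} {L : List (Fin K)} (h : L ∈ GoodW t K (n + 1)) :
    ¬ BadHead t L := by
  simp only [GoodW, Finset.mem_filter] at h
  exact h.2

open Classical in
/-- If the first `k+1` letters are determined by the rest, few words satisfy the constraint. -/
theorem card_constraint {t K n k : ℕ} (hk : k ≤ n) (φ : ℕ → ℕ) (hφ : ∀ i ≤ k, k < φ i) :
    (((Finset.univ ×ˢ GoodW t K n).image (fun q : Fin K × List (Fin K) => q.1 :: q.2)).filter
      (fun L => ∀ i ≤ k, L[i]? = L[φ i]?)).card ≤ (GoodW t K (n - k)).card := by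
  apply Finset.card_le_card_of_injOn (fun L => L.drop (k + 1))
  · intro L hL
    simp only [Finset.coe_filter, Finset.mem_image, Finset.mem_product, Set.mem_ofPred_eq] at hL
    obtain ⟨⟨q, ⟨-, hq⟩, rfl⟩, -⟩ := hL
    simp only [List.drop_succ_cons]
    apply goodW_drop
    rwa [Nat.sub_add_cancel hk]
  · intro L hL M hM hLM
    simp only [Finset.coe_filter, Set.mem_ofPred_eq] at hL hM
    simp only at hLM
    have key : ∀ i, k < i → L[i]? = M[i]? := by
      intro i hi
      have := congrArg (fun l => l[i - (k + 1)]?) hLM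
      simp only [List.getElem?_drop] at this
      rwa [Nat.add_sub_cancel' hi] at this
    apply List.ext_getElem?
    intro i
    by_cases hi : i ≤ k
    · rw [hL.2 i hi, hM.2 i hi]; exact key _ (hφ i hi)
    · exact key _ (not_le.mp hi)

open Classical in
theorem goodW_step {t n : ℕ} (ht : 4 ≤ t) :
    (2 * t + 2) * (GoodW t (2 * t + 2) n).card ≤ (GoodW t (2 * t + 2) (n + 1)).card +
      ((t - 1) * (GoodW t (2 * t + 2) n).card +
        ∑ m ∈ Finset.range n, 2 * t * (GoodW t (2 * t + 2) m).card) := by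
  set K := 2 * t + 2 with hK
  set C := (Finset.univ ×ˢ GoodW t K n).image (fun q : Fin K × List (Fin K) => q.1 :: q.2) with hC
  have hCcard : C.card = K * (GoodW t K n).card := by
    rw [hC, Finset.card_image_of_injective, Finset.card_product]
    · simp
    · rintro ⟨a, b⟩ ⟨c, d⟩ h
      simpa using h
  have hClen : ∀ L ∈ C, L.length = n + 1 := by
    intro L hL
    simp only [hC, Finset.mem_image, Finset.mem_product] at hL
    obtain ⟨q, ⟨-, hq⟩, rfl⟩ := hL
    simp [goodW_length hq]
  have hsplit : C.card = (GoodW t K (n + 1)).card + (C.filter (fun L => BadHead t L)).card := by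
    rw [← Finset.card_filter_add_card_filter_not (s := C) (fun L => BadHead t L), add_comm]
    rfl
  rw [← hCcard, hsplit]
  apply Nat.add_le_add_left
  let F1 : ℕ → Finset (List (Fin K)) := fun r => C.filter (fun L => ∀ i ≤ 0, L[i]? = L[i + r]?)
  let F2 : ℕ → ℕ → Finset (List (Fin K)) := fun k r =>
    C.filter (fun L => ∀ i ≤ k, L[i]? = L[i + (k * t + r)]?)
  let F3 : ℕ → ℕ → Finset (List (Fin K)) := fun k r =>
    C.filter (fun L => ∀ i ≤ k, L[i]? = L[k * t + 2 + r - i]?)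
  have hsub : C.filter (fun L => BadHead t L) ⊆ (Finset.Ico 1 t).biUnion F1 ∪
      (Finset.range n).biUnion (fun m => (Finset.range t).biUnion (fun r => F2 (n - m) r) ∪
        (Finset.range t).biUnion (fun r => F3 (n - m) r)) := by
    intro L hL
    rw [Finset.mem_filter] at hL
    obtain ⟨hLC, hbad⟩ := hL
    have hlen := hClen L hLC
    rw [Finset.mem_union]
    rcases hbad with ⟨r, h1, h2, h3, h4⟩ | ⟨k, r, h1, h2, h3, h4⟩ | ⟨k, r, h1, h2, h3, h4⟩
    · left
      rw [Finset.mem_biUnion]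
      refine ⟨r, Finset.mem_Ico.2 ⟨h1, h2⟩, ?_⟩
      simp only [F1, Finset.mem_filter]
      refine ⟨hLC, ?_⟩
      intro i hi
      obtain rfl : i = 0 := by omega
      simpa using h4
    · right
      have hkn : k ≤ n := by omega
      rw [Finset.mem_biUnion]
      refine ⟨n - k, Finset.mem_range.2 (by omega), ?_⟩
      rw [Finset.mem_union, Finset.mem_biUnion]
      left
      refine ⟨r, Finset.mem_range.2 h2, ?_⟩
      simp only [F2, Finset.mem_filter, Nat.sub_sub_self hkn]
      exact ⟨hLC, h4⟩
    · right
      have hkn : k ≤ n := by nlinarith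
      rw [Finset.mem_biUnion]
      refine ⟨n - k, Finset.mem_range.2 (by omega), ?_⟩
      rw [Finset.mem_union]
      right
      rw [Finset.mem_biUnion]
      refine ⟨r, Finset.mem_range.2 h2, ?_⟩
      simp only [F3, Finset.mem_filter, Nat.sub_sub_self hkn]
      exact ⟨hLC, h4⟩
  refine (Finset.card_le_card hsub).trans ((Finset.card_union_le _ _).trans (Nat.add_le_add ?_ ?_))
  · refine (Finset.card_biUnion_le_card_mul _ _ (GoodW t K n).card ?_).trans (by simp)
    intro r hr
    have h1 := (Finset.mem_Ico.1 hr).1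
    have := card_constraint (t := t) (K := K) (n := n) (k := 0) (Nat.zero_le _)
      (fun i => i + r) (by intro i _; omega)
    rw [Nat.sub_zero] at this
    convert this using 2
    simp only [F1, hC]
    congr
  · refine Finset.card_biUnion_le.trans (Finset.sum_le_sum ?_)
    intro m hm
    have hm := Finset.mem_range.1 hm
    refine (Finset.card_union_le _ _).trans ?_
    have e : 2 * t * (GoodW t K m).card = t * (GoodW t K m).card + t * (GoodW t K m).card := by ring
    rw [e]
    have hnm : n - (n - m) = m := by omega
    have hpos : 1 ≤ n - m := by omega
    have hkn : n - m ≤ n := by omega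
    generalize n - m = k at *
    have hkt : 4 * k ≤ k * t := by nlinarith
    apply Nat.add_le_add
    · refine (Finset.card_biUnion_le_card_mul _ _ (GoodW t K m).card ?_).trans (by simp)
      intro r _
      have := card_constraint (t := t) (K := K) (n := n) (k := k) hkn
        (fun i => i + (k * t + r)) (by intro i _; omega)
      rwa [hnm] at this
    · refine (Finset.card_biUnion_le_card_mul _ _ (GoodW t K m).card ?_).trans (by simp)
      intro r _
      have := card_constraint (t := t) (K := K) (n := n) (k := k) hkn
        (fun i => k * t + 2 + r - i) (by intro i _; omega)
      rwa [hnm] at this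

theorem goodW_inv {t : ℕ} (ht : 4 ≤ t) (n : ℕ) :
    2 * ∑ m ∈ Finset.range n, (GoodW t (2 * t + 2) m).card ≤ (GoodW t (2 * t + 2) n).card ∧
      0 < (GoodW t (2 * t + 2) n).card := by
  induction n with
  | zero => simp [GoodW]
  | succ n ih =>
    have h := goodW_step (n := n) ht
    rw [← Finset.mul_sum] at h
    rw [Finset.sum_range_succ]
    generalize (∑ m ∈ Finset.range n, (GoodW t (2 * t + 2) m).card) = T at *
    generalize (GoodW t (2 * t + 2) n).card = S at *
    generalize (GoodW t (2 * t + 2) (n + 1)).card = S' at *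
    obtain ⟨u, rfl⟩ : ∃ u, t = u + 1 := ⟨t - 1, by omega⟩
    simp only [Nat.add_sub_cancel] at h
    have h2 : (u + 1) * (2 * T) ≤ (u + 1) * S := Nat.mul_le_mul_left _ ih.1
    have : 3 * S ≤ S' := by nlinarith
    omega

theorem exists_word (t : ℕ) (ht : 4 ≤ t) : ∃ w : ℕ → Fin (2 * t + 2),
    (∀ N r, 1 ≤ r → r < t → r ≤ N → w N ≠ w (N - r)) ∧
    (∀ N k r, 1 ≤ k → r < t → k * t + r + k ≤ N →
      ¬ ∀ i ≤ k, w (N - i) = w (N - (i + (k * t + r)))) ∧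
    (∀ N k r, 1 ≤ k → r < t → k * t + 2 + r ≤ N →
      ¬ ∀ i ≤ k, w (N - i) = w (N - (k * t + 2 + r - i))) := by
  have hne : ∀ n, ∃ L, L ∈ GoodW t (2 * t + 2) n := fun n =>
    Finset.card_pos.1 (goodW_inv ht n).2
  choose L hL using hne
  let W : ℕ → ℕ → Fin (2 * t + 2) := fun n i => ((L n)[n - 1 - i]?).getD 0
  have hlim : ∀ i, ∃ x, ∀ᶠ n in (Filter.hyperfilter ℕ : Filter ℕ), W n i = x := by
    intro i
    have : ∀ᶠ n in (Filter.hyperfilter ℕ : Filter ℕ), ∃ x ∈ (Set.univ : Set (Fin (2 * t + 2))), W n i = x :=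
      Filter.Eventually.of_forall (fun n => ⟨_, trivial, rfl⟩)
    obtain ⟨x, -, hx⟩ := (Ultrafilter.eventually_exists_mem_iff Set.finite_univ).1 this
    exact ⟨x, hx⟩
  choose w hw using hlim
  have happ : ∀ N, ∃ M : List (Fin (2 * t + 2)), M.length = N + 1 ∧ ¬ BadHead t M ∧
      ∀ i ≤ N, M[i]? = some (w (N - i)) := by
    intro N
    have h1 : ∀ᶠ n in (Filter.hyperfilter ℕ : Filter ℕ), ∀ i ∈ Finset.range (N + 1), W n i = w i :=
      (Filter.eventually_all_finset _).2 (fun i _ => hw i)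
    have h2 : ∀ᶠ n in (Filter.hyperfilter ℕ : Filter ℕ), N + 1 ≤ n :=
      Nat.hyperfilter_le_atTop (Filter.eventually_ge_atTop (N + 1))
    obtain ⟨n, hn1, hn2⟩ := (h1.and h2).exists
    obtain ⟨d, rfl⟩ : ∃ d, n = (N + 1) + d := ⟨n - (N + 1), by omega⟩
    have hg := goodW_drop (hL (N + 1 + d))
    refine ⟨_, goodW_length hg, goodW_not_bad hg, ?_⟩
    intro i hi
    rw [← hn1 (N - i) (Finset.mem_range.2 (by omega)), List.getElem?_drop]
    simp only [W]
    have e : N + 1 + d - 1 - (N - i) = d + i := by omega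
    rw [e]
    have : d + i < (L (N + 1 + d)).length := by rw [goodW_length (hL _)]; omega
    simp [this]
  refine ⟨w, ?_, ?_, ?_⟩
  · intro N r h1 h2 h3 h
    obtain ⟨M, hl, hb, hM⟩ := happ N
    apply hb
    left
    refine ⟨r, h1, h2, by omega, ?_⟩
    rw [hM 0 (by omega), hM r h3]
    simpa using h
  · intro N k r h1 h2 h3 h
    obtain ⟨M, hl, hb, hM⟩ := happ N
    apply hb
    right; left
    refine ⟨k, r, h1, h2, by omega, ?_⟩
    intro i hi
    rw [hM i (by omega), hM _ (by omega), h i hi]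
  · intro N k r h1 h2 h3 h
    obtain ⟨M, hl, hb, hM⟩ := happ N
    apply hb
    right; right
    refine ⟨k, r, h1, h2, by omega, ?_⟩
    intro i hi
    have : k * 4 ≤ k * t := Nat.mul_le_mul_left _ ht
    rw [hM i (by omega), hM _ (by omega), h i hi]

/-- The properties of the level word. -/
def LevelWord {α : Type*} (t : ℕ) (w : ℕ → α) : Prop :=
    (∀ N r, 1 ≤ r → r < t → r ≤ N → w N ≠ w (N - r)) ∧
    (∀ N k r, 1 ≤ k → r < t → k * t + r + k ≤ N →
      ¬ ∀ i ≤ k, w (N - i) = w (N - (i + (k * t + r)))) ∧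
    (∀ N k r, 1 ≤ k → r < t → k * t + 2 + r ≤ N →
      ¬ ∀ i ≤ k, w (N - i) = w (N - (k * t + 2 + r - i)))

theorem LevelWord.near {α : Type*} {t : ℕ} {w : ℕ → α} (h : LevelWord t w) {x y : ℕ}
    (hxy : w x = w y) (h1 : x < y + t) (h2 : y < x + t) : x = y := by
  rcases lt_trichotomy x y with hlt | rfl | hlt
  · have := h.1 y (y - x) (by omega) (by omega) (by omega)
    rw [Nat.sub_sub_self hlt.le] at this
    exact absurd hxy.symm this
  · rfl
  · have := h.1 x (x - y) (by omega) (by omega) (by omega)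
    rw [Nat.sub_sub_self hlt.le] at this
    exact absurd hxy this

/-- No long repetition in the level word. -/
theorem LevelWord.rep {α : Type*} {t : ℕ} {w : ℕ → α} (h : LevelWord t w) {x P k : ℕ}
    (hP : 1 ≤ P) (hk1 : k * t ≤ P) (hk2 : P < (k + 1) * t)
    (heq : ∀ i ≤ k, w (x + i) = w (x + P + i)) : False := by
  rw [add_mul, one_mul] at hk2
  rcases Nat.eq_zero_or_pos k with rfl | hk
  · have := h.near (heq 0 le_rfl) (by omega) (by omega)
    omega
  · obtain ⟨r, rfl⟩ := Nat.exists_eq_add_of_le hk1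
    apply h.2.1 (x + (k * t + r) + k) k r hk (by omega) (by omega)
    intro i hi
    have := heq (k - i) (by omega)
    rw [show x + (k * t + r) + k - i = x + (k * t + r) + (k - i) by omega, ← this]
    congr 1
    omega

/-- No near reversal in the level word. -/
theorem LevelWord.rev {α : Type*} {t : ℕ} {w : ℕ → α} (ht : 4 ≤ t) (h : LevelWord t w)
    {x y k : ℕ} (hxy : x < y) (hkx : k ≤ x) (hg : y + 2 * k < x + (k + 1) * t)
    (heq : ∀ i ≤ k, w (x - i) = w (y + i)) : False := by
  by_cases hgt : y < x + t
  · have := h.near (heq 0 (Nat.zero_le _)) (by omega) (by omega)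
    omega
  · obtain ⟨g, rfl⟩ : ∃ g, y = x + (g + 2) := ⟨y - x - 2, by omega⟩
    obtain ⟨u, rfl⟩ : ∃ u, t = u + 2 := ⟨t - 2, by omega⟩
    have hu : 0 < u := by omega
    have hdm := Nat.div_add_mod g u
    have hr := Nat.mod_lt g hu
    have hk1 : 1 ≤ g / u := (Nat.one_le_div_iff hu).2 (by omega)
    have hkk : g / u ≤ k := by
      apply Nat.le_of_lt_succ
      rw [Nat.div_lt_iff_lt_mul hu]
      rw [Nat.succ_eq_add_one]
      nlinarith
    generalize g / u = k' at *
    generalize g % u = r at *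
    have e : k' * (u + 2) + 2 + r = g + 2 + 2 * k' := by rw [← hdm]; ring
    apply h.2.2 (x + (g + 2) + k') k' r hk1 (by omega) (by omega)
    intro i hi
    rw [e]
    have := heq (k' - i) (by omega)
    rw [show x + (g + 2) + k' - i = x + (g + 2) + (k' - i) by omega, ← this]
    congr 1
    omega

theorem LevelWord.rev' {α : Type*} {t : ℕ} {w : ℕ → α} (ht : 4 ≤ t) (h : LevelWord t w)
    {m u v k : ℕ} (hk : 1 ≤ k) (hku : k ≤ u) (hk2 : u + v < (k + 1) * t)
    (heq : ∀ i ≤ k, w (m + u - i) = w (m + v + i)) : False := by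
  by_cases h1 : u < v
  · exact h.rev ht (x := m + u) (y := m + v) (k := k) (by omega) (by omega) (by omega) heq
  by_cases h2 : v + 2 * k < u
  · refine h.rev ht (x := m + v + k) (y := m + u - k) (k := k) (by omega) (by omega) (by omega) ?_
    intro i hi
    have := heq (k - i) (by omega)
    rw [show m + v + k - i = m + v + (k - i) by omega, ← this]
    congr 1
    omega
  · have hd := heq ((u - v) / 2) (by omega)
    have := h.near hd (by omega) (by omega)
    by_cases h0 : (u - v) / 2 = 0
    · have := h.near (heq 1 (by omega)) (by omega) (by omega)
      omega
    · have := h.near (heq ((u - v) / 2 - 1) (by omega)) (by omega) (by omega)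
      omega

theorem turn_exists (f : ℕ → List Bool) (n : ℕ)
    (hadj : ∀ i < n, (∃ x, f (i + 1) = f i ++ [x]) ∨ ∃ x, f i = f (i + 1) ++ [x])
    (hinj : ∀ i ≤ n, ∀ j ≤ n, f i = f j → i = j) :
    ∃ s ≤ n, (∀ i < s, ∃ x, f i = f (i + 1) ++ [x]) ∧
      ∀ i, s ≤ i → i < n → ∃ x, f (i + 1) = f i ++ [x] := by
  induction n with
  | zero => exact ⟨0, le_rfl, by omega, by omega⟩
  | succ n ih =>
    obtain ⟨s, hs, hup, hdown⟩ := ih (fun i hi => hadj i (by omega))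
      (fun i hi j hj => hinj i (by omega) j (by omega))
    rcases hadj n (by omega) with hd | hu
    · refine ⟨s, by omega, hup, ?_⟩
      intro i h1 h2
      rcases Nat.lt_succ_iff_lt_or_eq.1 h2 with h3 | rfl
      · exact hdown i h1 h3
      · exact hd
    · rcases Nat.lt_or_eq_of_le hs with h | rfl
      · exfalso
        obtain ⟨x, hx⟩ := hdown (n - 1) (by omega) (by omega)
        obtain ⟨y, hy⟩ := hu
        rw [Nat.sub_add_cancel (by omega : 1 ≤ n)] at hx
        rw [hx] at hy
        have := hinj _ (by omega) _ (by omega) (List.append_inj_left' hy rfl)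
        omega
      · refine ⟨s + 1, le_rfl, ?_, by omega⟩
        intro i hi
        rcases Nat.lt_succ_iff_lt_or_eq.1 hi with h3 | rfl
        · exact hup i h3
        · exact hu

/-- The last `q` direction bits of a vertex. -/
def lastBits (q : ℕ) (v : List Bool) : Fin q → Bool := fun i => (v.reverse[(i : ℕ)]?).getD false

theorem eq_of_lastBits {q : ℕ} {v z a : List Bool} (hv : a <+: v) (hz : a <+: z)
    (hl : v.length = z.length) (hq : v.length ≤ a.length + q)
    (hb : lastBits q v = lastBits q z) : v = z := by
  obtain ⟨v', rfl⟩ := hv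
  obtain ⟨z', rfl⟩ := hz
  simp only [List.length_append] at hl hq
  congr 1
  rw [← List.reverse_inj]
  apply List.ext_getElem (by simp; omega)
  intro i h1 h2
  have h1' := h1
  have h2' := h2
  rw [List.length_reverse] at h1' h2'
  have := congrFun hb ⟨i, by omega⟩
  simpa [lastBits, List.getElem?_append, h1', h2'] using this

theorem path_core {α : Type*} {t q n : ℕ} (ht : 4 ≤ t) (hq : t ≤ 2 * q + 2) {w : ℕ → α}
    (hw : LevelWord t w) (f : ℕ → List Bool)
    (hadj : ∀ i < n, (∃ x, f (i + 1) = f i ++ [x]) ∨ ∃ x, f i = f (i + 1) ++ [x])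
    (hinj : ∀ i ≤ n, ∀ j ≤ n, f i = f j → i = j) {a P k : ℕ} (hP : 1 ≤ P)
    (hk1 : k * t ≤ P) (hk2 : P < (k + 1) * t) (han : a + P + k ≤ n)
    (hc : ∀ i ≤ k, w (f (a + i)).length = w (f (a + P + i)).length ∧
      lastBits q (f (a + i)) = lastBits q (f (a + P + i))) : False := by
  obtain ⟨s, hs, hup, hdown⟩ := turn_exists f n hadj hinj
  have U : ∀ d ≤ s, f s <+: f (s - d) ∧ (f (s - d)).length = (f s).length + d := by
    intro d
    induction d with
    | zero => simp
    | succ d ih =>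
      intro hd
      obtain ⟨h1, h2⟩ := ih (by omega)
      obtain ⟨x, hx⟩ := hup (s - (d + 1)) (by omega)
      rw [show s - (d + 1) + 1 = s - d by omega] at hx
      rw [hx]
      exact ⟨h1.trans (List.prefix_append _ _), by simp [h2]; omega⟩
  have Dn : ∀ d, s + d ≤ n → f s <+: f (s + d) ∧ (f (s + d)).length = (f s).length + d := by
    intro d
    induction d with
    | zero => simp
    | succ d ih =>
      intro hd
      obtain ⟨h1, h2⟩ := ih (by omega)
      obtain ⟨x, hx⟩ := hdown (s + d) (by omega) (by omega)
      rw [← add_assoc, hx]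
      exact ⟨h1.trans (List.prefix_append _ _), by simp [h2]; omega⟩
  have U' : ∀ i ≤ s, f s <+: f i ∧ (f i).length = (f s).length + (s - i) := by
    intro i hi
    have := U (s - i) (by omega)
    rwa [Nat.sub_sub_self hi] at this
  have D' : ∀ i ≤ n, s ≤ i → f s <+: f i ∧ (f i).length = (f s).length + (i - s) := by
    intro i hi hsi
    have := Dn (i - s) (by omega)
    rwa [Nat.add_sub_cancel' hsi] at this
  generalize hm : (f s).length = m at *
  have hkP : k + 1 ≤ P := by
    have : k * 4 ≤ k * t := Nat.mul_le_mul_left _ ht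
    omega
  by_cases c1 : s ≤ a
  · refine hw.rep (x := m + (a - s)) hP hk1 hk2 ?_
    intro i hi
    have := (hc i hi).1
    rw [(D' _ (by omega) (by omega)).2, (D' _ (by omega) (by omega)).2] at this
    convert this using 2 <;> omega
  by_cases c2 : a + P + k ≤ s
  · refine hw.rep (x := m + (s - (a + P + k))) hP hk1 hk2 ?_
    intro i hi
    have := (hc (k - i) (by omega)).1
    rw [(U' _ (by omega)).2, (U' _ (by omega)).2] at this
    rw [eq_comm]
    convert this using 2 <;> omega
  rcases Nat.eq_zero_or_pos k with rfl | hk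
  · obtain ⟨h1, h2⟩ := hc 0 le_rfl
    simp only [add_zero, zero_mul, zero_add, one_mul] at *
    have ha := U' a (by omega)
    have hb := D' (a + P) (by omega) (by omega)
    have hl : (f a).length = (f (a + P)).length := hw.near h1 (by omega) (by omega)
    have := hinj a (by omega) (a + P) (by omega)
      (eq_of_lastBits ha.1 hb.1 hl (by omega) h2)
    omega
  by_cases c3 : s < a + k
  · have h1 := (hc (s - 1 - a) (by omega)).1
    have h2 := (hc (s + 1 - a) (by omega)).1
    rw [(U' _ (by omega)).2, (D' _ (by omega) (by omega)).2] at h1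
    rw [(D' _ (by omega) (by omega)).2, (D' _ (by omega) (by omega)).2] at h2
    rw [show m + (s - (a + (s - 1 - a))) = m + (a + (s + 1 - a) - s) by omega, h2] at h1
    have := hw.near h1 (by omega) (by omega)
    omega
  by_cases c4 : a + P < s
  · have h1 := (hc (s - 1 - a - P) (by omega)).1
    have h2 := (hc (s + 1 - a - P) (by omega)).1
    rw [(U' _ (by omega)).2, (U' _ (by omega)).2] at h1
    rw [(U' _ (by omega)).2, (D' _ (by omega) (by omega)).2] at h2
    rw [show m + (s - (a + P + (s - 1 - a - P))) = m + (a + P + (s + 1 - a - P) - s) by omega,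
      ← h2] at h1
    have := hw.near h1 (by omega) (by omega)
    omega
  refine hw.rev' ht (m := m) (u := s - a) (v := a + P - s) hk (by omega) (by omega) ?_
  intro i hi
  have := (hc i hi).1
  rw [(U' _ (by omega)).2, (D' _ (by omega) (by omega)).2] at this
  convert this using 2 <;> omega

/-- For every `t ≥ 4`, the infinite rooted binary tree admits a coloring with
`(t+1)·2^⌊(t+1)/2⌋` colors that is `(1 + 1/t)⁺`-free. -/
theorem binTree_coloring_free (t : ℕ) (ht : 4 ≤ t) :
    ∃ c : List Bool → Fin ((t + 1) * 2 ^ ((t + 1) / 2)),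
      ColoringFreePlus BinTree c (1 + 1 / (t : ℝ)) := by
  obtain ⟨w, hw⟩ := exists_word t ht
  have hw : LevelWord t w := hw
  obtain ⟨q, hq⟩ : ∃ q, (t + 1) / 2 = q + 1 := ⟨(t + 1) / 2 - 1, by omega⟩
  have hcard : Fintype.card (Fin (2 * t + 2) × (Fin q → Bool)) =
      (t + 1) * 2 ^ ((t + 1) / 2) := by
    rw [hq]
    simp only [Fintype.card_prod, Fintype.card_fin, Fintype.card_pi, Fintype.card_bool,
      Finset.prod_const, Finset.card_univ, pow_succ]
    ring
  let e := Fintype.equivFinOfCardEq hcard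
  refine ⟨fun v => e (w v.length, lastBits q v), ?_⟩
  intro u v p hp hrep
  obtain ⟨x, y, hx, ⟨l, r, hlr⟩, hpre, hβ⟩ := hrep
  have hP : 1 ≤ x.length := List.length_pos_iff.2 hx
  have hlt : x.length < t * y.length := by
    have hxp : (0 : ℝ) < x.length := by exact_mod_cast hP
    have htp : (0 : ℝ) < t := by exact_mod_cast (by omega : 0 < t)
    have h2 : ((x.length : ℝ) + y.length) / x.length = 1 + y.length / x.length := by
      field_simp
    rw [h2] at hβ
    have h3 := lt_of_add_lt_add_left hβ
    rw [div_lt_div_iff₀ htp hxp] at h3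
    have : (x.length : ℝ) < ((t * y.length : ℕ) : ℝ) := by
      push_cast
      linarith
    exact_mod_cast this
  have hlen := congrArg List.length hlr
  simp only [List.length_append, List.length_map, Walk.length_support] at hlen
  have hk : x.length / t < y.length := by
    rw [Nat.div_lt_iff_lt_mul (by omega)]
    linarith
  have hdm := Nat.div_add_mod x.length t
  have hml := Nat.mod_lt x.length (by omega : 0 < t)
  refine path_core (n := p.length) (q := q) (a := l.length) (P := x.length) (k := x.length / t)
    ht (by omega) hw p.getVert ?_ ?_ hP (Nat.div_mul_le_self _ _) ?_ ?_ ?_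
  · intro i hi
    have := p.adj_getVert_succ hi
    simpa [BinTree, SimpleGraph.fromRel_adj] using this.2
  · intro i hi j hj hij
    exact hp.getVert_injOn hi hj hij
  · linarith
  · omega
  · intro i hi
    have g : ∀ j, j < x.length + y.length →
        (x ++ y)[j]? = some (e (w (p.getVert (l.length + j)).length,
          lastBits q (p.getVert (l.length + j)))) := by
      intro j hj
      have h1 : (l ++ (x ++ y) ++ r)[l.length + j]? = (x ++ y)[j]? := by
        rw [List.append_assoc, List.getElem?_append_right (by omega), Nat.add_sub_cancel_left,
          List.getElem?_append_left (by simpa using hj)]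
      rw [← h1, hlr, List.getElem?_map, ← p.getVert_eq_support_getElem? (by omega)]
      rfl
    have h1 := g i (by omega)
    have h2 := g (x.length + i) (by omega)
    have h3 : (x ++ y)[x.length + i]? = (x ++ y)[i]? := by
      rw [List.getElem?_append_right (by omega), Nat.add_sub_cancel_left]
      obtain ⟨z, hz⟩ := hpre
      rw [← hz, List.getElem?_append_left (by omega)]
    rw [h3, h1] at h2
    have := e.injective (Option.some.inj h2)
    rw [Prod.mk.injEq, ← add_assoc] at this
    exact this
end
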